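/- Let ω ⊂ ℝ^d be an open, bounded domain and k ≥ 1. For every v ∈ C²(ω̄, ℝ^k), w ∈ C²(ω̄, ℝ^d) and A ∈ C^{0,β}(ω̄, ℝ^{d×d}_sym) with 0 < β ≤ 1 such that the deficit D = A − (½(∇v)ᵀ∇v + sym∇w) satisfies 0 < ‖D‖₀ ≤ 1, and for every exponent α with 0 < α < min{β/2, 1/(1 + d(d+1)/k)} (or 0 < α < min{β/2, 1} when k ≥ d(d+1)), there exist ṽ ∈ C^{1,α}(ω̄, ℝ^k) and w̃ ∈ C^{1,α}(ω̄, ℝ^d) such that ‖ṽ − v‖₁ ≤ C‖D‖₀^{1/2}, ‖w̃ − w‖₁ ≤ C‖D‖₀^{1/2}(1 + ‖∇v‖₀), and A − (½(∇ṽ)ᵀ∇ṽ + sym∇w̃) = 0 on ω̄, where the constants C depend only on d, k and ω. -/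

import Mathlib

noncomputable section
open MeasureTheory Real
open scoped BigOperators ENNReal NNReal

/-- Partial derivative of `f` in the `i`-th coordinate direction. -/
def pd {d : ℕ} {E : Type*} [NormedAddCommGroup E] [NormedSpace ℝ E]
    (i : Fin d) (f : (Fin d → ℝ) → E) (x : Fin d → ℝ) : E :=
  fderiv ℝ f x (Pi.single i 1)

/-- The matrix `(∇v)ᵀ∇v`, with entries `⟨∂ᵢv, ∂ⱼv⟩`. -/
def gradTgrad {d k : ℕ} (v : (Fin d → ℝ) → Fin k → ℝ) (x : Fin d → ℝ) :
    Fin d → Fin d → ℝ :=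
  fun i j => ∑ l, pd i (fun y => v y l) x * pd j (fun y => v y l) x

/-- The symmetrized gradient `sym∇w = ½(∇w + (∇w)ᵀ)`. -/
def symGrad {d : ℕ} (w : (Fin d → ℝ) → Fin d → ℝ) (x : Fin d → ℝ) :
    Fin d → Fin d → ℝ :=
  fun i j => (pd i (fun y => w y j) x + pd j (fun y => w y i) x) / 2

/-- The deficit `D = A − (½(∇v)ᵀ∇v + sym∇w)`. -/
def deficit {d k : ℕ} (A : (Fin d → ℝ) → Fin d → Fin d → ℝ)
    (v : (Fin d → ℝ) → Fin k → ℝ) (w : (Fin d → ℝ) → Fin d → ℝ)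
    (x : Fin d → ℝ) : Fin d → Fin d → ℝ :=
  fun i j => A x i j - ((1/2) * gradTgrad v x i j + symGrad w x i j)

/-- `C⁰` norm of `f` on the closure of `ω`. -/
def supNorm {d : ℕ} {E : Type*} [NormedAddCommGroup E]
    (ω : Set (Fin d → ℝ)) (f : (Fin d → ℝ) → E) : ℝ :=
  ⨆ x : closure ω, ‖f x.1‖

/-- `f` is (globally) `β`-Hölder, i.e. the restriction of a `C^{0,β}` map of `ℝ^d`. -/
def IsHolder {d : ℕ} {E : Type*} [NormedAddCommGroup E] (β : ℝ)
    (f : (Fin d → ℝ) → E) : Prop :=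
  ∃ C : ℝ≥0, HolderWith C β.toNNReal f

/-- `f` is of class `C^{1,α}`: it is `C¹` and its gradient is `α`-Hölder. -/
def IsC1Holder {d : ℕ} {E : Type*} [NormedAddCommGroup E] [NormedSpace ℝ E] (α : ℝ)
    (f : (Fin d → ℝ) → E) : Prop :=
  ContDiff ℝ 1 f ∧ IsHolder α (fderiv ℝ f)

/-- `M > c·Id` in the sense of quadratic forms. -/
def MatGt {d : ℕ} (M : Fin d → Fin d → ℝ) (c : ℝ) : Prop :=
  ∀ ξ : Fin d → ℝ, ξ ≠ 0 → c * ∑ i, ξ i ^ 2 < ∑ i, ∑ j, M i j * ξ i * ξ j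

/-- supremum norm of the gradient on the closure of `ω`. -/
def grad1Norm {d : ℕ} {E : Type*} [NormedAddCommGroup E] [NormedSpace ℝ E]
    (ω : Set (Fin d → ℝ)) (f : (Fin d → ℝ) → E) : ℝ :=
  ⨆ x : closure ω, ‖fderiv ℝ f x.1‖

/-- supremum norm of the Hessian on the closure of `ω`. -/
def grad2Norm {d : ℕ} {E : Type*} [NormedAddCommGroup E] [NormedSpace ℝ E]
    (ω : Set (Fin d → ℝ)) (f : (Fin d → ℝ) → E) : ℝ :=
  ⨆ x : closure ω, ‖fderiv ℝ (fderiv ℝ f) x.1‖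

/-- `C¹` norm on the closure of `ω`. -/
def C1Norm {d : ℕ} {E : Type*} [NormedAddCommGroup E] [NormedSpace ℝ E]
    (ω : Set (Fin d → ℝ)) (f : (Fin d → ℝ) → E) : ℝ :=
  supNorm ω f + grad1Norm ω f

/-- `C²` norm on the closure of `ω`. -/
def C2Norm {d : ℕ} {E : Type*} [NormedAddCommGroup E] [NormedSpace ℝ E]
    (ω : Set (Fin d → ℝ)) (f : (Fin d → ℝ) → E) : ℝ :=
  supNorm ω f + grad1Norm ω f + grad2Norm ω f

/-- Hölder `C^{0,β}` norm on the closure of `ω`. -/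
def holderNorm {d : ℕ} {E : Type*} [NormedAddCommGroup E] (β : ℝ)
    (ω : Set (Fin d → ℝ)) (f : (Fin d → ℝ) → E) : ℝ :=
  supNorm ω f +
    ⨆ p : (closure ω) × (closure ω),
      ‖f p.1.1 - f p.2.1‖ / ‖(p.1.1 : Fin d → ℝ) - (p.2.1 : Fin d → ℝ)‖ ^ β

/-- The open strip of half-width `ρ` around the real points of `ℂ^d`. -/
def strip (d : ℕ) (ρ : ℝ) : Set (Fin d → ℂ) := {z | ∀ i, |(z i).im| < ρ}

/-- The inclusion of `ℝ^d` in `ℂ^d`. -/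
def toC {d : ℕ} (x : Fin d → ℝ) : Fin d → ℂ := fun i => (x i : ℂ)

/-- `f` is the restriction to the real points of a function that is holomorphic and bounded by `A`
on the strip of half-width `ρ`. -/
def HolBdd {d : ℕ} (ρ A : ℝ) (f : (Fin d → ℝ) → ℝ) : Prop :=
  ∃ F : (Fin d → ℂ) → ℂ, ContDiffOn ℂ (⊤ : ℕ∞) F (strip d ρ) ∧ (∀ z ∈ strip d ρ, ‖F z‖ ≤ A) ∧
    ∀ x, F (toC x) = (f x : ℂ)

section HolBdd

variable {d : ℕ}

theorem isOpen_strip (ρ : ℝ) : IsOpen (strip d ρ) := by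
  have : strip d ρ = ⋂ i, {z : Fin d → ℂ | |(z i).im| < ρ} := by
    ext z; simp [strip]
  rw [this]
  refine isOpen_iInter_of_finite fun i => ?_
  exact isOpen_lt (by fun_prop) continuous_const

theorem toC_mem_strip {ρ : ℝ} (hρ : 0 < ρ) (x : Fin d → ℝ) : toC x ∈ strip d ρ := by
  intro i; simpa [toC] using hρ

theorem strip_mono {ρ ρ' : ℝ} (h : ρ' ≤ ρ) : strip d ρ' ⊆ strip d ρ :=
  fun _ hz i => (hz i).trans_le h

/-- The real-linear inclusion of `ℝ^d` in `ℂ^d`. -/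
def toCL (d : ℕ) : (Fin d → ℝ) →L[ℝ] (Fin d → ℂ) :=
  ContinuousLinearMap.pi fun i => Complex.ofRealCLM.comp (ContinuousLinearMap.proj i)

theorem toCL_apply (x : Fin d → ℝ) : toCL d x = toC x := by
  ext i; simp [toCL, toC]

theorem toC_single (i : Fin d) : toC (Pi.single i (1 : ℝ)) = Pi.single i (1 : ℂ) := by
  ext j
  by_cases h : j = i
  · subst h; simp [toC]
  · simp [toC, h]

namespace HolBdd

variable {ρ ρ' A A' B : ℝ} {f g : (Fin d → ℝ) → ℝ}

theorem mono (h : HolBdd ρ A f) (hρ : ρ' ≤ ρ) (hA : A ≤ A') : HolBdd ρ' A' f := by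
  obtain ⟨F, h1, h2, h3⟩ := h
  exact ⟨F, h1.mono (strip_mono hρ), fun z hz => (h2 z (strip_mono hρ hz)).trans hA, h3⟩

theorem shrink (h : HolBdd ρ A f) (hρ : ρ' ≤ ρ) : HolBdd ρ' A f := h.mono hρ le_rfl

theorem weaken (h : HolBdd ρ A f) (hA : A ≤ A') : HolBdd ρ A' f := h.mono le_rfl hA

theorem congr (h : HolBdd ρ A f) (hfg : ∀ x, f x = g x) : HolBdd ρ A g := by
  rwa [← funext hfg]

theorem const (c : ℝ) : HolBdd ρ |c| (fun _ : Fin d → ℝ => c) :=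
  ⟨fun _ => c, contDiffOn_const, fun z _ => by simp, fun _ => rfl⟩

theorem add (hf : HolBdd ρ A f) (hg : HolBdd ρ B g) : HolBdd ρ (A + B) (fun x => f x + g x) := by
  obtain ⟨F, h1, h2, h3⟩ := hf
  obtain ⟨G, k1, k2, k3⟩ := hg
  exact ⟨fun z => F z + G z, h1.add k1,
    fun z hz => (norm_add_le _ _).trans (add_le_add (h2 z hz) (k2 z hz)),
    fun x => by simp [h3, k3]⟩

theorem neg (hf : HolBdd ρ A f) : HolBdd ρ A (fun x => -f x) := by
  obtain ⟨F, h1, h2, h3⟩ := hf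
  exact ⟨fun z => -F z, h1.neg, fun z hz => by simpa using h2 z hz, fun x => by simp [h3]⟩

theorem sub (hf : HolBdd ρ A f) (hg : HolBdd ρ B g) : HolBdd ρ (A + B) (fun x => f x - g x) := by
  simpa [sub_eq_add_neg] using hf.add hg.neg

theorem nonneg (hρ : 0 < ρ) (hf : HolBdd ρ A f) : 0 ≤ A := by
  obtain ⟨F, h1, h2, h3⟩ := hf
  exact (norm_nonneg _).trans (h2 _ (toC_mem_strip hρ 0))

theorem abs_le (hρ : 0 < ρ) (hf : HolBdd ρ A f) (x : Fin d → ℝ) : |f x| ≤ A := by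
  obtain ⟨F, h1, h2, h3⟩ := hf
  have := h2 _ (toC_mem_strip hρ x)
  rwa [h3, Complex.norm_real] at this

theorem mul (hf : HolBdd ρ A f) (hg : HolBdd ρ B g) (hρ : 0 < ρ) :
    HolBdd ρ (A * B) (fun x => f x * g x) := by
  have hA := hf.nonneg hρ
  obtain ⟨F, h1, h2, h3⟩ := hf
  obtain ⟨G, k1, k2, k3⟩ := hg
  exact ⟨fun z => F z * G z, h1.mul k1,
    fun z hz => by
      rw [norm_mul]
      exact mul_le_mul (h2 z hz) (k2 z hz) (norm_nonneg _) hA,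
    fun x => by simp [h3, k3]⟩

theorem const_mul (c : ℝ) (hf : HolBdd ρ A f) : HolBdd ρ (|c| * A) (fun x => c * f x) := by
  obtain ⟨F, h1, h2, h3⟩ := hf
  refine ⟨fun z => (c : ℂ) * F z, contDiffOn_const.mul h1, fun z hz => ?_, fun x => by simp [h3]⟩
  rw [norm_mul, Complex.norm_real]
  exact mul_le_mul_of_nonneg_left (h2 z hz) (abs_nonneg _)

theorem sum {ι : Type*} (s : Finset ι) {A : ι → ℝ} {f : ι → (Fin d → ℝ) → ℝ}
    (h : ∀ i ∈ s, HolBdd ρ (A i) (f i)) : HolBdd ρ (∑ i ∈ s, A i) (fun x => ∑ i ∈ s, f i x) := by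
  classical
  induction s using Finset.induction_on with
  | empty => simpa using const (d := d) (ρ := ρ) 0
  | insert a s ha ih =>
    simp only [Finset.sum_insert ha]
    exact (h a (by simp)).add (ih fun i hi => h i (by simp [hi]))

theorem contDiff (hρ : 0 < ρ) (hf : HolBdd ρ A f) : ContDiff ℝ (⊤ : ℕ∞) f := by
  obtain ⟨F, h1, h2, h3⟩ := hf
  have : f = fun x => Complex.reCLM (F (toCL d x)) := by
    ext x; rw [toCL_apply, h3]; simp
  rw [this]
  refine Complex.reCLM.contDiff.comp ?_
  rw [← contDiffOn_univ]
  exact (h1.restrict_scalars ℝ).comp (toCL d).contDiff.contDiffOn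
    (fun x _ => by rw [toCL_apply]; exact toC_mem_strip hρ x)

theorem pd (hρ : 0 < ρ) (hf : HolBdd ρ A f) (i : Fin d) :
    HolBdd (ρ / 2) (2 * A / ρ) (pd i f) := by
  obtain ⟨F, h1, h2, h3⟩ := hf
  have ho := isOpen_strip (d := d) ρ
  refine ⟨fun z => fderiv ℂ F z (Pi.single i 1), ?_, ?_, ?_⟩
  · have := (h1.fderiv_of_isOpen (m := (⊤ : ℕ∞)) ho (by simp)).clm_apply
      (contDiffOn_const (c := (Pi.single i (1 : ℂ) : Fin d → ℂ)))
    exact this.mono (strip_mono (by linarith))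
  · intro z hz
    set γ : ℂ → (Fin d → ℂ) := fun t => z + t • (Pi.single i (1 : ℂ)) with hγ
    have hmem : ∀ t : ℂ, ‖t‖ ≤ ρ / 2 → γ t ∈ strip d ρ := by
      intro t ht j
      have h4 := hz j
      have h5 : |t.im| ≤ ρ / 2 := (Complex.abs_im_le_norm t).trans ht
      by_cases hj : j = i
      · subst hj
        simp only [hγ, Pi.add_apply, Pi.smul_apply, Pi.single_eq_same, smul_eq_mul, mul_one,
          Complex.add_im]
        exact (abs_add_le _ _).trans_lt (by linarith)
      · simp only [hγ, Pi.add_apply, Pi.smul_apply, Pi.single_eq_of_ne hj, smul_eq_mul, mul_zero,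
          add_zero]
        linarith
    have hder : ∀ t : ℂ, ‖t‖ ≤ ρ / 2 →
        HasDerivAt (fun t => F (γ t)) (fderiv ℂ F (γ t) (Pi.single i 1)) t := by
      intro t ht
      have hd : HasFDerivAt F (fderiv ℂ F (γ t)) (γ t) :=
        ((h1.contDiffAt (ho.mem_nhds (hmem t ht))).differentiableAt (by simp)).hasFDerivAt
      have hg : HasDerivAt γ (Pi.single i (1 : ℂ)) t := by
        have := ((hasDerivAt_id t).smul_const (Pi.single i (1 : ℂ) : Fin d → ℂ)).const_add z
        simpa [hγ] using this
      exact hd.comp_hasDerivAt t hg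
    have hd0 := (hder 0 (by simp; linarith)).deriv
    have hγ0 : γ 0 = z := by simp [hγ]
    rw [hγ0] at hd0
    show ‖fderiv ℂ F z (Pi.single i 1)‖ ≤ _
    rw [← hd0]
    have hcl : DiffContOnCl ℂ (fun t => F (γ t)) (Metric.ball 0 (ρ / 2)) := by
      apply DifferentiableOn.diffContOnCl
      intro t ht
      have ht' : ‖t‖ ≤ ρ / 2 := by
        have := Metric.closure_ball_subset_closedBall ht
        simpa using this
      exact (hder t ht').differentiableAt.differentiableWithinAt
    have := Complex.norm_deriv_le_of_forall_mem_sphere_norm_le (half_pos hρ) hcl (C := A)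
      (fun t ht => h2 _ (hmem t (by simpa using ht.le)))
    refine this.trans (le_of_eq ?_)
    field_simp
  · intro x
    have hd : HasFDerivAt F (fderiv ℂ F (toC x)) (toC x) :=
      ((h1.contDiffAt (ho.mem_nhds (toC_mem_strip hρ x))).differentiableAt (by simp)).hasFDerivAt
    have h4 : HasFDerivAt (fun y => F (toCL d y))
        (((fderiv ℂ F (toC x)).restrictScalars ℝ).comp (toCL d)) x := by
      have h5 : HasFDerivAt F ((fderiv ℂ F (toC x)).restrictScalars ℝ) (toCL d x) := by
        rw [toCL_apply]; exact hd.restrictScalars ℝ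
      exact h5.comp x (toCL d).hasFDerivAt
    have h6 : (fun y => F (toCL d y)) = fun y => Complex.ofRealCLM (f y) := by
      ext y; rw [toCL_apply, h3]; simp
    rw [h6] at h4
    have hfd : HasFDerivAt f (fderiv ℝ f x) x :=
      (((contDiff hρ ⟨F, h1, h2, h3⟩).differentiable (by simp)) x).hasFDerivAt
    have h7 := Complex.ofRealCLM.hasFDerivAt.comp x hfd
    have h8 := h4.unique h7
    have h9 := congrArg (fun L => L (Pi.single i (1 : ℝ))) h8
    simpa [toCL_apply, toC_single, _root_.pd] using h9

end HolBdd

end HolBdd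

section HolBddFunctions

variable {d : ℕ}

theorem norm_cexp_mul_I_le (z : ℂ) : ‖Complex.exp (z * Complex.I)‖ ≤ Real.exp |z.im| := by
  rw [Complex.norm_exp]
  apply Real.exp_le_exp.2
  simp only [Complex.mul_re, Complex.I_re, Complex.I_im, mul_zero, mul_one, zero_sub]
  exact neg_le_abs _

theorem norm_csin_le (z : ℂ) : ‖Complex.sin z‖ ≤ Real.exp |z.im| := by
  have h1 := norm_cexp_mul_I_le z
  have h2 := norm_cexp_mul_I_le (-z)
  rw [Complex.neg_im, abs_neg] at h2
  rw [Complex.sin, norm_div, norm_mul, Complex.norm_I, Complex.norm_ofNat]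
  have := norm_sub_le (Complex.exp (-z * Complex.I)) (Complex.exp (z * Complex.I))
  linarith

theorem norm_ccos_le (z : ℂ) : ‖Complex.cos z‖ ≤ Real.exp |z.im| := by
  have h1 := norm_cexp_mul_I_le z
  have h2 := norm_cexp_mul_I_le (-z)
  rw [Complex.neg_im, abs_neg] at h2
  rw [Complex.cos, norm_div, Complex.norm_ofNat]
  have := norm_add_le (Complex.exp (z * Complex.I)) (Complex.exp (-z * Complex.I))
  linarith

/-- The complex extension of the linear form with real coefficients `m`. -/
theorem abs_im_sum_mul_le {ρ b : ℝ} (m : Fin d → ℝ) (hb : (∑ i, |m i|) * ρ ≤ b)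
    {z : Fin d → ℂ} (hz : z ∈ strip d ρ) : |(∑ i, (m i : ℂ) * z i).im| ≤ b := by
  rw [Complex.im_sum]
  refine (Finset.abs_sum_le_sum_abs _ _).trans (le_trans ?_ hb)
  rw [Finset.sum_mul]
  refine Finset.sum_le_sum fun i _ => ?_
  rw [Complex.im_ofReal_mul, abs_mul]
  exact mul_le_mul_of_nonneg_left (hz i).le (abs_nonneg _)

theorem contDiff_sum_mul (m : Fin d → ℝ) :
    ContDiff ℂ (⊤ : ℕ∞) (fun z : Fin d → ℂ => ∑ i, (m i : ℂ) * z i) := by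
  fun_prop

namespace HolBdd

theorem sin {ρ b : ℝ} (m : Fin d → ℝ) (hb : (∑ i, |m i|) * ρ ≤ b) :
    HolBdd ρ (Real.exp b) (fun x => Real.sin (∑ i, m i * x i)) := by
  refine ⟨fun z => Complex.sin (∑ i, (m i : ℂ) * z i),
    (Complex.contDiff_sin.comp (contDiff_sum_mul m)).contDiffOn, fun z hz => ?_, fun x => ?_⟩
  · exact (norm_csin_le _).trans (Real.exp_le_exp.2 (abs_im_sum_mul_le m hb hz))
  · simp [toC]

theorem cos {ρ b : ℝ} (m : Fin d → ℝ) (hb : (∑ i, |m i|) * ρ ≤ b) :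
    HolBdd ρ (Real.exp b) (fun x => Real.cos (∑ i, m i * x i)) := by
  refine ⟨fun z => Complex.cos (∑ i, (m i : ℂ) * z i),
    (Complex.contDiff_cos.comp (contDiff_sum_mul m)).contDiffOn, fun z hz => ?_, fun x => ?_⟩
  · exact (norm_ccos_le _).trans (Real.exp_le_exp.2 (abs_im_sum_mul_le m hb hz))
  · simp [toC]

theorem div {ρ A c : ℝ} {e b : (Fin d → ℝ) → ℝ} (hc : 0 < c)
    (he : HolBdd ρ A e) (hb : HolBdd ρ c (fun x => b x - 2 * c)) :
    HolBdd ρ (A / c) (fun x => e x / b x) := by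
  obtain ⟨F, h1, h2, h3⟩ := he
  obtain ⟨G, k1, k2, k3⟩ := hb
  have key : ∀ z ∈ strip d ρ, c ≤ ‖G z + 2 * c‖ := by
    intro z hz
    have h4 : ‖(2 * c : ℂ)‖ = 2 * c := by
      rw [norm_mul, Complex.norm_real, Complex.norm_ofNat, Real.norm_of_nonneg hc.le]
    have h5 := norm_sub_le (G z + 2 * c) (G z)
    rw [add_sub_cancel_left, h4] at h5
    linarith [k2 z hz]
  refine ⟨fun z => F z / (G z + 2 * c), h1.div (k1.add contDiffOn_const) ?_, ?_, ?_⟩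
  · intro z hz h0
    have := key z hz
    rw [h0, norm_zero] at this
    linarith
  · intro z hz
    rw [norm_div]
    exact div_le_div₀ ((norm_nonneg _).trans (h2 z hz)) (h2 z hz) hc (key z hz)
  · intro x
    show F (toC x) / (G (toC x) + 2 * c) = _
    rw [h3, k3]; push_cast; ring_nf

end HolBdd

theorem cexp_half_log_re_nonneg (w : ℂ) : 0 ≤ (Complex.exp (Complex.log w / 2)).re := by
  rw [Complex.exp_re]
  refine mul_nonneg (Real.exp_pos _).le (Real.cos_nonneg_of_mem_Icc ?_)
  have h : (Complex.log w / 2).im = w.arg / 2 := by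
    rw [show (2 : ℂ) = ((2 : ℝ) : ℂ) by norm_num, Complex.div_ofReal_im, Complex.log_im]
  rw [h]
  constructor <;> linarith [Complex.neg_pi_lt_arg w, Complex.arg_le_pi w]

theorem norm_cexp_half_log_sub_one_le {w : ℂ} (hw : w ≠ 0) :
    ‖Complex.exp (Complex.log w / 2) - 1‖ ≤ ‖w - 1‖ := by
  set s := Complex.exp (Complex.log w / 2) with hs
  have hsq : s * s = w := by
    rw [hs, ← Complex.exp_add, add_halves, Complex.exp_log hw]
  have h1 : 1 ≤ ‖s + 1‖ := by
    have := Complex.re_le_norm (s + 1)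
    have h0 := cexp_half_log_re_nonneg w
    simp only [Complex.add_re, Complex.one_re] at this
    linarith
  have h2 : w - 1 = (s - 1) * (s + 1) := by rw [← hsq]; ring
  rw [h2, norm_mul]
  exact le_mul_of_one_le_right (norm_nonneg _) h1

theorem HolBdd.sqrt_sub {ρ δ : ℝ} {c : (Fin d → ℝ) → ℝ} (hρ : 0 < ρ) (hδ : 0 < δ)
    (hc : HolBdd ρ (δ / 2) (fun x => c x - δ)) :
    HolBdd ρ (√δ / 2) (fun x => √(c x) - √δ) := by
  obtain ⟨F, h1, h2, h3⟩ := hc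
  have hb : ∀ z ∈ strip d ρ, ‖F z / δ‖ ≤ 1 / 2 := by
    intro z hz
    rw [norm_div, Complex.norm_real, Real.norm_of_nonneg hδ.le, div_le_iff₀ hδ]
    linarith [h2 z hz]
  have hre : ∀ z ∈ strip d ρ, 0 < (1 + F z / δ).re := by
    intro z hz
    have := (_root_.abs_le.1 ((Complex.abs_re_le_norm (F z / δ)).trans (hb z hz))).1
    simp only [Complex.add_re, Complex.one_re]
    linarith
  refine ⟨fun z => (√δ : ℂ) * (Complex.exp (Complex.log (1 + F z / δ) / 2) - 1), ?_, ?_, ?_⟩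
  · refine contDiffOn_const.mul (ContDiffOn.sub ?_ contDiffOn_const)
    refine ContDiffOn.cexp (ContDiffOn.div_const (fun z hz => ?_) _)
    have h4 : ContDiffWithinAt ℂ (⊤ : ℕ∞) (fun z => 1 + F z / δ) (strip d ρ) z :=
      (contDiffOn_const.add (h1.div_const _)) z hz
    exact (Complex.contDiffAt_log (Or.inl (hre z hz))).comp_contDiffWithinAt z h4
  · intro z hz
    have hne : 1 + F z / δ ≠ 0 := by
      intro h0
      have := hre z hz
      rw [h0] at this; simp at this
    have := norm_cexp_half_log_sub_one_le hne
    rw [add_sub_cancel_left] at this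
    rw [norm_mul, Complex.norm_real, Real.norm_of_nonneg (Real.sqrt_nonneg _)]
    have h5 := mul_le_mul_of_nonneg_left (this.trans (hb z hz)) (Real.sqrt_nonneg δ)
    linarith
  · intro x
    show (√δ : ℂ) * (Complex.exp (Complex.log (1 + F (toC x) / δ) / 2) - 1) = _
    have hp := hre _ (toC_mem_strip hρ x)
    have e1 : (1 : ℂ) + F (toC x) / δ = ((c x / δ : ℝ) : ℂ) := by
      rw [h3]; push_cast
      have : (δ : ℂ) ≠ 0 := by exact_mod_cast hδ.ne'
      field_simp; ring
    rw [e1, Complex.ofReal_re] at hp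
    rw [e1, ← Complex.ofReal_log hp.le]
    have e2 : √(c x) = √δ * Real.exp (Real.log (c x / δ) / 2) := by
      rw [Real.exp_half, Real.exp_log hp, ← Real.sqrt_mul hδ.le, mul_div_cancel₀ _ hδ.ne']
    show _ = ((√(c x) - √δ : ℝ) : ℂ)
    rw [e2]; push_cast; ring

end HolBddFunctions

section PartialDerivatives

variable {d k : ℕ}

/-- Smooth scalar functions on `ℝ^d`. -/
abbrev Smooth {d : ℕ} (f : (Fin d → ℝ) → ℝ) : Prop := ContDiff ℝ (⊤ : ℕ∞) f

theorem Smooth.differentiable {f : (Fin d → ℝ) → ℝ} (hf : Smooth f) : Differentiable ℝ f :=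
  ContDiff.differentiable hf (by simp)

theorem Smooth.pd {f : (Fin d → ℝ) → ℝ} (hf : Smooth f) (i : Fin d) : Smooth (pd i f) := by
  have : ContDiff ℝ (⊤ : ℕ∞) (fderiv ℝ f) := ContDiff.fderiv_right hf (by simp)
  exact this.clm_apply contDiff_const

theorem pd_add {f g : (Fin d → ℝ) → ℝ} (hf : Differentiable ℝ f) (hg : Differentiable ℝ g)
    (i : Fin d) (x : Fin d → ℝ) : pd i (fun y => f y + g y) x = pd i f x + pd i g x := by
  unfold pd; rw [fderiv_fun_add (hf x) (hg x)]; rfl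

theorem pd_sub {f g : (Fin d → ℝ) → ℝ} (hf : Differentiable ℝ f) (hg : Differentiable ℝ g)
    (i : Fin d) (x : Fin d → ℝ) : pd i (fun y => f y - g y) x = pd i f x - pd i g x := by
  unfold pd; rw [fderiv_fun_sub (hf x) (hg x)]; rfl

theorem pd_const_mul {f : (Fin d → ℝ) → ℝ} (hf : Differentiable ℝ f) (c : ℝ)
    (i : Fin d) (x : Fin d → ℝ) : pd i (fun y => c * f y) x = c * pd i f x := by
  unfold pd; rw [fderiv_const_mul (hf x)]; rfl

theorem pd_mul {f g : (Fin d → ℝ) → ℝ} (hf : Differentiable ℝ f) (hg : Differentiable ℝ g)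
    (i : Fin d) (x : Fin d → ℝ) :
    pd i (fun y => f y * g y) x = f x * pd i g x + g x * pd i f x := by
  unfold pd; rw [fderiv_fun_mul (hf x) (hg x)]; simp

theorem pd_sum {ι : Type*} (s : Finset ι) {f : ι → (Fin d → ℝ) → ℝ}
    (hf : ∀ l ∈ s, Differentiable ℝ (f l)) (i : Fin d) (x : Fin d → ℝ) :
    pd i (fun y => ∑ l ∈ s, f l y) x = ∑ l ∈ s, pd i (f l) x := by
  unfold pd
  rw [fderiv_fun_sum (fun l hl => hf l hl x)]
  simp

theorem hasFDerivAt_sum_mul (m : Fin d → ℝ) (x : Fin d → ℝ) :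
    HasFDerivAt (fun y : Fin d → ℝ => ∑ i, m i * y i)
      (∑ i, m i • ContinuousLinearMap.proj (R := ℝ) (φ := fun _ : Fin d => ℝ) i) x := by
  refine HasFDerivAt.fun_sum fun i _ => ?_
  exact (hasFDerivAt_apply i x).const_mul (m i)

theorem sum_smul_proj_single (m : Fin d → ℝ) (i : Fin d) :
    (∑ j, m j • ContinuousLinearMap.proj (R := ℝ) (φ := fun _ : Fin d => ℝ) j)
      (Pi.single i (1 : ℝ)) = m i := by
  simp [Pi.single_apply]

theorem pd_sum_mul (m : Fin d → ℝ) (i : Fin d) (x : Fin d → ℝ) :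
    pd i (fun y : Fin d → ℝ => ∑ j, m j * y j) x = m i := by
  unfold pd
  rw [(hasFDerivAt_sum_mul m x).fderiv, sum_smul_proj_single]

theorem pd_sin (m : Fin d → ℝ) (i : Fin d) (x : Fin d → ℝ) :
    pd i (fun y => Real.sin (∑ j, m j * y j)) x = m i * Real.cos (∑ j, m j * x j) := by
  unfold pd
  rw [((hasFDerivAt_sum_mul m x).sin).fderiv]
  rw [smul_apply, sum_smul_proj_single, smul_eq_mul, mul_comm]

theorem pd_cos (m : Fin d → ℝ) (i : Fin d) (x : Fin d → ℝ) :
    pd i (fun y => Real.cos (∑ j, m j * y j)) x = -(m i * Real.sin (∑ j, m j * x j)) := by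
  unfold pd
  rw [((hasFDerivAt_sum_mul m x).cos).fderiv]
  rw [smul_apply, sum_smul_proj_single, smul_eq_mul]; ring

theorem smooth_sum_mul (m : Fin d → ℝ) : Smooth (fun y : Fin d → ℝ => ∑ j, m j * y j) := by
  unfold Smooth; fun_prop

theorem smooth_sin (m : Fin d → ℝ) : Smooth (fun y => Real.sin (∑ j, m j * y j)) :=
  Real.contDiff_sin.comp (smooth_sum_mul m)

theorem smooth_cos (m : Fin d → ℝ) : Smooth (fun y => Real.cos (∑ j, m j * y j)) :=
  Real.contDiff_cos.comp (smooth_sum_mul m)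

/-- The matrix field `½(∇v)ᵀ∇v + sym∇w` in terms of the components of `v` and `w`. -/
def metricForm (v : Fin k → (Fin d → ℝ) → ℝ) (w : Fin d → (Fin d → ℝ) → ℝ) (i j : Fin d)
    (x : Fin d → ℝ) : ℝ :=
  (1 / 2) * ∑ l, pd i (v l) x * pd j (v l) x + (pd i (w j) x + pd j (w i) x) / 2

/-- The symmetrized second derivative. -/
def symHess (i j : Fin d) (g : (Fin d → ℝ) → ℝ) (x : Fin d → ℝ) : ℝ :=
  (pd i (pd j g) x + pd j (pd i g) x) / 2

theorem symHess_comm (i j : Fin d) (g : (Fin d → ℝ) → ℝ) (x : Fin d → ℝ) :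
    symHess i j g x = symHess j i g x := by
  unfold symHess; ring

theorem metricForm_comm (v : Fin k → (Fin d → ℝ) → ℝ) (w : Fin d → (Fin d → ℝ) → ℝ) (i j : Fin d)
    (x : Fin d → ℝ) : metricForm v w i j x = metricForm v w j i x := by
  unfold metricForm
  rw [add_comm (pd i (w j) x)]
  simp_rw [mul_comm (pd i (v _) x)]

/-- The compensating change of `w` that accompanies the change of `v` by `f`. -/
def compensate (v f : Fin k → (Fin d → ℝ) → ℝ) (u : Fin d → (Fin d → ℝ) → ℝ) (i : Fin d)
    (x : Fin d → ℝ) : ℝ :=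
  u i x - ∑ l, f l x * pd i (v l) x

theorem smooth_compensate {v f : Fin k → (Fin d → ℝ) → ℝ} {u : Fin d → (Fin d → ℝ) → ℝ}
    (hv : ∀ l, Smooth (v l)) (hf : ∀ l, Smooth (f l)) (hu : ∀ i, Smooth (u i)) (i : Fin d) :
    Smooth (compensate v f u i) :=
  (hu i).sub (ContDiff.sum fun l _ => (hf l).mul ((hv l).pd i))

theorem pd_compensate {v f : Fin k → (Fin d → ℝ) → ℝ} {u : Fin d → (Fin d → ℝ) → ℝ}
    (hv : ∀ l, Smooth (v l)) (hf : ∀ l, Smooth (f l)) (hu : ∀ i, Smooth (u i)) (i j : Fin d)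
    (x : Fin d → ℝ) :
    pd j (compensate v f u i) x = pd j (u i) x -
      ∑ l, (f l x * pd j (pd i (v l)) x + pd i (v l) x * pd j (f l) x) := by
  have h1 : ∀ l, Differentiable ℝ (fun y => f l y * pd i (v l) y) := fun l =>
    (hf l).differentiable.mul ((hv l).pd i).differentiable
  unfold compensate
  rw [pd_sub (hu i).differentiable (Differentiable.fun_sum fun l _ => h1 l),
    pd_sum _ (fun l _ => h1 l)]
  congr 1
  exact Finset.sum_congr rfl fun l _ =>
    pd_mul (hf l).differentiable ((hv l).pd i).differentiable j x

theorem metricForm_add {v f : Fin k → (Fin d → ℝ) → ℝ} {w u : Fin d → (Fin d → ℝ) → ℝ}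
    (hv : ∀ l, Smooth (v l)) (hf : ∀ l, Smooth (f l)) (hw : ∀ i, Smooth (w i))
    (hu : ∀ i, Smooth (u i)) (i j : Fin d) (x : Fin d → ℝ) :
    metricForm (fun l y => v l y + f l y) (fun i y => w i y + compensate v f u i y) i j x =
      metricForm v w i j x + (pd i (u j) x + pd j (u i) x) / 2 +
        ∑ l, ((1 / 2) * (pd i (f l) x * pd j (f l) x) - f l x * symHess i j (v l) x) := by
  have hc := smooth_compensate hv hf hu
  unfold metricForm
  simp_rw [pd_add (hv _).differentiable (hf _).differentiable,
    pd_add (hw _).differentiable (hc _).differentiable, pd_compensate hv hf hu]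
  have key : (1 / 2 : ℝ) * ∑ l, (pd i (v l) x + pd i (f l) x) * (pd j (v l) x + pd j (f l) x) =
      (1 / 2) * ∑ l, pd i (v l) x * pd j (v l) x +
      (∑ l, (f l x * pd i (pd j (v l)) x + pd j (v l) x * pd i (f l) x)) / 2 +
      (∑ l, (f l x * pd j (pd i (v l)) x + pd i (v l) x * pd j (f l) x)) / 2 +
      ∑ l, ((1 / 2) * (pd i (f l) x * pd j (f l) x) - f l x * symHess i j (v l) x) := by
    simp only [Finset.mul_sum, Finset.sum_div, ← Finset.sum_add_distrib]
    refine Finset.sum_congr rfl fun l _ => ?_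
    unfold symHess; ring
  rw [key]; ring

end PartialDerivatives

section RankOneBasis

variable {d : ℕ}

theorem two_mul_sum_le_pairs (F : Fin d → Fin d → ℝ) (hF : ∀ a b, F a b = F b a) :
    2 * ∑ p : {p : Fin d × Fin d // p.1 ≤ p.2}, F p.1.1 p.1.2 =
      (∑ a, ∑ b, F a b) + ∑ a, F a a := by
  have h1 : ∑ p : {p : Fin d × Fin d // p.1 ≤ p.2}, F p.1.1 p.1.2 =
      ∑ a, ∑ b, if a ≤ b then F a b else 0 := by
    rw [← Finset.sum_subtype (Finset.univ.filter fun p : Fin d × Fin d => p.1 ≤ p.2) (by simp)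
      (fun p => F p.1 p.2), Finset.sum_filter, Fintype.sum_prod_type]
  have h2 : (∑ a, ∑ b, if a ≤ b then F a b else 0) = ∑ a, ∑ b, if b ≤ a then F a b else 0 := by
    rw [Finset.sum_comm]
    simp_rw [hF]
  have h3 : (∑ a, ∑ b, if a ≤ b then F a b else 0) + (∑ a, ∑ b, if b ≤ a then F a b else 0) =
      (∑ a, ∑ b, F a b) + ∑ a, ∑ b, if a = b then F a b else 0 := by
    simp_rw [← Finset.sum_add_distrib]
    refine Finset.sum_congr rfl fun a _ => Finset.sum_congr rfl fun b _ => ?_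
    rcases lt_trichotomy a b with h | h | h
    · simp [h.le, h.not_ge, h.ne]
    · simp [h]
    · simp [h.le, h.not_ge, h.ne']
  have h4 : (∑ a, ∑ b, if a = b then F a b else 0) = ∑ a, F a a := by simp
  rw [h1, two_mul]
  nth_rewrite 2 [h2]
  rw [h3, h4]

/-- The vectors `e_a` (if `a = b`) and `e_a + e_b`. -/
def pairVec (a b i : Fin d) : ℝ :=
  if a = b then (if a = i then 1 else 0) else (if a = i then 1 else 0) + (if b = i then 1 else 0)

theorem abs_pairVec_le (a b i : Fin d) : |pairVec a b i| ≤ 1 := by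
  unfold pairVec
  split_ifs with h1 h2 h3 h4 h5
  all_goals first | (exfalso; apply h1; rw [h3, h4]) | simp

/-- Coefficients of a symmetric matrix in the basis `η ⊗ η`, `η = pairVec a b`. -/
def pairCoef (D : Fin d → Fin d → ℝ) (a b : Fin d) : ℝ :=
  if a = b then 2 * D a a - ∑ j, D a j else D a b

theorem sum_pairCoef_mul (D : Fin d → Fin d → ℝ) (hD : ∀ a b, D a b = D b a) (i j : Fin d) :
    ∑ p : {p : Fin d × Fin d // p.1 ≤ p.2},
      pairCoef D p.1.1 p.1.2 * (pairVec p.1.1 p.1.2 i * pairVec p.1.1 p.1.2 j) = D i j := by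
  have h := two_mul_sum_le_pairs
    (fun a b => pairCoef D a b * (pairVec a b i * pairVec a b j)) (by
      intro a b
      by_cases hab : a = b
      · subst hab; rfl
      · simp only [pairCoef, pairVec, if_neg hab, if_neg (Ne.symm hab), hD a b]; ring)
  have h2 : (∑ a, ∑ b, pairCoef D a b * (pairVec a b i * pairVec a b j)) =
      (∑ a, ∑ b, D a b * (((if a = i then 1 else 0) + (if b = i then 1 else 0)) *
        ((if a = j then 1 else 0) + (if b = j then 1 else 0)))) +
      ∑ a, (pairCoef D a a * (pairVec a a i * pairVec a a j) -
        D a a * (4 * ((if a = i then 1 else 0) * (if a = j then 1 else 0)))) := by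
    have : ∀ a, (pairCoef D a a * (pairVec a a i * pairVec a a j) -
        D a a * (4 * ((if a = i then 1 else 0) * (if a = j then 1 else 0)))) =
        ∑ b, if a = b then (pairCoef D a b * (pairVec a b i * pairVec a b j) -
        D a a * (4 * ((if a = i then 1 else 0) * (if a = j then 1 else 0)))) else 0 := by
      intro a; simp
    simp_rw [this, ← Finset.sum_add_distrib]
    refine Finset.sum_congr rfl fun a _ => Finset.sum_congr rfl fun b _ => ?_
    by_cases hab : a = b
    · subst hab; simp only [if_true]; ring
    · simp only [if_neg hab, pairCoef, pairVec, add_zero]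
  have h3 : (∑ a, ∑ b, D a b * (((if a = i then 1 else 0) + (if b = i then 1 else 0)) *
        ((if a = j then 1 else 0) + (if b = j then 1 else 0)))) =
      2 * D i j + 2 * (if i = j then ∑ b, D i b else 0) := by
    have e : ∀ a b, D a b * (((if a = i then 1 else 0) + (if b = i then 1 else 0)) *
        ((if a = j then 1 else 0) + (if b = j then 1 else 0))) =
        (if a = i then (if a = j then D a b else 0) else 0) +
        (if a = i then (if b = j then D a b else 0) else 0) +
        (if a = j then (if b = i then D a b else 0) else 0) +
        (if b = i then (if b = j then D a b else 0) else 0) := by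
      intro a b
      generalize D a b = t
      split_ifs <;> ring
    have s1 : ∀ a, (∑ b, if a = i then (if a = j then D a b else 0) else 0) =
        if a = i then (if a = j then ∑ b, D a b else 0) else 0 := by
      intro a; split_ifs <;> simp
    have s2 : ∀ a (i j : Fin d), (∑ b, if a = i then (if b = j then D a b else 0) else 0) =
        if a = i then D a j else 0 := by
      intro a i j; split_ifs <;> simp
    have s3 : ∀ b, (∑ a, if b = i then (if b = j then D a b else 0) else 0) =
        if b = i then (if b = j then ∑ a, D a b else 0) else 0 := by
      intro a; split_ifs <;> simp
    simp_rw [e, Finset.sum_add_distrib, s1, s2]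
    rw [Finset.sum_comm (f := fun a b => if b = i then (if b = j then D a b else 0) else 0)]
    simp_rw [s3]
    simp only [Finset.sum_ite_eq', Finset.mem_univ, if_true]
    rw [hD j i, Finset.sum_congr rfl fun b _ => hD b i]
    ring
  rw [h2, h3] at h
  have h4 : ∀ a, pairCoef D a a * (pairVec a a i * pairVec a a j) =
      if a = i then (if a = j then 2 * D a a - ∑ b, D a b else 0) else 0 := by
    intro a; unfold pairCoef pairVec; split_ifs <;> simp_all
  have h5 : ∀ a, D a a * (4 * ((if a = i then (1 : ℝ) else 0) * (if a = j then 1 else 0))) =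
      if a = i then (if a = j then 4 * D a a else 0) else 0 := by
    intro a; by_cases h : a = i <;> by_cases h' : a = j <;> simp [h, h', mul_comm]
  simp_rw [Finset.sum_sub_distrib, h5, h4] at h
  simp only [Finset.sum_ite_eq', Finset.mem_univ, if_true] at h
  by_cases hij : i = j
  · subst hij; simp only [if_true] at h; linarith
  · simp only [if_neg hij] at h; linarith

theorem exists_rankOne_basis (d : ℕ) :
    ∃ (N : ℕ) (η : Fin N → Fin d → ℝ) (L : Fin N → Fin d → Fin d → ℝ),
      2 * N = d * (d + 1) ∧ (∀ n i, |η n i| ≤ 1) ∧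
      ∀ D : Fin d → Fin d → ℝ, (∀ a b, D a b = D b a) → ∀ i j,
        ∑ n, (∑ a, ∑ b, L n a b * D a b) * (η n i * η n j) = D i j := by
  have hcard : 2 * Fintype.card {p : Fin d × Fin d // p.1 ≤ p.2} = d * (d + 1) := by
    rw [← Fintype.card_congr (Sym2.sortEquiv (α := Fin d)), Sym2.card, Fintype.card_fin,
      Nat.choose_two_right, Nat.mul_div_cancel' (Nat.even_mul_pred_self _).two_dvd]
    simp [mul_comm]
  let e := Fintype.equivFin {p : Fin d × Fin d // p.1 ≤ p.2}
  let L : Fin d → Fin d → Fin d → Fin d → ℝ := fun p q a b =>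
    if p = q then (if a = p then (if b = p then 1 else -1) else 0)
      else (if a = p then (if b = q then 1 else 0) else 0)
  have hL : ∀ (D : Fin d → Fin d → ℝ) p q, ∑ a, ∑ b, L p q a b * D a b = pairCoef D p q := by
    intro D p q
    by_cases hpq : p = q
    · subst hpq
      have : ∀ a b, L p p a b * D a b =
          if a = p then ((if b = p then 2 * D a b else 0) - D a b) else 0 := by
        intro a b
        simp only [L, if_true]
        split_ifs <;> ring
      simp_rw [this]
      rw [Finset.sum_comm]
      simp [pairCoef]
    · simp [L, hpq, pairCoef]
  refine ⟨_, fun n => pairVec (e.symm n).1.1 (e.symm n).1.2,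
    fun n => L (e.symm n).1.1 (e.symm n).1.2, hcard, ?_, ?_⟩
  · intro n i
    exact abs_pairVec_le _ _ _
  · intro D hD i j
    simp_rw [hL]
    rw [← sum_pairCoef_mul D hD i j]
    exact Equiv.sum_comp e.symm (fun p : {p : Fin d × Fin d // p.1 ≤ p.2} =>
      pairCoef D p.1.1 p.1.2 * (pairVec p.1.1 p.1.2 i * pairVec p.1.1 p.1.2 j))

end RankOneBasis

section Increments

variable {d k : ℕ}

/-- The sum of the absolute values of all first derivatives. -/
def gradSum (v : Fin k → (Fin d → ℝ) → ℝ) (x : Fin d → ℝ) : ℝ :=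
  ∑ l, ∑ i, |pd i (v l) x|

theorem gradSum_nonneg (v : Fin k → (Fin d → ℝ) → ℝ) (x : Fin d → ℝ) : 0 ≤ gradSum v x :=
  Finset.sum_nonneg fun _ _ => Finset.sum_nonneg fun _ _ => abs_nonneg _

/-- Control of the passage from `(v, w)` to `(v', w')`: the increments are bounded by `b` on the
strip of half-width `r`, up to a factor accounting for the size `K` of `∇v`. -/
structure Incr (r b K : ℝ) (v v' : Fin k → (Fin d → ℝ) → ℝ) (w w' : Fin d → (Fin d → ℝ) → ℝ) :
    Prop where
  v_sub : ∀ l, HolBdd r b (fun x => v' l x - v l x)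
  pd_v_sub : ∀ l i, HolBdd r b (fun x => pd i (v' l) x - pd i (v l) x)
  w_sub : ∀ i, HolBdd r (b * (1 + K)) (fun x => w' i x - w i x)
  pd_w_sub : ∀ i j, HolBdd r (b * (1 + K)) (fun x => pd j (w' i) x - pd j (w i) x)
  abs_w_sub : ∀ i x, |w' i x - w i x| ≤ b * (1 + gradSum v x)
  abs_pd_w_sub : ∀ i j x, |pd j (w' i) x - pd j (w i) x| ≤ b * (1 + gradSum v x)

theorem HolBdd.zero {r b : ℝ} (hb : 0 ≤ b) : HolBdd (d := d) r b (fun _ => 0) := by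
  have := HolBdd.const (d := d) (ρ := r) 0
  exact this.weaken (by simpa using hb)

namespace Incr

variable {r r' b b' K : ℝ} {v v' v'' : Fin k → (Fin d → ℝ) → ℝ}
  {w w' w'' : Fin d → (Fin d → ℝ) → ℝ}

theorem refl (r K : ℝ) (v : Fin k → (Fin d → ℝ) → ℝ) (w : Fin d → (Fin d → ℝ) → ℝ) :
    Incr r 0 K v v w w := by
  constructor <;> intros <;> simp [HolBdd.zero]

theorem mono (h : Incr r b K v v' w w') (hr : r' ≤ r) (hb : b ≤ b') (hK : 0 ≤ K) :
    Incr r' b' K v v' w w' := by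
  have hb2 : b * (1 + K) ≤ b' * (1 + K) := by gcongr
  have hb3 : ∀ x, b * (1 + gradSum v x) ≤ b' * (1 + gradSum v x) := fun x =>
    mul_le_mul_of_nonneg_right hb (by have := gradSum_nonneg v x; linarith)
  exact ⟨fun l => (h.v_sub l).mono hr hb, fun l i => (h.pd_v_sub l i).mono hr hb,
    fun i => (h.w_sub i).mono hr hb2, fun i j => (h.pd_w_sub i j).mono hr hb2,
    fun i x => (h.abs_w_sub i x).trans (hb3 x), fun i j x => (h.abs_pd_w_sub i j x).trans (hb3 x)⟩

theorem gradSum_le (hr : 0 < r) (h : Incr r b K v v' w w') (x : Fin d → ℝ) :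
    gradSum v' x ≤ gradSum v x + d * k * b := by
  have h1 : ∀ l i, |pd i (v' l) x| ≤ |pd i (v l) x| + b := by
    intro l i
    have h2 := (h.pd_v_sub l i).abs_le hr x
    have h3 := abs_add_le (pd i (v l) x) (pd i (v' l) x - pd i (v l) x)
    rw [add_sub_cancel] at h3
    linarith
  calc gradSum v' x ≤ ∑ l : Fin k, ∑ i : Fin d, (|pd i (v l) x| + b) :=
        Finset.sum_le_sum fun l _ => Finset.sum_le_sum fun i _ => h1 l i
    _ = _ := by
        simp only [Finset.sum_add_distrib, Finset.sum_const, Finset.card_univ, Fintype.card_fin,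
          nsmul_eq_mul, gradSum]
        ring

theorem pd_bound (h : Incr r b K v v' w w') {Kv : ℝ} (hv : ∀ l i, HolBdd r Kv (pd i (v l))) (l i) :
    HolBdd r (Kv + b) (pd i (v' l)) :=
  ((hv l i).add (h.pd_v_sub l i)).congr fun x => by ring

theorem trans (hr' : 0 < r') (hrr : r' ≤ r) (hK : 0 ≤ K) (hb : 0 ≤ b) (hb' : 0 ≤ b')
    (hd : 1 ≤ (d : ℝ) * k) (h : Incr r b K v v' w w')
    (h' : Incr r' b' (K + b) v' v'' w' w'') :
    Incr r' (b + b' * (1 + d * k * b)) K v v'' w w'' := by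
  have hdb : b ≤ d * k * b := by nlinarith
  have hdb0 : 0 ≤ d * k * b := hb.trans hdb
  have e1 : b + b' ≤ b + b' * (1 + d * k * b) := by nlinarith
  have key : ∀ X, 0 ≤ X → b * (1 + X) + b' * (1 + (X + d * k * b)) ≤
      (b + b' * (1 + d * k * b)) * (1 + X) := by
    intro X hX
    have : 0 ≤ b' * ((d * k * b) * X) := by positivity
    nlinarith
  have e2 : b * (1 + K) + b' * (1 + (K + b)) ≤ (b + b' * (1 + d * k * b)) * (1 + K) := by
    have := key K hK
    nlinarith [mul_le_mul_of_nonneg_left hdb hb']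
  have e3 : ∀ x, b * (1 + gradSum v x) + b' * (1 + gradSum v' x) ≤
      (b + b' * (1 + d * k * b)) * (1 + gradSum v x) := by
    intro x
    have h1 := h.gradSum_le (hr'.trans_le hrr) x
    have h2 := key _ (gradSum_nonneg v x)
    nlinarith [mul_le_mul_of_nonneg_left h1 hb']
  refine ⟨fun l => ?_, fun l i => ?_, fun i => ?_, fun i j => ?_, fun i x => ?_, fun i j x => ?_⟩
  · exact ((((h.v_sub l).shrink hrr).add (h'.v_sub l)).weaken e1).congr fun x => by ring
  · exact ((((h.pd_v_sub l i).shrink hrr).add (h'.pd_v_sub l i)).weaken e1).congr fun x => by ring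
  · exact ((((h.w_sub i).shrink hrr).add (h'.w_sub i)).weaken e2).congr fun x => by ring
  · exact ((((h.pd_w_sub i j).shrink hrr).add (h'.pd_w_sub i j)).weaken e2).congr fun x => by ring
  · refine le_trans ?_ (e3 x)
    refine le_trans ?_ (add_le_add (h.abs_w_sub i x) (h'.abs_w_sub i x))
    rw [add_comm]
    exact le_of_eq_of_le (by ring_nf) (abs_add_le _ _)
  · refine le_trans ?_ (e3 x)
    refine le_trans ?_ (add_le_add (h.abs_pd_w_sub i j x) (h'.abs_pd_w_sub i j x))
    rw [add_comm]
    exact le_of_eq_of_le (by ring_nf) (abs_add_le _ _)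

theorem of_compensate {s F P h : ℝ} {f : Fin k → (Fin d → ℝ) → ℝ} {u : Fin d → (Fin d → ℝ) → ℝ}
    (hs : 0 < s) (hFP : F ≤ P) (hF : 0 ≤ F) (hh : 0 ≤ h)
    (hv : ∀ l, Smooth (v l)) (hw : ∀ i, Smooth (w i))
    (hf : ∀ l, HolBdd s F (f l)) (hu : ∀ i, HolBdd s F (u i))
    (hpf : ∀ l i, HolBdd s P (pd i (f l))) (hpu : ∀ i j, HolBdd s P (pd j (u i))) (hK : 0 ≤ K)
    (hpv : ∀ l i, HolBdd s K (pd i (v l)))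
    (hfv : ∀ l i j, HolBdd s h (fun x => f l x * pd j (pd i (v l)) x)) :
    Incr s ((1 + k) * P + k * h) K v (fun l y => v l y + f l y) w
      (fun i y => w i y + compensate v f u i y) := by
  have hfs : ∀ l, Smooth (f l) := fun l => (hf l).contDiff hs
  have hus : ∀ i, Smooth (u i) := fun l => (hu l).contDiff hs
  have hcs := smooth_compensate hv hfs hus
  have hP : 0 ≤ P := hF.trans hFP
  have hk0 : (0 : ℝ) ≤ k := Nat.cast_nonneg k
  have e1 : P ≤ (1 + k) * P + k * h := by
    have : 0 ≤ k * P := by positivity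
    have : 0 ≤ k * h := by positivity
    linarith
  have hG : ∀ i x, ∑ l, |pd i (v l) x| ≤ gradSum v x := by
    intro i x
    refine Finset.sum_le_sum fun l _ => ?_
    exact Finset.single_le_sum (f := fun i => |pd i (v l) x|) (fun _ _ => abs_nonneg _)
      (Finset.mem_univ i)
  refine ⟨fun l => ?_, fun l i => ?_, fun i => ?_, fun i j => ?_, fun i x => ?_, fun i j x => ?_⟩
  · exact ((hf l).weaken (hFP.trans e1)).congr fun x => by ring
  · refine ((hpf l i).weaken e1).congr fun x => ?_
    rw [pd_add (hv l).differentiable (hfs l).differentiable]; ring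
  · have h1 := (hu i).sub (HolBdd.sum Finset.univ fun l _ => (hf l).mul (hpv l i) hs)
    refine (h1.weaken ?_).congr fun x => by unfold compensate; ring
    simp only [Finset.sum_const, Finset.card_univ, Fintype.card_fin, nsmul_eq_mul]
    have h2 : F * K ≤ P * K := by gcongr
    have h3 : k * (F * K) ≤ k * (P * K) := by gcongr
    have : 0 ≤ k * h := by positivity
    have : 0 ≤ k * h * K := by positivity
    have : 0 ≤ k * P := by positivity
    have : 0 ≤ P * K := by positivity
    nlinarith
  · have h1 := (hpu i j).sub (HolBdd.sum Finset.univ fun l _ =>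
      (hfv l i j).add ((hpv l i).mul (hpf l j) hs))
    refine (h1.weaken ?_).congr fun x => ?_
    · simp only [Finset.sum_const, Finset.card_univ, Fintype.card_fin, nsmul_eq_mul]
      have : 0 ≤ k * h * K := by positivity
      have : 0 ≤ k * P := by positivity
      have : 0 ≤ P * K := by positivity
      nlinarith
    · rw [pd_add (hw i).differentiable (hcs i).differentiable, add_sub_cancel_left,
        pd_compensate hv hfs hus]
  · have h0 := gradSum_nonneg v x
    have h1 : |compensate v f u i x| ≤ F + F * gradSum v x := by
      unfold compensate
      refine (abs_sub _ _).trans (add_le_add ((hu i).abs_le hs x) ?_)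
      refine (Finset.abs_sum_le_sum_abs _ _).trans ?_
      refine le_trans ?_ (mul_le_mul_of_nonneg_left (hG i x) hF)
      rw [Finset.mul_sum]
      refine Finset.sum_le_sum fun l _ => ?_
      rw [abs_mul]
      exact mul_le_mul_of_nonneg_right ((hf l).abs_le hs x) (abs_nonneg _)
    rw [add_sub_cancel_left]
    refine h1.trans ?_
    calc F + F * gradSum v x = F * (1 + gradSum v x) := by ring
      _ ≤ _ := by gcongr; exact hFP.trans e1
  · have h0 := gradSum_nonneg v x
    rw [pd_add (hw i).differentiable (hcs i).differentiable, add_sub_cancel_left,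
      pd_compensate hv hfs hus]
    have h1 : |pd j (u i) x| ≤ P := (hpu i j).abs_le hs x
    have h2 : |∑ l, (f l x * pd j (pd i (v l)) x + pd i (v l) x * pd j (f l) x)| ≤
        k * h + P * gradSum v x := by
      refine (Finset.abs_sum_le_sum_abs _ _).trans ?_
      refine le_trans ?_ (add_le_add le_rfl (mul_le_mul_of_nonneg_left (hG i x) hP))
      have : (k : ℝ) * h = ∑ _l : Fin k, h := by simp
      rw [this, Finset.mul_sum, ← Finset.sum_add_distrib]
      refine Finset.sum_le_sum fun l _ => ?_
      refine (abs_add_le _ _).trans (add_le_add ((hfv l i j).abs_le hs x) ?_)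
      rw [abs_mul, mul_comm]
      exact mul_le_mul_of_nonneg_right ((hpf l j).abs_le hs x) (abs_nonneg _)
    refine (abs_sub _ _).trans ((add_le_add h1 h2).trans ?_)
    have : 0 ≤ k * h * gradSum v x := by positivity
    have : 0 ≤ k * P := by positivity
    have : 0 ≤ k * P * gradSum v x := by positivity
    nlinarith

end Incr

end Increments

section Primitive

variable {d : ℕ}

theorem exists_primitive_step {ρ lam δ : ℝ} {a : (Fin d → ℝ) → ℝ} {η : Fin d → ℝ}
    (hρ : 0 < ρ) (hl : 0 < lam) (hlρ : 4 ≤ lam * ρ) (hδ : 0 < δ) (hη : ∀ i, |η i| ≤ 1)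
    (ha : HolBdd ρ (2 * √δ) a) :
    ∃ (φ : (Fin d → ℝ) → ℝ) (u : Fin d → (Fin d → ℝ) → ℝ),
      HolBdd (1 / lam) (4 * Real.exp (2 * d) * √δ / lam) φ ∧
      (∀ i, HolBdd (1 / lam) (4 * Real.exp (2 * d) * δ / lam) (u i)) ∧
      ∀ i j, HolBdd (1 / lam) (64 * Real.exp (2 * d) * δ / (lam * ρ) ^ 2)
        (fun x => (1 / 2) * (pd i φ x * pd j φ x) + (pd i (u j) x + pd j (u i) x) / 2 -
          a x ^ 2 * (η i * η j)) := by
  set B := Real.exp (2 * d) with hB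
  have hB1 : 1 ≤ B := Real.one_le_exp (by positivity)
  set s := 1 / lam with hs
  have hs0 : 0 < s := by positivity
  have hsρ : s ≤ ρ / 4 := by
    rw [hs, div_le_div_iff₀ hl (by norm_num)]; linarith
  have hsum : (∑ i, |lam * η i|) * s ≤ d := by
    have h1 : ∑ i, |lam * η i| ≤ ∑ _i : Fin d, lam := Finset.sum_le_sum fun i _ => by
      rw [abs_mul, abs_of_pos hl]
      exact mul_le_of_le_one_right hl.le (hη i)
    calc (∑ i, |lam * η i|) * s ≤ (∑ _i : Fin d, lam) * s := by gcongr
      _ = d := by simp [hs]; field_simp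
  have hsum2 : (∑ i, |2 * (lam * η i)|) * s ≤ 2 * d := by
    have : ∀ i, |2 * (lam * η i)| = 2 * |lam * η i| := fun i => by rw [abs_mul]; simp
    simp_rw [this, ← Finset.mul_sum]
    linarith
  have hd0 : (0 : ℝ) ≤ d := Nat.cast_nonneg d
  have HS := HolBdd.sin (fun i => lam * η i) (hsum.trans (by linarith : (d : ℝ) ≤ 2 * d))
  have HS2 := HolBdd.sin (fun i => 2 * (lam * η i)) hsum2
  have HC2 := HolBdd.cos (fun i => 2 * (lam * η i)) hsum2
  rw [← hB] at HS HS2 HC2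
  have hsa : Smooth a := ha.contDiff hρ
  have HS' := smooth_sin (fun i => lam * η i)
  have HS2' := smooth_sin (fun i => 2 * (lam * η i))
  have HC2' := smooth_cos (fun i => 2 * (lam * η i))
  have hpS := pd_sin (fun i => lam * η i)
  have hpS2 := pd_sin (fun i => 2 * (lam * η i))
  have hpC2 := pd_cos (fun i => 2 * (lam * η i))
  have hS2 : ∀ x : Fin d → ℝ, Real.sin (∑ i, 2 * (lam * η i) * x i) =
      2 * Real.sin (∑ i, lam * η i * x i) * Real.cos (∑ i, lam * η i * x i) := by
    intro x
    rw [← Real.sin_two_mul, Finset.mul_sum]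
    simp_rw [mul_assoc]
  have hC2 : ∀ x : Fin d → ℝ, Real.cos (∑ i, 2 * (lam * η i) * x i) =
      2 * Real.cos (∑ i, lam * η i * x i) ^ 2 - 1 := by
    intro x
    rw [← Real.cos_two_mul, Finset.mul_sum]
    simp_rw [mul_assoc]
  have hSC : ∀ x : Fin d → ℝ, Real.sin (∑ i, lam * η i * x i) ^ 2 =
      1 - Real.cos (∑ i, lam * η i * x i) ^ 2 := fun x => by
    rw [Real.sin_sq]
  set S : (Fin d → ℝ) → ℝ := fun x => Real.sin (∑ i, lam * η i * x i) with hSdef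
  set C : (Fin d → ℝ) → ℝ := fun x => Real.cos (∑ i, lam * η i * x i) with hCdef
  set S2 : (Fin d → ℝ) → ℝ := fun x => Real.sin (∑ i, 2 * (lam * η i) * x i) with hS2def
  set C2 : (Fin d → ℝ) → ℝ := fun x => Real.cos (∑ i, 2 * (lam * η i) * x i) with hC2def
  replace hS2 : ∀ x, S2 x = 2 * S x * C x := hS2
  replace hC2 : ∀ x, C2 x = 2 * C x ^ 2 - 1 := hC2
  replace hSC : ∀ x, S x ^ 2 = 1 - C x ^ 2 := hSC
  have hsq : √δ * √δ = δ := Real.mul_self_sqrt hδ.le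
  have hq : 0 < √δ := Real.sqrt_pos.2 hδ
  have has : HolBdd s (2 * √δ) a := ha.shrink (by linarith)
  have hpa : ∀ i, HolBdd (ρ / 2) (4 * √δ / ρ) (pd i a) := fun i =>
    (ha.pd hρ i).weaken (le_of_eq (by ring))
  have hpas : ∀ i, HolBdd s (4 * √δ / ρ) (pd i a) := fun i => (hpa i).shrink (by linarith)
  have hppa : ∀ i j, HolBdd s (16 * √δ / ρ ^ 2) (pd i (pd j a)) := fun i j =>
    ((hpa j).pd (by linarith) i).mono (by linarith) (le_of_eq (by field_simp; ring))
  refine ⟨fun x => 2 / lam * (a x * S x),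
    fun i x => -(1 / (2 * lam)) * (a x * a x * S2 x) * η i +
      1 / (2 * lam ^ 2) * (a x * pd i a x * C2 x), ?_, ?_, ?_⟩
  · refine ((has.mul HS hs0).const_mul (2 / lam)).weaken (le_of_eq ?_)
    rw [abs_of_pos (by positivity)]
    ring
  · intro i
    have h1 := ((has.mul has hs0).mul HS2 hs0).const_mul (-(1 / (2 * lam)) * η i)
    have h2 := ((has.mul (hpas i) hs0).mul HC2 hs0).const_mul (1 / (2 * lam ^ 2))
    refine ((h1.add h2).weaken ?_).congr fun x => by ring
    rw [abs_mul, abs_neg, abs_of_pos (by positivity : 0 < 1 / (2 * lam)),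
      abs_of_pos (by positivity : 0 < 1 / (2 * lam ^ 2))]
    have e1 : 1 / (2 * lam) * |η i| * (2 * √δ * (2 * √δ) * B) ≤ 2 * B * δ / lam := by
      calc 1 / (2 * lam) * |η i| * (2 * √δ * (2 * √δ) * B)
          ≤ 1 / (2 * lam) * 1 * (2 * √δ * (2 * √δ) * B) := by gcongr; exact hη i
        _ = 2 * B * (√δ * √δ) / lam := by field_simp
        _ = _ := by rw [hsq]
    have e2 : 1 / (2 * lam ^ 2) * (2 * √δ * (4 * √δ / ρ) * B) ≤ B * δ / lam := by
      have : 1 / (2 * lam ^ 2) * (2 * √δ * (4 * √δ / ρ) * B) =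
          B * (√δ * √δ) / lam * (4 / (lam * ρ)) := by field_simp
      rw [this, hsq]
      refine mul_le_of_le_one_right (by positivity) ?_
      rw [div_le_one (by positivity)]; exact hlρ
    have e3 : 0 ≤ B * δ / lam := by positivity
    calc _ ≤ 2 * B * δ / lam + B * δ / lam := add_le_add e1 e2
      _ ≤ 4 * B * δ / lam := by
        have : 4 * B * δ / lam = 2 * B * δ / lam + B * δ / lam + B * δ / lam := by ring
        linarith
  · intro i j
    have hpφ : ∀ i x, pd i (fun x => 2 / lam * (a x * S x)) x =
        2 / lam * (S x * pd i a x + a x * (lam * η i * C x)) := by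
      intro i x
      rw [pd_const_mul (hsa.differentiable.fun_mul HS'.differentiable),
        pd_mul hsa.differentiable HS'.differentiable, hpS]
      ring
    have hpu : ∀ i j x, pd i (fun x => -(1 / (2 * lam)) * (a x * a x * S2 x) * η j +
        1 / (2 * lam ^ 2) * (a x * pd j a x * C2 x)) x =
        -(1 / (2 * lam)) * η j * (2 * a x * pd i a x * S2 x +
          a x * a x * (2 * (lam * η i) * C2 x)) +
        1 / (2 * lam ^ 2) * (pd i a x * pd j a x * C2 x + a x * pd i (pd j a) x * C2 x -
          a x * pd j a x * (2 * (lam * η i) * S2 x)) := by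
      intro i j x
      have d1 := hsa.differentiable
      have d2 := (hsa.pd j).differentiable
      have d3 := HS2'.differentiable
      have d4 := HC2'.differentiable
      have e1 : (fun x => -(1 / (2 * lam)) * (a x * a x * S2 x) * η j +
          1 / (2 * lam ^ 2) * (a x * pd j a x * C2 x)) =
          fun x => (-(1 / (2 * lam)) * η j) * (a x * a x * S2 x) +
          1 / (2 * lam ^ 2) * (a x * pd j a x * C2 x) := by funext x; ring
      rw [e1, pd_add (((d1.fun_mul d1).fun_mul d3).const_mul _)
        (((d1.fun_mul d2).fun_mul d4).const_mul _),
        pd_const_mul ((d1.fun_mul d1).fun_mul d3), pd_const_mul ((d1.fun_mul d2).fun_mul d4),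
        pd_mul (d1.fun_mul d1) d3, pd_mul (d1.fun_mul d2) d4, pd_mul d1 d1, pd_mul d1 d2,
        hpS2, hpC2]
      ring
    have hid : ∀ x, 1 / lam ^ 2 * (pd i a x * pd j a x) +
        -(1 / lam ^ 2) * (C2 x * (pd i a x * pd j a x)) +
        1 / (2 * lam ^ 2) * (C2 x * (pd i a x * pd j a x)) +
        1 / (4 * lam ^ 2) * (C2 x * (a x * pd i (pd j a) x)) +
        1 / (4 * lam ^ 2) * (C2 x * (a x * pd j (pd i a) x)) =
        (1 / 2) * (pd i (fun x => 2 / lam * (a x * S x)) x *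
            pd j (fun x => 2 / lam * (a x * S x)) x) +
          (pd i (fun x => -(1 / (2 * lam)) * (a x * a x * S2 x) * η j +
            1 / (2 * lam ^ 2) * (a x * pd j a x * C2 x)) x +
           pd j (fun x => -(1 / (2 * lam)) * (a x * a x * S2 x) * η i +
            1 / (2 * lam ^ 2) * (a x * pd i a x * C2 x)) x) / 2 - a x ^ 2 * (η i * η j) := by
      intro x
      rw [hpφ, hpφ, hpu, hpu, hS2, hC2]
      have h := hSC x
      generalize S x = σ at *
      generalize C x = κ at *
      field_simp
      linear_combination (-32 * pd i a x * pd j a x) * h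
    have haa := (hpas i).mul (hpas j) hs0
    have h1 := haa.const_mul (1 / lam ^ 2)
    have h2 := (HC2.mul haa hs0).const_mul (-(1 / lam ^ 2))
    have h3 := (HC2.mul haa hs0).const_mul (1 / (2 * lam ^ 2))
    have h4 := (HC2.mul (has.mul (hppa i j) hs0) hs0).const_mul (1 / (4 * lam ^ 2))
    have h5 := (HC2.mul (has.mul (hppa j i) hs0) hs0).const_mul (1 / (4 * lam ^ 2))
    refine (((((h1.add h2).add h3).add h4).add h5).weaken ?_).congr hid
    rw [abs_neg, abs_of_pos (by positivity : 0 < 1 / lam ^ 2),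
      abs_of_pos (by positivity : 0 < 1 / (2 * lam ^ 2)),
      abs_of_pos (by positivity : 0 < 1 / (4 * lam ^ 2))]
    have : 1 / lam ^ 2 * (4 * √δ / ρ * (4 * √δ / ρ)) +
        1 / lam ^ 2 * (B * (4 * √δ / ρ * (4 * √δ / ρ))) +
        1 / (2 * lam ^ 2) * (B * (4 * √δ / ρ * (4 * √δ / ρ))) +
        1 / (4 * lam ^ 2) * (B * (2 * √δ * (16 * √δ / ρ ^ 2))) +
        1 / (4 * lam ^ 2) * (B * (2 * √δ * (16 * √δ / ρ ^ 2))) =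
        (16 + 40 * B) * (√δ * √δ) / (lam * ρ) ^ 2 := by field_simp; ring
    rw [this, hsq]
    gcongr
    linarith

end Primitive

/-- A basis of the symmetric matrices consisting of rank-one matrices `η n ⊗ η n`, with the
coordinates given by the linear forms `L n`. -/
structure RankOneBasis (d N : ℕ) where
  η : Fin N → Fin d → ℝ
  L : Fin N → Fin d → Fin d → ℝ
  abs_le : ∀ n i, |η n i| ≤ 1
  sum_coef : ∀ D : Fin d → Fin d → ℝ, (∀ a b, D a b = D b a) → ∀ i j,
    ∑ n, (∑ a, ∑ b, L n a b * D a b) * (η n i * η n j) = D i j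

namespace RankOneBasis

variable {d N k : ℕ} (S : RankOneBasis d N)

/-- The sum of the basis elements. -/
def total (i j : Fin d) : ℝ := ∑ m, S.η m i * S.η m j

theorem total_comm (i j : Fin d) : S.total i j = S.total j i := by
  unfold total
  simp_rw [mul_comm]

/-- The tolerated relative size of a perturbation of a multiple of `S.total`. -/
def rad : ℝ := 1 / (8 * (1 + ∑ n, ∑ a, ∑ b, |S.L n a b|))

theorem sum_abs_nonneg : 0 ≤ ∑ n, ∑ a, ∑ b, |S.L n a b| :=
  Finset.sum_nonneg fun _ _ => Finset.sum_nonneg fun _ _ => Finset.sum_nonneg fun _ _ =>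
    abs_nonneg _

theorem rad_pos : 0 < S.rad := by
  have := S.sum_abs_nonneg
  unfold rad; positivity

theorem rad_le : S.rad ≤ 1 := by
  have := S.sum_abs_nonneg
  unfold rad
  rw [div_le_one (by positivity)]; linarith

theorem sum_abs_mul_rad_le (n : Fin N) : (∑ a, ∑ b, |S.L n a b|) * S.rad ≤ 1 / 8 := by
  have h0 := S.sum_abs_nonneg
  have h1 : ∑ a, ∑ b, |S.L n a b| ≤ ∑ n, ∑ a, ∑ b, |S.L n a b| :=
    Finset.single_le_sum (f := fun n => ∑ a, ∑ b, |S.L n a b|)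
      (fun _ _ => Finset.sum_nonneg fun _ _ => Finset.sum_nonneg fun _ _ => abs_nonneg _)
      (Finset.mem_univ n)
  unfold rad
  rw [mul_one_div, div_le_div_iff₀ (by positivity) (by norm_num)]
  linarith

/-- The coordinate forms, applied to a matrix field. -/
def coef (n : Fin N) (R : Fin d → Fin d → (Fin d → ℝ) → ℝ) (x : Fin d → ℝ) : ℝ :=
  ∑ a, ∑ b, S.L n a b * R a b x

theorem holBdd_coef {ρ A : ℝ} {R : Fin d → Fin d → (Fin d → ℝ) → ℝ}
    (hR : ∀ i j, HolBdd ρ A (R i j)) (n : Fin N) :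
    HolBdd ρ ((∑ a, ∑ b, |S.L n a b|) * A) (S.coef n R) := by
  have h := HolBdd.sum (ρ := ρ) (Finset.univ : Finset (Fin d)) fun a _ =>
    HolBdd.sum (Finset.univ : Finset (Fin d)) fun b _ => (hR a b).const_mul (S.L n a b)
  refine h.weaken (le_of_eq ?_)
  simp_rw [Finset.sum_mul]

/-- The amplitudes in the decomposition of `t • S.total + R`. -/
def amp (t : ℝ) (R : Fin d → Fin d → (Fin d → ℝ) → ℝ) (n : Fin N) (x : Fin d → ℝ) : ℝ :=
  √(S.coef n R x + t)

theorem holBdd_amp_arg {ρ δ δ' : ℝ} (hδ : 0 < δ) (hδ' : 0 ≤ δ')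
    (hδδ : δ' ≤ δ / 4) {R : Fin d → Fin d → (Fin d → ℝ) → ℝ}
    (hR : ∀ i j, HolBdd ρ (2 * S.rad * δ) (R i j)) (n : Fin N) :
    HolBdd ρ (δ / 2) (fun x => S.coef n R x + (δ - δ') - δ) := by
  have h1 := (S.holBdd_coef hR n).sub (HolBdd.const δ')
  refine (h1.weaken ?_).congr fun x => by ring
  rw [abs_of_nonneg hδ']
  nlinarith [S.sum_abs_mul_rad_le n]

theorem holBdd_amp_sub {ρ δ δ' : ℝ} (hρ : 0 < ρ) (hδ : 0 < δ) (hδ' : 0 ≤ δ')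
    (hδδ : δ' ≤ δ / 4) {R : Fin d → Fin d → (Fin d → ℝ) → ℝ}
    (hR : ∀ i j, HolBdd ρ (2 * S.rad * δ) (R i j)) (n : Fin N) :
    HolBdd ρ (√δ / 2) (fun x => S.amp (δ - δ') R n x - √δ) :=
  HolBdd.sqrt_sub hρ hδ (S.holBdd_amp_arg hδ hδ' hδδ hR n)

theorem holBdd_amp {ρ δ δ' : ℝ} (hρ : 0 < ρ) (hδ : 0 < δ) (hδ' : 0 ≤ δ')
    (hδδ : δ' ≤ δ / 4) {R : Fin d → Fin d → (Fin d → ℝ) → ℝ}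
    (hR : ∀ i j, HolBdd ρ (2 * S.rad * δ) (R i j)) (n : Fin N) :
    HolBdd ρ (2 * √δ) (S.amp (δ - δ') R n) := by
  have h0 : 0 ≤ √δ := Real.sqrt_nonneg _
  have h1 := (S.holBdd_amp_sub hρ hδ hδ' hδδ hR n).add (HolBdd.const (√δ))
  refine (h1.weaken ?_).congr fun x => by ring
  rw [abs_of_nonneg h0]; linarith

theorem amp_sq {ρ δ δ' : ℝ} (hρ : 0 < ρ) (hδ : 0 < δ) (hδ' : 0 ≤ δ')
    (hδδ : δ' ≤ δ / 4) {R : Fin d → Fin d → (Fin d → ℝ) → ℝ}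
    (hR : ∀ i j, HolBdd ρ (2 * S.rad * δ) (R i j)) (n : Fin N) (x : Fin d → ℝ) :
    S.amp (δ - δ') R n x ^ 2 = S.coef n R x + (δ - δ') := by
  have h := (S.holBdd_amp_arg hδ hδ' hδδ hR n).abs_le hρ x
  rw [_root_.abs_le] at h
  exact Real.sq_sqrt (by linarith)

theorem sum_amp_sq {ρ δ δ' : ℝ} (hρ : 0 < ρ) (hδ : 0 < δ) (hδ' : 0 ≤ δ')
    (hδδ : δ' ≤ δ / 4) {R : Fin d → Fin d → (Fin d → ℝ) → ℝ}
    (hR : ∀ i j, HolBdd ρ (2 * S.rad * δ) (R i j)) (hs : ∀ i j x, R i j x = R j i x)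
    (i j : Fin d) (x : Fin d → ℝ) :
    ∑ n, S.amp (δ - δ') R n x ^ 2 * (S.η n i * S.η n j) =
      R i j x + (δ - δ') * S.total i j := by
  simp_rw [S.amp_sq hρ hδ hδ' hδδ hR]
  simp only [add_mul, Finset.sum_add_distrib]
  rw [← Finset.mul_sum]
  congr 1
  exact S.sum_coef (fun a b => R a b x) (fun a b => hs a b x) i j

end RankOneBasis

section Step

variable {d k : ℕ}

theorem exists_rankOne_step {ρ lam δ Δ K H : ℝ} {a : (Fin d → ℝ) → ℝ} {η : Fin d → ℝ}
    {v : Fin k → (Fin d → ℝ) → ℝ} {w : Fin d → (Fin d → ℝ) → ℝ} (l : Fin k)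
    (hρ : 0 < ρ) (hρ1 : ρ ≤ 1) (hl : 0 < lam) (hlρ : 4 ≤ lam * ρ) (hδ : 0 < δ) (hΔ : 1 ≤ Δ)
    (hδΔ : √δ ≤ Δ) (hη : ∀ i, |η i| ≤ 1) (ha : HolBdd ρ (2 * √δ) a)
    (hv : ∀ l, Smooth (v l)) (hw : ∀ i, Smooth (w i)) (hK : 0 ≤ K)
    (hpv : ∀ l i, HolBdd (1 / lam) K (pd i (v l)))
    (hppv : ∀ i j, HolBdd (1 / lam) H (pd i (pd j (v l))))
    (hH : 4 * Real.exp (2 * d) * H / lam ≤ 1) :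
    ∃ (v' : Fin k → (Fin d → ℝ) → ℝ) (w' : Fin d → (Fin d → ℝ) → ℝ),
      (∀ l, Smooth (v' l)) ∧ (∀ i, Smooth (w' i)) ∧
      Incr (1 / (4 * lam)) (((1 + k) * (8 * Real.exp (2 * d) * Δ) + k) * √δ) K v v' w w' ∧
      (∀ l', l' ≠ l → v' l' = v l') ∧
      (∀ i j, HolBdd (1 / (4 * lam)) (H + 32 * Real.exp (2 * d) * (√δ * lam))
        (pd i (pd j (v' l)))) ∧
      ∀ i j, HolBdd (1 / (4 * lam)) (64 * Real.exp (2 * d) * δ / (lam * ρ) ^ 2 +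
          4 * Real.exp (2 * d) * √δ / lam * H)
        (fun x => metricForm v' w' i j x - metricForm v w i j x - a x ^ 2 * (η i * η j)) := by
  obtain ⟨φ, u, hφ, hu, herr⟩ := exists_primitive_step hρ hl hlρ hδ hη ha
  set B := Real.exp (2 * d) with hB
  have hB0 : 0 < B := Real.exp_pos _
  have hs0 : 0 < 1 / lam := by positivity
  have hq : 0 < √δ := Real.sqrt_pos.2 hδ
  have hsq : √δ * √δ = δ := Real.mul_self_sqrt hδ.le
  set f : Fin k → (Fin d → ℝ) → ℝ := fun l' x => if l' = l then φ x else 0 with hf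
  have hφs : Smooth φ := hφ.contDiff hs0
  have hus : ∀ i, Smooth (u i) := fun i => (hu i).contDiff hs0
  set F := 4 * B * √δ * Δ / lam with hF
  have hF0 : 0 ≤ F := by positivity
  have hφF : 4 * B * √δ / lam ≤ F := by
    rw [hF]
    exact div_le_div_of_nonneg_right (le_mul_of_one_le_right (by positivity) hΔ) hl.le
  have hf1 : ∀ l', HolBdd (1 / lam) F (f l') := by
    intro l'
    by_cases h : l' = l
    · exact (hφ.weaken hφF).congr fun x => by simp [hf, h]
    · exact (HolBdd.zero hF0).congr fun x => by simp [hf, h]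
  have hfs : ∀ l, Smooth (f l) := fun l => (hf1 l).contDiff hs0
  have hu1 : ∀ i, HolBdd (1 / lam) F (u i) := fun i => (hu i).weaken (by
    refine div_le_div_of_nonneg_right ?_ hl.le
    calc 4 * B * δ = 4 * B * √δ * √δ := by rw [mul_assoc (4 * B), hsq]
      _ ≤ _ := by gcongr)
  have e2 : 1 / lam / 2 ≤ 1 / lam := by linarith
  have hlam1 : 1 / lam ≤ 2 := by
    rw [div_le_iff₀ hl]; nlinarith
  have hFP : 2 * F / (1 / lam) ≤ 8 * B * √δ * Δ := le_of_eq (by rw [hF]; field_simp; ring)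
  have hFP' : F ≤ 8 * B * √δ * Δ := by
    refine le_trans ?_ hFP
    rw [le_div_iff₀ hs0]; nlinarith
  have hinc := Incr.of_compensate (P := 8 * B * √δ * Δ) (h := √δ) (v := v) (w := w)
    (by positivity : 0 < 1 / lam / 2) hFP' hF0 hq.le hv hw (fun l => (hf1 l).shrink e2)
    (fun i => (hu1 i).shrink e2) (fun l i => ((hf1 l).pd hs0 i).weaken hFP)
    (fun i j => ((hu1 i).pd hs0 j).weaken hFP) hK (fun l i => (hpv l i).shrink e2) (by
      intro l' i j
      by_cases h : l' = l
      · subst h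
        refine (((hφ.mul (hppv j i) hs0).mono e2 ?_)).congr fun x => by simp [hf]
        calc 4 * B * √δ / lam * H = (4 * B * H / lam) * √δ := by ring
          _ ≤ 1 * √δ := by gcongr
          _ = √δ := one_mul _
      · exact (HolBdd.zero hq.le).congr fun x => by simp [hf, h])
  have hcs := smooth_compensate hv hfs hus
  have e4 : 1 / (4 * lam) = 1 / lam / 2 / 2 := by field_simp; ring
  have e4' : 1 / (4 * lam) ≤ 1 / lam := by
    rw [e4]; linarith
  refine ⟨_, _, fun l => (hv l).add (hfs l), fun i => (hw i).add (hcs i),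
    hinc.mono ?_ (le_of_eq (by ring)) hK, ?_, ?_, ?_⟩
  · rw [e4]; linarith
  · intro l' h
    funext x
    simp [hf, h]
  · intro i j
    have h1 : ∀ x, pd i (pd j (fun y => v l y + f l y)) x =
        pd i (pd j (v l)) x + pd i (pd j φ) x := by
      intro x
      have : (pd j (fun y => v l y + f l y)) = fun x => pd j (v l) x + pd j φ x := by
        funext x
        rw [pd_add (hv l).differentiable (hfs l).differentiable]
        simp [hf]
      rw [this, pd_add ((hv l).pd j).differentiable (hφs.pd j).differentiable]
    have h2 := (hφ.pd hs0 j).pd (by positivity) i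
    rw [← e4] at h2
    refine ((((hppv i j).shrink e4').add h2).weaken (add_le_add le_rfl (le_of_eq ?_))).congr
      fun x => (h1 x).symm
    field_simp; ring
  · intro i j
    have h1 : HolBdd (1 / lam) H (symHess i j (v l)) :=
      ((((hppv i j).add (hppv j i)).const_mul (1 / 2)).weaken (le_of_eq (by
        rw [abs_of_pos (by norm_num)]; ring))).congr fun x => by unfold symHess; ring
    refine (((herr i j).sub (hφ.mul h1 hs0)).shrink e4').congr fun x => ?_
    rw [metricForm_add hv hfs hw hus]
    have h2 : ∀ l' x, f l' x * symHess i j (v l') x =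
        if l' = l then φ x * symHess i j (v l) x else 0 := by
      intro l' x
      by_cases h : l' = l
      · simp [hf, h]
      · simp [hf, h]
    have h3 : ∀ l' x, (1 / 2) * (pd i (f l') x * pd j (f l') x) =
        if l' = l then (1 / 2) * (pd i φ x * pd j φ x) else 0 := by
      intro l' x
      by_cases h : l' = l
      · simp [hf, h]
      · have : f l' = fun _ => 0 := by funext x; simp [hf, h]
        simp [this, pd, h]
    simp_rw [Finset.sum_sub_distrib, h2, h3]
    simp
    ring

end Step

section CodimensionStage

variable {d k N : ℕ}

/-- The constants in the accumulated increments of successive steps. -/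
def incrConst (d k : ℕ) (c Δ : ℝ) : ℕ → ℝ
  | 0 => 0
  | n + 1 => incrConst d k c Δ n + c * (1 + d * k * Δ * incrConst d k c Δ n)

theorem incrConst_nonneg {c Δ : ℝ} (hc : 0 ≤ c) (hΔ : 0 ≤ Δ) (n : ℕ) :
    0 ≤ incrConst d k c Δ n := by
  induction n with
  | zero => exact le_rfl
  | succ n ih => unfold incrConst; positivity

theorem Incr.trans_sqrt {r r' K c e δ Δ : ℝ} {v v' v'' : Fin k → (Fin d → ℝ) → ℝ}
    {w w' w'' : Fin d → (Fin d → ℝ) → ℝ} (hr' : 0 < r') (hrr : r' ≤ r) (hK : 0 ≤ K) (he : 0 ≤ e)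
    (hc : 0 ≤ c) (hd : 1 ≤ (d : ℝ) * k) (hδΔ : √δ ≤ Δ) (h : Incr r (e * √δ) K v v' w w')
    (h' : Incr r' (c * √δ) (K + e * √δ) v' v'' w' w'') :
    Incr r' ((e + c * (1 + d * k * Δ * e)) * √δ) K v v'' w w'' := by
  have hq := Real.sqrt_nonneg δ
  refine (h.trans hr' hrr hK (by positivity) (by positivity) hd h').mono le_rfl ?_ hK
  have h1 : c * √δ * (d * k * (e * √δ)) ≤ c * √δ * (d * k * (e * Δ)) := by gcongr
  nlinarith

/-- The accumulated constant of one stage. -/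
def stageConst (d k N : ℕ) (Δ : ℝ) : ℝ :=
  incrConst d k ((1 + k) * (8 * Real.exp (2 * d) * Δ) + k) Δ N

set_option maxHeartbeats 1000000 in
theorem RankOneBasis.exists_stage_of_codim (S : RankOneBasis d N) (hk : 0 < k) (hd : 0 < d)
    {ρ δ θ σ P K Δ : ℝ} {M : ℕ} {v : Fin k → (Fin d → ℝ) → ℝ} {w : Fin d → (Fin d → ℝ) → ℝ}
    {G : Fin d → Fin d → (Fin d → ℝ) → ℝ}
    (hρ : 0 < ρ) (hρ1 : ρ ≤ 1) (hδ : 0 < δ) (hΔ : 1 ≤ Δ) (hδΔ : √δ ≤ Δ) (hθ : 4 ≤ θ) (hσ : 4 ≤ σ)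
    (hθ2 : N * (1024 * Real.exp (2 * d)) ≤ S.rad / 4 * θ ^ 2)
    (hθk : (N + 1) * (256 * Real.exp (2 * d) ^ 2 * Δ * σ ^ 2) ≤ S.rad / 4 * θ ^ k)
    (hP : √δ * θ * σ = 4 * ρ * (P * θ ^ M))
    (hv : ∀ l, Smooth (v l)) (hw : ∀ i, Smooth (w i)) (hG : ∀ i j x, G i j x = G j i x)
    (hK : 0 ≤ K) (hpv : ∀ l i, HolBdd ρ K (pd i (v l)))
    (hppv : ∀ m, M ≤ m → ∀ i j, HolBdd ρ (64 * Real.exp (2 * d) * (P * θ ^ m) / θ ^ k)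
      (pd i (pd j (v ⟨m % k, Nat.mod_lt _ hk⟩))))
    (hR : ∀ i j, HolBdd ρ (S.rad * δ)
      (fun x => G i j x - metricForm v w i j x - δ * S.total i j)) :
    ∃ (v' : Fin k → (Fin d → ℝ) → ℝ) (w' : Fin d → (Fin d → ℝ) → ℝ),
      (∀ l, Smooth (v' l)) ∧ (∀ i, Smooth (w' i)) ∧
      Incr (ρ / (σ * θ ^ N)) (stageConst d k N Δ * √δ) K v v' w w' ∧
      (∀ m, M + N ≤ m → ∀ i j, HolBdd (ρ / (σ * θ ^ N))
        (64 * Real.exp (2 * d) * (P * θ ^ m) / θ ^ k)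
        (pd i (pd j (v' ⟨m % k, Nat.mod_lt _ hk⟩)))) ∧
      ∀ i j, HolBdd (ρ / (σ * θ ^ N)) (S.rad * (δ / σ ^ 2) / 2)
        (fun x => G i j x - metricForm v' w' i j x - δ / σ ^ 2 * S.total i j) := by
  set B := Real.exp (2 * d) with hB
  have hB1 : 1 ≤ B := Real.one_le_exp (by positivity)
  have hθ0 : 0 < θ := by linarith
  have hσ0 : 0 < σ := by linarith
  have hq : 0 < √δ := Real.sqrt_pos.2 hδ
  have hsq : √δ * √δ = δ := Real.mul_self_sqrt hδ.le
  have hrad := S.rad_pos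
  have hθk4 : 4 ≤ θ ^ k := hθ.trans (le_self_pow₀ (by linarith) hk.ne')
  have hP0 : 0 < P := by
    have : 0 < 4 * ρ * (P * θ ^ M) := by rw [← hP]; positivity
    have h2 : 0 < (4 * ρ * θ ^ M) * P := this.trans_eq (by ring)
    exact pos_of_mul_pos_right h2 (by positivity)
  set δ' := δ / σ ^ 2 with hδ'
  have hδ'0 : 0 < δ' := by positivity
  have hδδ : δ' ≤ δ / 4 := by
    rw [hδ', div_le_div_iff₀ (by positivity) (by norm_num)]
    have : 4 ≤ σ ^ 2 := by nlinarith
    gcongr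
  set R : Fin d → Fin d → (Fin d → ℝ) → ℝ :=
    fun i j x => G i j x - metricForm v w i j x - δ * S.total i j with hRdef
  have hR2 : ∀ i j, HolBdd ρ (2 * S.rad * δ) (R i j) := fun i j =>
    (hR i j).weaken (by nlinarith [mul_pos hrad hδ])
  have hRs : ∀ i j x, R i j x = R j i x := by
    intro i j x
    simp only [hRdef, hG i j, metricForm_comm v w i j, S.total_comm i j]
  set a := S.amp (δ - δ') R with ha
  have ham : ∀ n, HolBdd ρ (2 * √δ) (a n) := S.holBdd_amp hρ hδ hδ'0.le hδδ hR2
  have hsum := S.sum_amp_sq hρ hδ hδ'0.le hδδ hR2 hRs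
  set c := (1 + k) * (8 * B * Δ) + (k : ℝ) with hc
  have hc0 : 0 ≤ c := by positivity
  set e := incrConst d k c Δ with he
  have he0 : ∀ n, 0 ≤ e n := incrConst_nonneg hc0 (by linarith)
  have hdk : 1 ≤ (d : ℝ) * k := by
    have h1 : (1 : ℝ) ≤ d := by exact_mod_cast hd
    have h2 : (1 : ℝ) ≤ k := by exact_mod_cast hk
    nlinarith
  set err := 1024 * B * δ / (σ ^ 2 * θ ^ 2) + 256 * B ^ 2 * δ / θ ^ k with herr
  have herr0 : 0 ≤ err := by positivity
  have main : ∀ n, n ≤ N → ∃ (v' : Fin k → (Fin d → ℝ) → ℝ) (w' : Fin d → (Fin d → ℝ) → ℝ),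
      (∀ l, Smooth (v' l)) ∧ (∀ i, Smooth (w' i)) ∧
      Incr (ρ / (σ * θ ^ n)) (e n * √δ) K v v' w w' ∧
      (∀ m, M + n ≤ m → ∀ i j, HolBdd (ρ / (σ * θ ^ n))
        (64 * B * (P * θ ^ m) / θ ^ k)
        (pd i (pd j (v' ⟨m % k, Nat.mod_lt _ hk⟩)))) ∧
      ∀ i j, HolBdd (ρ / (σ * θ ^ n)) (n * err)
        (fun x => metricForm v' w' i j x - metricForm v w i j x -
          ∑ p : Fin N, if p.1 < n then a p x ^ 2 * (S.η p i * S.η p j) else 0) := by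
    intro n
    induction n with
    | zero =>
      intro _
      have hr : ρ / (σ * θ ^ 0) ≤ ρ := by
        rw [pow_zero, mul_one]
        exact div_le_self hρ.le (by linarith)
      refine ⟨v, w, hv, hw, by simpa [he, incrConst] using Incr.refl _ K v w,
        fun m hm i j => (hppv m hm i j).shrink hr, fun i j => ?_⟩
      refine (HolBdd.zero (by simp)).congr fun x => by simp
    | succ n ih =>
      intro hn
      obtain ⟨v₁, w₁, hv₁, hw₁, hinc, hpp, hm⟩ := ih (by omega)
      set lam := σ * θ ^ (n + 1) / (4 * ρ) with hlam
      have hlam0 : 0 < lam := by positivity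
      have hθn : 1 ≤ θ ^ n := one_le_pow₀ (by linarith)
      have hlρ : lam * ρ = σ * θ ^ (n + 1) / 4 := by rw [hlam]; field_simp
      have hθn1 : θ ≤ θ ^ (n + 1) := le_self_pow₀ (by linarith) (by omega)
      have hr1 : 1 / lam ≤ ρ / (σ * θ ^ n) := by
        rw [hlam, div_le_div_iff₀ (by positivity) (by positivity)]
        have : ρ * (σ * θ ^ (n + 1) / (4 * ρ)) = (σ * θ ^ n) * (θ / 4) := by
          field_simp; ring
        rw [this, one_mul]
        exact le_mul_of_one_le_right (by positivity) (by linarith)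
      have hr2 : 1 / (4 * lam) = ρ / (σ * θ ^ (n + 1)) := by
        rw [hlam]; field_simp
      have hQ : √δ * lam = P * θ ^ (M + n) := by
        have : √δ * lam = (√δ * θ * σ) * θ ^ n / (4 * ρ) := by rw [hlam]; ring
        rw [this, hP, pow_add]; field_simp
      have hkb : 256 * B ^ 2 * Δ * σ ^ 2 ≤ S.rad / 4 * θ ^ k := by
        refine le_trans ?_ hθk
        refine le_mul_of_one_le_left (by positivity) ?_
        have : (0 : ℝ) ≤ N := Nat.cast_nonneg N
        linarith
      set H := 64 * B * (P * θ ^ (M + n)) / θ ^ k with hH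
      have hHl : H / lam = 64 * B * √δ / θ ^ k := by
        rw [hH, ← hQ]; field_simp
      have hkb2 : 256 * B ^ 2 * Δ ≤ θ ^ k := by
        have h1 : 256 * B ^ 2 * Δ ≤ 256 * B ^ 2 * Δ * σ ^ 2 :=
          le_mul_of_one_le_right (by positivity) (one_le_pow₀ (by linarith))
        have h2 : S.rad / 4 * θ ^ k ≤ 1 * θ ^ k := by
          have := S.rad_le
          gcongr; linarith
        linarith
      have hH1 : 4 * B * H / lam ≤ 1 := by
        rw [mul_div_assoc, hHl]
        have : 4 * B * (64 * B * √δ / θ ^ k) = 256 * B ^ 2 * √δ / θ ^ k := by ring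
        rw [this, div_le_one (by positivity)]
        refine le_trans ?_ hkb2
        gcongr
      obtain ⟨v₂, w₂, hv₂, hw₂, hinc₂, hne, hpp₂, hm₂⟩ :=
        exists_rankOne_step (v := v₁) (w := w₁) ⟨(M + n) % k, Nat.mod_lt _ hk⟩ hρ hρ1 hlam0
          (by rw [hlρ]; nlinarith) hδ hΔ hδΔ (S.abs_le ⟨n, by omega⟩) (ham ⟨n, by omega⟩) hv₁ hw₁
          (K := K + e n * √δ) (H := H) (by have := he0 n; positivity)
          (fun l i => ((hinc.mono (by
            exact div_le_div_of_nonneg_left hρ.le (by positivity) le_rfl) le_rfl hK).pd_bound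
            (fun l i => (hpv l i).shrink (div_le_self hρ.le (by nlinarith))) l i).shrink hr1)
          (fun i j => (hpp _ le_rfl i j).shrink hr1) hH1
      have hr3 : ρ / (σ * θ ^ (n + 1)) ≤ ρ / (σ * θ ^ n) := by
        rw [← hr2]
        refine le_trans ?_ hr1
        exact div_le_div_of_nonneg_left zero_le_one hlam0 (by linarith)
      rw [hr2] at hinc₂ hpp₂ hm₂
      refine ⟨v₂, w₂, hv₂, hw₂, ?_, ?_, ?_⟩
      · exact hinc.trans_sqrt (by positivity) hr3 hK (he0 n) hc0 hdk hδΔ hinc₂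
      · intro m hm' i j
        by_cases h : (⟨m % k, Nat.mod_lt _ hk⟩ : Fin k) = ⟨(M + n) % k, Nat.mod_lt _ hk⟩
        · rw [h]
          refine (hpp₂ i j).weaken ?_
          have hmod : (M + n) % k = m % k := (Fin.mk.inj_iff.1 h).symm
          have hdvd : k ∣ m - (M + n) := (Nat.modEq_iff_dvd' (by omega)).1 hmod
          have hge := Nat.le_of_dvd (by omega) hdvd
          have h3 : θ ^ (M + n) * θ ^ k ≤ θ ^ m := by
            rw [← pow_add]
            exact pow_le_pow_right₀ (by linarith) (by omega)
          rw [hQ, hH]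
          have hX : 0 < P * θ ^ (M + n) := by positivity
          rw [le_div_iff₀ (by positivity), add_mul, div_mul_cancel₀ _ (by positivity)]
          have h4 : 64 * B * (P * (θ ^ (M + n) * θ ^ k)) ≤ 64 * B * (P * θ ^ m) := by gcongr
          have h5 : 64 * B * (P * θ ^ (M + n)) ≤ 64 * B * (P * θ ^ (M + n)) * (θ ^ k / 2) :=
            le_mul_of_one_le_right (by positivity) (by linarith)
          linarith
        · rw [hne _ h]
          exact (hpp m (by omega) i j).shrink hr3
      · intro i j
        refine ((((hm i j).shrink hr3).add (hm₂ i j)).weaken ?_).congr fun x => ?_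
        · have h1 : 64 * B * δ / (lam * ρ) ^ 2 ≤ 1024 * B * δ / (σ ^ 2 * θ ^ 2) := by
            rw [hlρ, div_le_div_iff₀ (by positivity) (by positivity)]
            have : θ ^ 2 ≤ (θ ^ (n + 1)) ^ 2 := by gcongr
            calc 64 * B * δ * (σ ^ 2 * θ ^ 2)
              ≤ 64 * B * δ * (σ ^ 2 * (θ ^ (n + 1)) ^ 2) := by gcongr
              _ = _ := by ring
          have h2 : 4 * B * √δ / lam * H = 256 * B ^ 2 * δ / θ ^ k := by
            calc 4 * B * √δ / lam * H = 4 * B * √δ * (H / lam) := by ring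
              _ = 256 * B ^ 2 * (√δ * √δ) / θ ^ k := by rw [hHl]; ring
              _ = _ := by rw [hsq]
          rw [h2]
          push_cast
          have : n * err + (64 * B * δ / (lam * ρ) ^ 2 + 256 * B ^ 2 * δ / θ ^ k) ≤
            n * err + err := by rw [herr]; gcongr
          linarith
        · have hs : (∑ p : Fin N, if p.1 < n + 1 then a p x ^ 2 * (S.η p i * S.η p j) else 0) =
              (∑ p : Fin N, if p.1 < n then a p x ^ 2 * (S.η p i * S.η p j) else 0) +
              a ⟨n, by omega⟩ x ^ 2 * (S.η ⟨n, by omega⟩ i * S.η ⟨n, by omega⟩ j) := by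
            have h1 : a ⟨n, by omega⟩ x ^ 2 * (S.η ⟨n, by omega⟩ i * S.η ⟨n, by omega⟩ j) =
                ∑ p : Fin N, if p = ⟨n, by omega⟩ then a p x ^ 2 * (S.η p i * S.η p j) else 0 := by
              simp
            rw [h1, ← Finset.sum_add_distrib]
            refine Finset.sum_congr rfl fun p _ => ?_
            rcases lt_trichotomy p.1 n with h | h | h
            · have : p ≠ ⟨n, by omega⟩ := fun hp => by simp [hp] at h
              simp [h, this, h.trans (Nat.lt_succ_self n)]
            · have : p = ⟨n, by omega⟩ := Fin.ext h
              simp [this]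
            · have : p ≠ ⟨n, by omega⟩ := fun hp => by simp [hp] at h
              simp [this, h.not_gt, show ¬ p.1 < n + 1 by omega]
          rw [hs]; ring
  obtain ⟨v', w', hv', hw', hinc, hpp, hm⟩ := main N le_rfl
  refine ⟨v', w', hv', hw', hinc, hpp, fun i j => ?_⟩
  refine ((hm i j).neg.weaken ?_).congr fun x => ?_
  · have h1 : N * (1024 * B * δ / (σ ^ 2 * θ ^ 2)) ≤ S.rad * δ' / 4 := by
      calc N * (1024 * B * δ / (σ ^ 2 * θ ^ 2)) = (N * (1024 * B)) * δ / (σ ^ 2 * θ ^ 2) := by ring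
        _ ≤ (S.rad / 4 * θ ^ 2) * δ / (σ ^ 2 * θ ^ 2) := by gcongr
        _ = S.rad * δ' / 4 := by rw [hδ']; field_simp
    have h2 : N * (256 * B ^ 2 * δ / θ ^ k) ≤ S.rad * δ' / 4 := by
      have hNn : (0 : ℝ) ≤ N := Nat.cast_nonneg N
      have h3 : N * (256 * B ^ 2 * σ ^ 2) ≤ S.rad / 4 * θ ^ k := by
        refine le_trans ?_ hθk
        calc N * (256 * B ^ 2 * σ ^ 2) = N * (256 * B ^ 2 * 1 * σ ^ 2) := by ring
          _ ≤ (N + 1) * (256 * B ^ 2 * Δ * σ ^ 2) := by gcongr; linarith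
      calc N * (256 * B ^ 2 * δ / θ ^ k) = N * (256 * B ^ 2 * σ ^ 2) * δ / (σ ^ 2 * θ ^ k) := by
            field_simp
        _ ≤ (S.rad / 4 * θ ^ k) * δ / (σ ^ 2 * θ ^ k) := by gcongr
        _ = S.rad * δ' / 4 := by rw [hδ']; field_simp
    rw [herr, mul_add]
    linarith
  · have h1 := hsum i j x
    have h2 : (∑ p : Fin N, if p.1 < N then a p x ^ 2 * (S.η p i * S.η p j) else 0) =
        ∑ p : Fin N, a p x ^ 2 * (S.η p i * S.η p j) :=
      Finset.sum_congr rfl fun p _ => if_pos p.2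
    rw [h2, h1]
    simp only [hRdef]
    ring

end CodimensionStage

section Oscillation

variable {d k N r : ℕ}

namespace RankOneBasis

variable (S : RankOneBasis d N)

/-- Pairs of oscillating functions with amplitudes `a` in the directions of the basis, extended by
zero. -/
def osc (r : ℕ) (lam : ℝ) (a : Fin N → (Fin d → ℝ) → ℝ) : Fin (N + N + r) → (Fin d → ℝ) → ℝ :=
  Fin.append (Fin.append
    (fun n x => √2 / lam * (a n x * Real.sin (∑ i, lam * S.η n i * x i)))
    (fun n x => √2 / lam * (a n x * Real.cos (∑ i, lam * S.η n i * x i))))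
    (fun _ _ => 0)

theorem osc_sub (lam : ℝ) (a b : Fin N → (Fin d → ℝ) → ℝ) (l : Fin (N + N + r)) (x : Fin d → ℝ) :
    S.osc r lam (fun n y => a n y - b n y) l x = S.osc r lam a l x - S.osc r lam b l x := by
  unfold osc
  refine Fin.addCases (fun l => ?_) (fun l => ?_) l
  · refine Fin.addCases (fun l => ?_) (fun l => ?_) l <;>
      simp only [Fin.append_left, Fin.append_right] <;> ring
  · simp

theorem sum_abs_mul_le {lam s : ℝ} (hl : 0 ≤ lam) (hs : 0 ≤ s) (hls : lam * s ≤ 1) (n : Fin N) :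
    (∑ i, |lam * S.η n i|) * s ≤ 2 * d := by
  have h1 : ∑ i, |lam * S.η n i| ≤ ∑ _i : Fin d, lam := by
    refine Finset.sum_le_sum fun i _ => ?_
    rw [abs_mul, abs_of_nonneg hl]
    exact mul_le_of_le_one_right hl (S.abs_le n i)
  calc (∑ i, |lam * S.η n i|) * s ≤ (∑ _i : Fin d, lam) * s := by gcongr
    _ = d * (lam * s) := by simp [mul_assoc]
    _ ≤ d * 2 := by gcongr; linarith
    _ = 2 * d := mul_comm _ _

theorem sqrt_two_le_two : √(2 : ℝ) ≤ 2 := by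
  rw [Real.sqrt_le_left (by norm_num)]; norm_num

theorem holBdd_osc {lam s A : ℝ} (hl : 0 < lam) (hs : 0 < s) (hls : lam * s ≤ 1) (hA : 0 ≤ A)
    {a : Fin N → (Fin d → ℝ) → ℝ} (ha : ∀ n, HolBdd s A (a n)) (l : Fin (N + N + r)) :
    HolBdd s (2 * Real.exp (2 * d) * A / lam) (S.osc r lam a l) := by
  have hB := Real.exp_pos (2 * (d : ℝ))
  have h2 : |√2 / lam| ≤ 2 / lam := by
    rw [abs_of_nonneg (by positivity)]
    exact div_le_div_of_nonneg_right sqrt_two_le_two hl.le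
  have h3 : |√2 / lam| * (A * Real.exp (2 * d)) ≤ 2 * Real.exp (2 * d) * A / lam :=
    (mul_le_mul_of_nonneg_right h2 (by positivity)).trans (le_of_eq (by ring))
  unfold osc
  refine Fin.addCases (fun l => ?_) (fun l => ?_) l
  · refine Fin.addCases (fun l => ?_) (fun l => ?_) l
    · simp only [Fin.append_left]
      exact (((ha l).mul (HolBdd.sin _ (S.sum_abs_mul_le hl.le hs.le hls l)) hs).const_mul
        _).weaken h3
    · simp only [Fin.append_left, Fin.append_right]
      exact (((ha l).mul (HolBdd.cos _ (S.sum_abs_mul_le hl.le hs.le hls l)) hs).const_mul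
        _).weaken h3
  · simp only [Fin.append_right]
    exact HolBdd.zero (by positivity)

theorem smooth_osc {lam : ℝ} {a : Fin N → (Fin d → ℝ) → ℝ} (ha : ∀ n, Smooth (a n))
    (l : Fin (N + N + r)) : Smooth (S.osc r lam a l) := by
  unfold osc
  refine Fin.addCases (fun l => ?_) (fun l => ?_) l
  · refine Fin.addCases (fun l => ?_) (fun l => ?_) l
    · simp only [Fin.append_left]
      exact contDiff_const.mul ((ha l).mul (smooth_sin _))
    · simp only [Fin.append_left, Fin.append_right]
      exact contDiff_const.mul ((ha l).mul (smooth_cos _))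
  · simp only [Fin.append_right]
    exact contDiff_const

theorem pd_amp_mul_sin {c : ℝ} {a : (Fin d → ℝ) → ℝ} (ha : Smooth a) (m : Fin d → ℝ) (i : Fin d)
    (x : Fin d → ℝ) :
    pd i (fun x => c * (a x * Real.sin (∑ i, m i * x i))) x =
      c * (a x * (m i * Real.cos (∑ i, m i * x i)) + Real.sin (∑ i, m i * x i) * pd i a x) := by
  rw [pd_const_mul (Differentiable.fun_mul ha.differentiable (smooth_sin m).differentiable),
    pd_mul ha.differentiable (smooth_sin m).differentiable, pd_sin]

theorem pd_amp_mul_cos {c : ℝ} {a : (Fin d → ℝ) → ℝ} (ha : Smooth a) (m : Fin d → ℝ) (i : Fin d)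
    (x : Fin d → ℝ) :
    pd i (fun x => c * (a x * Real.cos (∑ i, m i * x i))) x =
      c * (a x * (-(m i * Real.sin (∑ i, m i * x i))) + Real.cos (∑ i, m i * x i) * pd i a x) := by
  rw [pd_const_mul (Differentiable.fun_mul ha.differentiable (smooth_cos m).differentiable),
    pd_mul ha.differentiable (smooth_cos m).differentiable, pd_cos]

theorem holBdd_pd_osc {lam s A A' : ℝ} (hl : 0 < lam) (hs : 0 < s) (hls : lam * s ≤ 1)
    (hA : 0 ≤ A) (hA' : 0 ≤ A')
    {a : Fin N → (Fin d → ℝ) → ℝ} (ha : ∀ n, HolBdd s A (a n))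
    (hpa : ∀ n i, HolBdd s A' (pd i (a n))) (l : Fin (N + N + r)) (i : Fin d) :
    HolBdd s (2 * Real.exp (2 * d) * (A + A' / lam)) (pd i (S.osc r lam a l)) := by
  have hB := Real.exp_pos (2 * (d : ℝ))
  have h2 : |√2 / lam| ≤ 2 / lam := by
    rw [abs_of_nonneg (by positivity)]
    exact div_le_div_of_nonneg_right sqrt_two_le_two hl.le
  have has : ∀ n, Smooth (a n) := fun n => (ha n).contDiff hs
  have h4 : ∀ n, |lam * S.η n i| ≤ lam := fun n => by
    rw [abs_mul, abs_of_pos hl]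
    exact mul_le_of_le_one_right hl.le (S.abs_le n i)
  have h3 : ∀ n, |√2 / lam| * (A * (|lam * S.η n i| * Real.exp (2 * d)) + Real.exp (2 * d) * A') ≤
      2 * Real.exp (2 * d) * (A + A' / lam) := fun n => by
    calc _ ≤ 2 / lam * (A * (lam * Real.exp (2 * d)) + Real.exp (2 * d) * A') := by
            gcongr; exact h4 n
      _ = _ := by field_simp
  unfold osc
  refine Fin.addCases (fun l => ?_) (fun l => ?_) l
  · refine Fin.addCases (fun l => ?_) (fun l => ?_) l
    · simp only [Fin.append_left]
      have hb := S.sum_abs_mul_le hl.le hs.le hls l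
      exact (((((ha l).mul ((HolBdd.cos _ hb).const_mul (lam * S.η l i)) hs).add
        ((HolBdd.sin _ hb).mul (hpa l i) hs)).const_mul _).weaken (h3 l)).congr
          fun x => (pd_amp_mul_sin (c := √2 / lam) (has l) (fun i => lam * S.η l i) i x).symm
    · simp only [Fin.append_left, Fin.append_right]
      have hb := S.sum_abs_mul_le hl.le hs.le hls l
      exact (((((ha l).mul (((HolBdd.sin _ hb).const_mul (lam * S.η l i)).neg) hs).add
        ((HolBdd.cos _ hb).mul (hpa l i) hs)).const_mul _).weaken (h3 l)).congr
          fun x => (pd_amp_mul_cos (c := √2 / lam) (has l) (fun i => lam * S.η l i) i x).symm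
  · simp only [Fin.append_right]
    refine (HolBdd.zero (by positivity)).congr fun x => ?_
    simp [_root_.pd]

theorem sum_pd_osc {lam : ℝ} (hl : 0 < lam) {a : Fin N → (Fin d → ℝ) → ℝ}
    (ha : ∀ n, Smooth (a n)) (i j : Fin d) (x : Fin d → ℝ) :
    ∑ l, (1 / 2) * (pd i (S.osc r lam a l) x * pd j (S.osc r lam a l) x) =
      ∑ n, a n x ^ 2 * (S.η n i * S.η n j) + 1 / lam ^ 2 * ∑ n, pd i (a n) x * pd j (a n) x := by
  have h0 : ∀ i : Fin d, pd i (fun _ : Fin d → ℝ => (0 : ℝ)) x = 0 := fun i => by simp [pd]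
  rw [Fin.sum_univ_add, Fin.sum_univ_add]
  simp only [osc, Fin.append_left, Fin.append_right, h0]
  simp_rw [pd_amp_mul_sin (ha _), pd_amp_mul_cos (ha _)]
  rw [Finset.mul_sum, ← Finset.sum_add_distrib, ← Finset.sum_add_distrib]
  simp only [mul_zero, Finset.sum_const_zero, add_zero]
  refine Finset.sum_congr rfl fun n _ => ?_
  have hs2 : √(2 : ℝ) ^ 2 = 2 := Real.sq_sqrt (by norm_num)
  have hcs := Real.sin_sq_add_cos_sq (∑ i, lam * S.η n i * x i)
  set s := Real.sin (∑ i, lam * S.η n i * x i)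
  set c := Real.cos (∑ i, lam * S.η n i * x i)
  have : ∀ p q : ℝ, 1 / 2 * (√2 / lam * (a n x * (lam * S.η n i * c) + s * p) *
      (√2 / lam * (a n x * (lam * S.η n j * c) + s * q))) +
      1 / 2 * (√2 / lam * (a n x * (-(lam * S.η n i * s)) + c * p) *
      (√2 / lam * (a n x * (-(lam * S.η n j * s)) + c * q))) =
      (√2 ^ 2 / 2) * (s ^ 2 + c ^ 2) * (a n x ^ 2 * (S.η n i * S.η n j) * (lam ^ 2 / lam ^ 2) +
        1 / lam ^ 2 * (p * q)) := by
    intro p q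
    field_simp
    ring
  refine (this (pd i (a n) x) (pd j (a n) x)).trans ?_
  rw [hs2, hcs, div_self (show (lam ^ 2) ≠ 0 by positivity)]
  ring

/-- The error of the oscillating perturbation with amplitudes `a`. -/
def oscErr (r : ℕ) (lam : ℝ) (v : Fin (N + N + r) → (Fin d → ℝ) → ℝ)
    (a : Fin N → (Fin d → ℝ) → ℝ) (i j : Fin d) (x : Fin d → ℝ) : ℝ :=
  ∑ l, S.osc r lam a l x * symHess i j (v l) x - 1 / lam ^ 2 * ∑ n, pd i (a n) x * pd j (a n) x

theorem oscErr_comm (lam : ℝ) (v : Fin (N + N + r) → (Fin d → ℝ) → ℝ)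
    (a : Fin N → (Fin d → ℝ) → ℝ) (i j : Fin d) (x : Fin d → ℝ) :
    S.oscErr r lam v a i j x = S.oscErr r lam v a j i x := by
  unfold oscErr
  simp_rw [symHess_comm i j, mul_comm (pd i (a _) x)]

theorem metricForm_osc {lam : ℝ} (hl : 0 < lam) {v : Fin (N + N + r) → (Fin d → ℝ) → ℝ}
    {w : Fin d → (Fin d → ℝ) → ℝ} {a : Fin N → (Fin d → ℝ) → ℝ} (hv : ∀ l, Smooth (v l))
    (hw : ∀ i, Smooth (w i)) (ha : ∀ n, Smooth (a n)) (i j : Fin d) (x : Fin d → ℝ) :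
    metricForm (fun l y => v l y + S.osc r lam a l y)
      (fun i y => w i y + compensate v (S.osc r lam a) (fun _ _ => 0) i y) i j x =
      metricForm v w i j x + ∑ n, a n x ^ 2 * (S.η n i * S.η n j) - S.oscErr r lam v a i j x := by
  have h0 : ∀ i : Fin d, pd i (fun _ : Fin d → ℝ => (0 : ℝ)) x = 0 := fun i => by simp [pd]
  rw [metricForm_add hv (S.smooth_osc ha) hw (fun _ => contDiff_const), Finset.sum_sub_distrib,
    S.sum_pd_osc hl ha, h0, h0]
  unfold oscErr
  ring

/-- Difference of the errors for different amplitudes. -/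
theorem holBdd_oscErr_sub {lam s A Q Q' H : ℝ} (hl : 0 < lam) (hs : 0 < s) (hls : lam * s ≤ 1)
    (hA : 0 ≤ A) {v : Fin (N + N + r) → (Fin d → ℝ) → ℝ}
    (hppv : ∀ l i j, HolBdd s H (pd i (pd j (v l))))
    {a b : Fin N → (Fin d → ℝ) → ℝ} (ha : ∀ n, Smooth (a n)) (hb : ∀ n, Smooth (b n))
    (hab : ∀ n, HolBdd s A (fun x => a n x - b n x))
    (hpa : ∀ n i, HolBdd s Q (pd i (a n))) (hpb : ∀ n i, HolBdd s Q (pd i (b n)))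
    (hpab : ∀ n i, HolBdd s Q' (pd i (fun x => a n x - b n x))) (i j : Fin d) :
    HolBdd s (((N + N + r : ℕ) : ℝ) * (2 * Real.exp (2 * d) * A / lam * H) +
      N * (2 * Q * Q') / lam ^ 2)
      (fun x => S.oscErr r lam v a i j x - S.oscErr r lam v b i j x) := by
  have hsy : ∀ l, HolBdd s H (symHess i j (v l)) := fun l =>
    ((((hppv l i j).add (hppv l j i)).const_mul (1 / 2)).weaken (le_of_eq (by
      rw [abs_of_pos (by norm_num)]; ring))).congr fun x => by unfold symHess; ring
  have h1 := HolBdd.sum (Finset.univ : Finset (Fin (N + N + r))) fun l _ =>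
    (S.holBdd_osc (r := r) hl hs hls hA hab l).mul (hsy l) hs
  have h2 := (HolBdd.sum (Finset.univ : Finset (Fin N)) fun n _ =>
    ((hpa n i).mul (hpab n j) hs).add ((hpab n i).mul (hpb n j) hs)).const_mul (1 / lam ^ 2)
  refine ((h1.sub h2).weaken (le_of_eq ?_)).congr fun x => ?_
  · rw [abs_of_pos (by positivity)]
    simp only [Finset.sum_const, Finset.card_univ, Fintype.card_fin, nsmul_eq_mul]
    ring
  · unfold oscErr
    have e : ∀ n i, pd i (fun x => a n x - b n x) x = pd i (a n) x - pd i (b n) x := fun n i =>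
      pd_sub (ha n).differentiable (hb n).differentiable i x
    simp_rw [e]
    have e2 : ∑ n, (pd i (a n) x * (pd j (a n) x - pd j (b n) x) +
        (pd i (a n) x - pd i (b n) x) * pd j (b n) x) =
        ∑ n, pd i (a n) x * pd j (a n) x - ∑ n, pd i (b n) x * pd j (b n) x := by
      rw [← Finset.sum_sub_distrib]
      exact Finset.sum_congr rfl fun n _ => by ring
    simp_rw [e2, S.osc_sub, sub_mul, Finset.sum_sub_distrib]
    ring

/-- The constants in the iteration that removes the error of the oscillating perturbation: the
bounds for the gradients of the amplitudes, for the increments and for the errors. -/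
def oscConst (r : ℕ) : ℕ → ℝ × ℝ × ℝ
  | 0 => (4, 32 * N + 4 * ((N + N + r : ℕ) : ℝ) * Real.exp (2 * d), 0)
  | j + 1 =>
    let c := oscConst r j
    let q := c.1 + 2 ^ (j + 2) * (c.2.1 / (8 * S.rad))
    (q, c.2.1 / (8 * S.rad) *
      (2 ^ (j + 3) * N * q + 2 * ((N + N + r : ℕ) : ℝ) * Real.exp (2 * d)), c.2.2 + c.2.1)

theorem oscConst_nonneg (r j : ℕ) :
    0 ≤ (S.oscConst r j).1 ∧ 0 ≤ (S.oscConst r j).2.1 ∧ 0 ≤ (S.oscConst r j).2.2 := by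
  have hr := S.rad_pos
  induction j with
  | zero => simp only [oscConst]; refine ⟨by norm_num, by positivity, le_rfl⟩
  | succ j ih =>
    obtain ⟨h1, h2, h3⟩ := ih
    simp only [oscConst]
    refine ⟨by positivity, by positivity, by positivity⟩

/-- The successive errors. -/
def oscSeq (r : ℕ) (lam t : ℝ) (v : Fin (N + N + r) → (Fin d → ℝ) → ℝ)
    (R : Fin d → Fin d → (Fin d → ℝ) → ℝ) : ℕ → Fin d → Fin d → (Fin d → ℝ) → ℝ
  | 0 => fun _ _ _ => 0
  | j + 1 => S.oscErr r lam v (S.amp t (fun a b x => R a b x + oscSeq r lam t v R j a b x))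

theorem oscSeq_comm (lam t : ℝ) (v : Fin (N + N + r) → (Fin d → ℝ) → ℝ)
    (R : Fin d → Fin d → (Fin d → ℝ) → ℝ) (m : ℕ) (i j : Fin d) (x : Fin d → ℝ) :
    S.oscSeq r lam t v R m i j x = S.oscSeq r lam t v R m j i x := by
  cases m with
  | zero => rfl
  | succ m => exact S.oscErr_comm _ _ _ _ _ _

theorem holBdd_add_oscSeq {s ρ δ ε c : ℝ} (hδ : 0 < δ) (hsρ : s ≤ ρ)
    {R E : Fin d → Fin d → (Fin d → ℝ) → ℝ} (hR : ∀ i j, HolBdd ρ (S.rad * δ) (R i j))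
    (hE : ∀ i j, HolBdd s (c * (δ * ε)) (E i j)) (hc : c * ε ≤ S.rad) (i j : Fin d) :
    HolBdd s (2 * S.rad * δ) (fun x => R i j x + E i j x) :=
  (((hR i j).shrink hsρ).add (hE i j)).weaken (by nlinarith)

/-- Lipschitz dependence of the amplitudes. -/
theorem holBdd_amp_sub_amp {s δ δ' e : ℝ} (hs : 0 < s) (hδ : 0 < δ) (hδ' : 0 ≤ δ')
    (hδδ : δ' ≤ δ / 4) (he : 0 ≤ e) {R E E' : Fin d → Fin d → (Fin d → ℝ) → ℝ}
    (hR : ∀ i j, HolBdd s (2 * S.rad * δ) (fun x => R i j x + E i j x))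
    (hR' : ∀ i j, HolBdd s (2 * S.rad * δ) (fun x => R i j x + E' i j x))
    (hE : ∀ i j, HolBdd s (e * δ) (fun x => E' i j x - E i j x)) (n : Fin N) :
    HolBdd s (e / (8 * S.rad) * √δ)
      (fun x => S.amp (δ - δ') (fun i j x => R i j x + E' i j x) n x -
        S.amp (δ - δ') (fun i j x => R i j x + E i j x) n x) := by
  have hq : 0 < √δ := Real.sqrt_pos.2 hδ
  have hsq : √δ * √δ = δ := Real.mul_self_sqrt hδ.le
  have hr := S.rad_pos
  set a := S.amp (δ - δ') (fun i j x => R i j x + E i j x) n with ha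
  set b := S.amp (δ - δ') (fun i j x => R i j x + E' i j x) n with hb
  have h1 : HolBdd s √δ (fun x => (b x + a x) - 2 * √δ) :=
    (((S.holBdd_amp_sub hs hδ hδ' hδδ hR' n).add
      (S.holBdd_amp_sub hs hδ hδ' hδδ hR n)).weaken (le_of_eq (by ring))).congr fun x => by
        rw [ha, hb]; ring
  have h2 := HolBdd.div hq (S.holBdd_coef hE n) h1
  refine (h2.weaken ?_).congr fun x => ?_
  · have h3 : ∑ i, ∑ j, |S.L n i j| ≤ 1 / (8 * S.rad) := by
      rw [le_div_iff₀ (by positivity)]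
      linarith [S.sum_abs_mul_rad_le n]
    rw [div_le_iff₀ hq]
    calc (∑ i, ∑ j, |S.L n i j|) * (e * δ) ≤ 1 / (8 * S.rad) * (e * δ) := by gcongr
      _ = e / (8 * S.rad) * √δ * √δ := by rw [mul_assoc _ √δ, hsq]; ring
  · have hab : ∀ x, b x ^ 2 - a x ^ 2 = S.coef n (fun i j x => E' i j x - E i j x) x := by
      intro x
      rw [ha, hb, S.amp_sq hs hδ hδ' hδδ hR', S.amp_sq hs hδ hδ' hδδ hR]
      unfold coef
      simp only [mul_add, mul_sub, Finset.sum_add_distrib, Finset.sum_sub_distrib]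
      ring
    have hpos : 0 < b x + a x := by
      have := h1.abs_le hs x
      rw [_root_.abs_le] at this
      linarith
    rw [← hab, div_eq_iff hpos.ne']
    ring

theorem oscSeq_bounds {lam ρ δ δ' ε H : ℝ} {v : Fin (N + N + r) → (Fin d → ℝ) → ℝ}
    {R : Fin d → Fin d → (Fin d → ℝ) → ℝ} (hl : 0 < lam) (hρ : 0 < ρ) (hδ : 0 < δ) (hδ' : 0 ≤ δ')
    (hδδ : δ' ≤ δ / 4) (hε : ε ≤ 1) (hρε : 1 / (lam * ρ) ≤ ε) (hH : H / lam ≤ ε * √δ)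
    (hppv : ∀ l i j, HolBdd ρ H (pd i (pd j (v l))))
    (hR : ∀ i j, HolBdd ρ (S.rad * δ) (R i j)) (J : ℕ)
    (hJ : ∀ j ≤ J, (S.oscConst r j).2.2 * ε ≤ S.rad) (j : ℕ) (hj : j ≤ J) :
    (∀ a b, HolBdd (1 / (2 ^ j * lam)) ((S.oscConst r j).2.2 * (δ * ε))
      (S.oscSeq r lam (δ - δ') v R j a b)) ∧
    (∀ n i, HolBdd (1 / (2 ^ (j + 1) * lam)) ((S.oscConst r j).1 * (lam * ε * √δ))
      (pd i (S.amp (δ - δ') (fun a b x => R a b x + S.oscSeq r lam (δ - δ') v R j a b x) n))) ∧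
    ∀ a b, HolBdd (1 / (2 ^ (j + 1) * lam)) ((S.oscConst r j).2.1 * ε ^ (j + 1) * δ)
      (fun x => S.oscSeq r lam (δ - δ') v R (j + 1) a b x -
        S.oscSeq r lam (δ - δ') v R j a b x) := by
  have hq : 0 < √δ := Real.sqrt_pos.2 hδ
  have hsq : √δ * √δ = δ := Real.mul_self_sqrt hδ.le
  have hr := S.rad_pos
  have hε0 : 0 < ε := lt_of_lt_of_le (by positivity) hρε
  have hlρ : 1 / lam ≤ ρ := by
    have h1 : 1 / (lam * ρ) ≤ 1 := hρε.trans hε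
    rw [div_le_one (by positivity)] at h1
    rwa [div_le_iff₀ hl, mul_comm]
  set s : ℕ → ℝ := fun j => 1 / (2 ^ j * lam) with hs
  have hs0 : ∀ j, 0 < s j := fun j => by simp only [hs]; positivity
  have hss : ∀ j, s (j + 1) = s j / 2 := fun j => by
    simp only [hs]; field_simp; ring
  have hss' : ∀ j, s (j + 1) ≤ s j := fun j => by rw [hss]; linarith [hs0 j]
  have hsl : ∀ j, lam * s j ≤ 1 := by
    intro j
    simp only [hs]
    have : (1 : ℝ) ≤ 2 ^ j := one_le_pow₀ (by norm_num)
    rw [mul_one_div, div_le_one (by positivity)]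
    exact le_mul_of_one_le_left hl.le this
  have hsρ : ∀ j, s j ≤ ρ := by
    intro j
    refine le_trans ?_ hlρ
    have : (1 : ℝ) ≤ 2 ^ j := one_le_pow₀ (by norm_num)
    exact one_div_le_one_div_of_le hl (le_mul_of_one_le_left hl.le this)
  set E := S.oscSeq r lam (δ - δ') v R with hE
  set a : ℕ → Fin N → (Fin d → ℝ) → ℝ :=
    fun j => S.amp (δ - δ') (fun a b x => R a b x + E j a b x) with ha
  have hEa : ∀ j, E (j + 1) = S.oscErr r lam v (a j) := fun j => rfl
  have hB := Real.exp_pos (2 * (d : ℝ))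
  change (∀ p q, HolBdd (s j) _ (E j p q)) ∧ (∀ n i, HolBdd (s (j + 1)) _ (pd i (a j n))) ∧
    ∀ p q, HolBdd (s (j + 1)) _ (fun x => E (j + 1) p q x - E j p q x)
  induction j with
  | zero =>
    have hE0 : ∀ p q, HolBdd (s 0) ((S.oscConst r 0).2.2 * (δ * ε)) (E 0 p q) := fun p q => by
      refine HolBdd.zero ?_
      simp [oscConst]
    have hR2 : ∀ p q, HolBdd ρ (2 * S.rad * δ) (fun x => R p q x + E 0 p q x) := fun p q =>
      ((hR p q).weaken (by nlinarith [mul_pos hr hδ])).congr fun x => by simp [hE, oscSeq]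
    have ha0 : ∀ n, HolBdd ρ (2 * √δ) (a 0 n) := S.holBdd_amp hρ hδ hδ' hδδ hR2
    have hpa : ∀ n i, HolBdd (s 1) ((S.oscConst r 0).1 * (lam * ε * √δ)) (pd i (a 0 n)) :=
      fun n i => ((ha0 n).pd hρ i).mono (by rw [hss 0]; linarith [hsρ 0]) (by
        have : 2 * (2 * √δ) / ρ = 4 * (lam * (1 / (lam * ρ)) * √δ) := by field_simp; ring
        rw [this]
        simp only [oscConst]
        gcongr)
    refine ⟨hE0, hpa, fun p q => ?_⟩
    have has : ∀ n, Smooth (a 0 n) := fun n => (ha0 n).contDiff hρ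
    have ha0' : ∀ n, HolBdd (s 1) (2 * √δ) (fun x => a 0 n x - (fun _ => (0 : ℝ)) x) := fun n =>
      ((ha0 n).shrink (hsρ 1)).congr fun x => by simp
    have hpa' : ∀ n i, HolBdd (s 1) ((S.oscConst r 0).1 * (lam * ε * √δ))
        (pd i (fun x => a 0 n x - (fun _ => (0 : ℝ)) x)) := fun n i => by
      simpa using hpa n i
    have hz : (0 : ℝ) ≤ (S.oscConst r 0).1 * (lam * ε * √δ) :=
      mul_nonneg (S.oscConst_nonneg r 0).1 (by positivity)
    have h := S.holBdd_oscErr_sub (b := fun _ _ => 0) hl (hs0 1) (hsl 1) (by positivity)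
      (fun l i j => (hppv l i j).shrink (hsρ 1)) has (fun _ => contDiff_const) ha0' hpa
      (fun n i => (HolBdd.zero hz).congr fun x => by simp [pd]) hpa' p q
    refine (h.weaken ?_).congr fun x => ?_
    · simp only [oscConst]
      have h1 : ((N + N + r : ℕ) : ℝ) * (2 * Real.exp (2 * d) * (2 * √δ) / lam * H) ≤
          4 * ((N + N + r : ℕ) : ℝ) * Real.exp (2 * d) * ε * δ := by
        calc _ = 4 * ((N + N + r : ℕ) : ℝ) * Real.exp (2 * d) * √δ * (H / lam) := by ring
          _ ≤ 4 * ((N + N + r : ℕ) : ℝ) * Real.exp (2 * d) * √δ * (ε * √δ) := by gcongr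
          _ = 4 * ((N + N + r : ℕ) : ℝ) * Real.exp (2 * d) * ε * (√δ * √δ) := by ring
          _ = _ := by rw [hsq]
      have h2 : N * (2 * (4 * (lam * ε * √δ)) * (4 * (lam * ε * √δ))) / lam ^ 2 ≤
          32 * N * ε * δ := by
        calc _ = 32 * N * (ε * ε) * (√δ * √δ) := by field_simp; ring
          _ ≤ 32 * N * (ε * 1) * (√δ * √δ) := by gcongr
          _ = _ := by rw [hsq, mul_one]
      rw [zero_add, pow_one]
      linarith
    · have h3 : S.oscErr r lam v (fun _ _ => 0) p q x = 0 := by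
        have h4 : ∀ l, S.osc r lam (fun _ _ => 0) l x = 0 := fun l => by
          simpa using S.osc_sub (r := r) lam (fun _ _ => 0) (fun _ _ => 0) l x
        simp [oscErr, h4, pd]
      rw [h3, hEa]
      simp [hE, oscSeq]
  | succ j ih =>
    obtain ⟨h1, h2, h3⟩ := ih (by omega)
    obtain ⟨c1, c2, c3⟩ := S.oscConst_nonneg r j
    set Q := (S.oscConst r j).1 with hQ
    set kc := (S.oscConst r j).2.1 with hkc
    set ks := (S.oscConst r j).2.2 with hks
    have hεj : ε ^ (j + 1) ≤ ε := pow_le_of_le_one hε0.le hε (by omega)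
    have hE1 : ∀ p q, HolBdd (s (j + 1)) ((S.oscConst r (j + 1)).2.2 * (δ * ε)) (E (j + 1) p q) :=
      fun p q => ((((h1 p q).shrink (hss' j)).add (h3 p q)).weaken (by
        have : kc * ε ^ (j + 1) * δ ≤ kc * ε * δ := by gcongr
        simp only [oscConst]
        rw [← hks, ← hkc]
        linarith)).congr fun x => by ring
    have hRj : ∀ p q, HolBdd (s (j + 1)) (2 * S.rad * δ) (fun x => R p q x + E j p q x) :=
      S.holBdd_add_oscSeq hδ (hsρ _) hR (fun p q => (h1 p q).shrink (hss' j)) (hJ j (by omega))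
    have hRj1 : ∀ p q, HolBdd (s (j + 1)) (2 * S.rad * δ) (fun x => R p q x + E (j + 1) p q x) :=
      S.holBdd_add_oscSeq hδ (hsρ _) hR hE1 (hJ (j + 1) hj)
    set L := kc / (8 * S.rad) with hL
    have hL0 : 0 ≤ L := by positivity
    have hda : ∀ n, HolBdd (s (j + 1)) (L * ε ^ (j + 1) * √δ) (fun x => a (j + 1) n x - a j n x) :=
      fun n => (S.holBdd_amp_sub_amp (hs0 _) hδ hδ' hδδ (by positivity) hRj hRj1 h3 n).weaken
        (le_of_eq (by rw [hL]; ring))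
    have has : ∀ n, Smooth (a j n) := fun n =>
      (S.holBdd_amp (hs0 _) hδ hδ' hδδ hRj n).contDiff (hs0 (j + 1))
    have has1 : ∀ n, Smooth (a (j + 1) n) := fun n =>
      (S.holBdd_amp (hs0 _) hδ hδ' hδδ hRj1 n).contDiff (hs0 (j + 1))
    have hpda : ∀ n i, HolBdd (s (j + 2)) (2 ^ (j + 2) * L * ε ^ (j + 1) * (lam * √δ))
        (pd i (fun x => a (j + 1) n x - a j n x)) := fun n i =>
      ((hda n).pd (hs0 _) i).mono (hss (j + 1)).le (le_of_eq (by
        simp only [hs]; field_simp; ring))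
    have hc1 : (S.oscConst r (j + 1)).1 = Q + 2 ^ (j + 2) * L := rfl
    have hc2 : (S.oscConst r (j + 1)).2.1 = L * (2 ^ (j + 3) * N * (Q + 2 ^ (j + 2) * L) +
      2 * ((N + N + r : ℕ) : ℝ) * Real.exp (2 * d)) := rfl
    have hpa1 : ∀ n i, HolBdd (s (j + 2)) ((S.oscConst r (j + 1)).1 * (lam * ε * √δ))
        (pd i (a (j + 1) n)) := fun n i =>
      ((((h2 n i).shrink (hss' (j + 1))).add (hpda n i)).weaken (by
        rw [hc1]
        have : 2 ^ (j + 2) * L * ε ^ (j + 1) * (lam * √δ) ≤ 2 ^ (j + 2) * L * ε * (lam * √δ) := by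
          gcongr
        linarith)).congr fun x => by
          rw [pd_sub (has1 n).differentiable (has n).differentiable]; ring
    refine ⟨hE1, hpa1, fun p q => ?_⟩
    have hpa0 : ∀ n i, HolBdd (s (j + 2)) ((S.oscConst r (j + 1)).1 * (lam * ε * √δ))
        (pd i (a j n)) := fun n i => (h2 n i).mono (hss' (j + 1)) (by
          rw [hc1]; gcongr; exact le_add_of_nonneg_right (by positivity))
    have h := S.holBdd_oscErr_sub hl (hs0 (j + 2)) (hsl _) (by positivity)
      (fun l p q => (hppv l p q).shrink (hsρ (j + 2))) has1 has
      (fun n => (hda n).shrink (hss' (j + 1))) hpa1 hpa0 hpda p q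
    refine (h.weaken ?_).congr fun x => by rw [hEa, hEa]
    have h4 : ((N + N + r : ℕ) : ℝ) * (2 * Real.exp (2 * d) * (L * ε ^ (j + 1) * √δ) / lam * H) ≤
        L * (2 * ((N + N + r : ℕ) : ℝ) * Real.exp (2 * d)) * ε ^ (j + 1 + 1) * δ := by
      calc _ = L * (2 * ((N + N + r : ℕ) : ℝ) * Real.exp (2 * d)) * ε ^ (j + 1) * √δ *
            (H / lam) := by
            ring
        _ ≤ L * (2 * ((N + N + r : ℕ) : ℝ) * Real.exp (2 * d)) * ε ^ (j + 1) * √δ * (ε * √δ) := by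
            gcongr
        _ = L * (2 * ((N + N + r : ℕ) : ℝ) * Real.exp (2 * d)) * ε ^ (j + 1 + 1) * (√δ * √δ) := by
            ring
        _ = _ := by rw [hsq]
    have h5 : N * (2 * ((S.oscConst r (j + 1)).1 * (lam * ε * √δ)) *
        (2 ^ (j + 2) * L * ε ^ (j + 1) * (lam * √δ))) / lam ^ 2 =
        L * (2 ^ (j + 3) * N * (Q + 2 ^ (j + 2) * L)) * ε ^ (j + 1 + 1) * δ := by
      rw [hc1]
      calc _ = L * (2 ^ (j + 3) * N * (Q + 2 ^ (j + 2) * L)) * ε ^ (j + 1 + 1) * (√δ * √δ) := by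
            field_simp; ring
        _ = _ := by rw [hsq]
    rw [h5, hc2]
    linarith

end RankOneBasis

end Oscillation

section LargeCodimensionStage

variable {d N r : ℕ}

theorem RankOneBasis.exists_stage_of_large_codim (S : RankOneBasis d N) (J : ℕ)
    {ρ δ σ Y K Δ : ℝ} {v : Fin (N + N + r) → (Fin d → ℝ) → ℝ} {w : Fin d → (Fin d → ℝ) → ℝ}
    {G : Fin d → Fin d → (Fin d → ℝ) → ℝ}
    (hρ : 0 < ρ) (hρ1 : ρ ≤ 1) (hδ : 0 < δ) (hδΔ : √δ ≤ Δ) (hσ : 4 ≤ σ)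
    (hY : 12 * Real.exp (2 * d) * σ * 2 ^ (J + 2) ≤ Y)
    (hY1 : ∀ j ≤ J, (S.oscConst r j).2.2 * (12 * Real.exp (2 * d) * σ * 2 ^ (J + 2) / Y) ≤ S.rad)
    (hY2 : (S.oscConst r J).1 * (12 * Real.exp (2 * d) * σ * 2 ^ (J + 2) / Y) ≤ 1)
    (hY3 : (S.oscConst r J).2.1 * (12 * Real.exp (2 * d) * σ * 2 ^ (J + 2) / Y) ^ (J + 1) * σ ^ 2 ≤
      S.rad / 2)
    (hv : ∀ l, Smooth (v l)) (hw : ∀ i, Smooth (w i)) (hG : ∀ i j x, G i j x = G j i x)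
    (hK : 0 ≤ K) (hpv : ∀ l i, HolBdd ρ K (pd i (v l)))
    (hppv : ∀ l i j, HolBdd ρ (12 * Real.exp (2 * d) * σ * √δ / ρ) (pd i (pd j (v l))))
    (hR : ∀ i j, HolBdd ρ (S.rad * δ)
      (fun x => G i j x - metricForm v w i j x - δ * S.total i j)) :
    ∃ (v' : Fin (N + N + r) → (Fin d → ℝ) → ℝ) (w' : Fin d → (Fin d → ℝ) → ℝ),
      (∀ l, Smooth (v' l)) ∧ (∀ i, Smooth (w' i)) ∧
      Incr (ρ / Y) (((1 + ((N + N + r : ℕ) : ℝ)) * (6 * Real.exp (2 * d)) +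
        ((N + N + r : ℕ) : ℝ) * (4 * Real.exp (2 * d) * Δ)) * √δ) K v v' w w' ∧
      (∀ l i j, HolBdd (ρ / Y) (12 * Real.exp (2 * d) * σ * √(δ / σ ^ 2) / (ρ / Y))
        (pd i (pd j (v' l)))) ∧
      ∀ i j, HolBdd (ρ / Y) (S.rad * (δ / σ ^ 2) / 2)
        (fun x => G i j x - metricForm v' w' i j x - δ / σ ^ 2 * S.total i j) := by
  set B := Real.exp (2 * d) with hB
  have hB1 : 1 ≤ B := Real.one_le_exp (by positivity)
  have hσ0 : 0 < σ := by linarith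
  have hY0 : 0 < Y := lt_of_lt_of_le (by positivity) hY
  have hq : 0 < √δ := Real.sqrt_pos.2 hδ
  have hsq : √δ * √δ = δ := Real.mul_self_sqrt hδ.le
  have hr := S.rad_pos
  set ε := 12 * B * σ * 2 ^ (J + 2) / Y with hε
  have hε0 : 0 < ε := by positivity
  have hε1 : ε ≤ 1 := (div_le_one hY0).2 hY
  set lam := Y / (2 ^ (J + 2) * ρ) with hlam
  have hl : 0 < lam := by positivity
  set H := 12 * B * σ * √δ / ρ with hHdef
  have hH0 : 0 < H := by positivity
  have hH : H / lam = ε * √δ := by rw [hHdef, hlam, hε]; field_simp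
  have hρε : 1 / (lam * ρ) ≤ ε := by
    have : 1 / (lam * ρ) = 2 ^ (J + 2) / Y := by rw [hlam]; field_simp
    rw [this, hε]
    refine div_le_div_of_nonneg_right (le_mul_of_one_le_left (by positivity) ?_) hY0.le
    nlinarith
  have hlρ1 : 1 ≤ lam * ρ := by
    have h1 := hρε.trans hε1
    rwa [div_le_one (by positivity)] at h1
  have hl1 : 1 ≤ lam := hlρ1.trans (mul_le_of_le_one_right hl.le hρ1)
  set δ' := δ / σ ^ 2 with hδ'
  have hδ'0 : 0 < δ' := by positivity
  have hδδ : δ' ≤ δ / 4 := by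
    rw [hδ', div_le_div_iff₀ (by positivity) (by norm_num)]
    have : 4 ≤ σ ^ 2 := by nlinarith
    gcongr
  have hsδ' : √δ' = √δ / σ := by rw [hδ', Real.sqrt_div hδ.le, Real.sqrt_sq hσ0.le]
  set R : Fin d → Fin d → (Fin d → ℝ) → ℝ :=
    fun i j x => G i j x - metricForm v w i j x - δ * S.total i j with hRdef
  have hRs : ∀ i j x, R i j x = R j i x := by
    intro i j x
    simp only [hRdef, hG i j, metricForm_comm v w i j, S.total_comm i j]
  obtain ⟨hE, hpa, hdE⟩ := S.oscSeq_bounds hl hρ hδ hδ'0.le hδδ hε1 hρε hH.le hppv hR J hY1 J le_rfl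
  set E := S.oscSeq r lam (δ - δ') v R with hEdef
  set a := S.amp (δ - δ') (fun p q x => R p q x + E J p q x) with ha
  set s := 1 / (2 ^ (J + 1) * lam) with hs
  have hs0 : 0 < s := by positivity
  have hsJ : s ≤ 1 / (2 ^ J * lam) := by
    refine one_div_le_one_div_of_le (by positivity) ?_
    gcongr <;> norm_num
  have hsl : lam * s ≤ 1 := by
    have : (1 : ℝ) ≤ 2 ^ (J + 1) := one_le_pow₀ (by norm_num)
    rw [hs, mul_one_div, div_le_one (by positivity)]
    exact le_mul_of_one_le_left hl.le this
  have hsρ : s ≤ ρ := by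
    have h1 : lam * s ≤ lam * ρ := hsl.trans hlρ1
    exact le_of_mul_le_mul_left h1 hl
  have hsY : ρ / Y = s / 2 := by
    rw [hs, hlam]; field_simp; ring
  have hRE : ∀ i j, HolBdd s (2 * S.rad * δ) (fun x => R i j x + E J i j x) :=
    S.holBdd_add_oscSeq hδ hsρ hR (fun p q => (hE p q).shrink hsJ) (hY1 J le_rfl)
  have haa : ∀ n, HolBdd s (2 * √δ) (a n) := S.holBdd_amp hs0 hδ hδ'0.le hδδ hRE
  have has : ∀ n, Smooth (a n) := fun n => (haa n).contDiff hs0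
  have hsum := S.sum_amp_sq hs0 hδ hδ'0.le hδδ hRE
    (fun i j x => by rw [hRs i j, hEdef, S.oscSeq_comm])
  have hpa' : ∀ n i, HolBdd s (lam * √δ) (pd i (a n)) := fun n i => (hpa n i).weaken (by
    calc (S.oscConst r J).1 * (lam * ε * √δ) = ((S.oscConst r J).1 * ε) * (lam * √δ) := by ring
      _ ≤ 1 * (lam * √δ) := by gcongr
      _ = _ := one_mul _)
  have hf : ∀ l, HolBdd s (4 * B * √δ / lam) (S.osc r lam a l) := fun l =>
    (S.holBdd_osc hl hs0 hsl (by positivity) haa l).weaken (le_of_eq (by ring))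
  have hpf : ∀ l i, HolBdd s (6 * B * √δ) (pd i (S.osc r lam a l)) := fun l i =>
    (S.holBdd_pd_osc hl hs0 hsl (by positivity) (by positivity) haa hpa' l i).weaken
      (le_of_eq (by field_simp; ring))
  have hfs := S.smooth_osc (r := r) (lam := lam) has
  have hs2 : s / 2 ≤ s := by linarith
  have hF : 4 * B * √δ / lam ≤ 6 * B * √δ := by
    rw [div_le_iff₀ hl]
    have h1 : 4 * B * √δ * 1 ≤ 6 * B * √δ * lam := by gcongr; norm_num
    linarith
  have hinc := Incr.of_compensate (P := 6 * B * √δ) (h := 4 * B * δ) (u := fun _ _ => 0) hs0 hF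
    (by positivity) (by positivity) hv hw hf (fun _ => HolBdd.zero (by positivity)) hpf
    (fun i j => (HolBdd.zero (by positivity)).congr fun x => by simp [pd]) hK
    (fun l i => (hpv l i).shrink hsρ) (by
      intro l i j
      refine ((hf l).mul ((hppv l j i).shrink hsρ) hs0).weaken ?_
      calc 4 * B * √δ / lam * H = 4 * B * √δ * (H / lam) := by ring
        _ = 4 * B * (√δ * √δ) * ε := by rw [hH]; ring
        _ ≤ 4 * B * (√δ * √δ) * 1 := by gcongr
        _ = _ := by rw [hsq, mul_one])
  rw [hsY]
  refine ⟨_, _, fun l => (hv l).add (hfs l),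
    fun i => (hw i).add (smooth_compensate hv hfs (fun _ => contDiff_const) i),
    hinc.mono hs2 ?_ hK, ?_, ?_⟩
  · have : 4 * B * δ ≤ 4 * B * Δ * √δ := by
      calc 4 * B * δ = 4 * B * √δ * √δ := by rw [mul_assoc _ √δ, hsq]
        _ ≤ _ := by gcongr
    have h2 : ((N + N + r : ℕ) : ℝ) * (4 * B * δ) ≤ ((N + N + r : ℕ) : ℝ) * (4 * B * Δ * √δ) := by
      gcongr
    linarith
  · intro l i j
    have h1 : ∀ x, pd i (pd j (fun y => v l y + S.osc r lam a l y)) x =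
        pd i (pd j (v l)) x + pd i (pd j (S.osc r lam a l)) x := by
      intro x
      have : (pd j (fun y => v l y + S.osc r lam a l y)) =
          fun x => pd j (v l) x + pd j (S.osc r lam a l) x := by
        funext x
        rw [pd_add (hv l).differentiable (hfs l).differentiable]
      rw [this, pd_add ((hv l).pd j).differentiable ((hfs l).pd j).differentiable]
    refine ((((hppv l i j).shrink (hs2.trans hsρ)).add ((hpf l j).pd hs0 i)).weaken ?_).congr
      fun x => (h1 x).symm
    rw [← hsY, hsδ']
    have h2 : 2 * (6 * B * √δ) / s = 6 * B * √δ * Y / ρ := by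
      have : s = 2 * (ρ / Y) := by rw [hsY]; ring
      rw [this]; field_simp
    have h3 : 12 * B * σ * (√δ / σ) / (ρ / Y) = 6 * B * √δ * Y / ρ + 6 * B * √δ * Y / ρ := by
      field_simp; ring
    rw [h2, h3]
    have h4 : 2 * σ ≤ Y := by
      refine le_trans ?_ hY
      have h5 : (1 : ℝ) ≤ 2 ^ (J + 2) := one_le_pow₀ (by norm_num)
      have h6 : 2 * σ * 1 ≤ 12 * B * σ * 2 ^ (J + 2) := by gcongr; linarith
      linarith
    have h7 : H ≤ 6 * B * √δ * Y / ρ := by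
      rw [hHdef]
      gcongr ?_ / _
      calc 12 * B * σ * √δ = 6 * B * √δ * (2 * σ) := by ring
        _ ≤ _ := by gcongr
    linarith
  · intro i j
    refine (((hdE i j).shrink hs2).weaken ?_).congr fun x => ?_
    · rw [hδ']
      calc _ = ((S.oscConst r J).2.1 * ε ^ (J + 1) * σ ^ 2) * (δ / σ ^ 2) := by field_simp
        _ ≤ (S.rad / 2) * (δ / σ ^ 2) := by gcongr
        _ = _ := by ring
    · rw [S.metricForm_osc hl hv hw has, hsum]
      have h1 : E (J + 1) i j x = S.oscErr r lam v a i j x := rfl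
      rw [h1]
      simp only [hRdef]
      ring

end LargeCodimensionStage

section ExpTransform

variable {d : ℕ} {F : Type} [NormedAddCommGroup F] [NormedSpace ℂ F]

/-- The complex linear functional `z ↦ ∑ zᵢ uᵢ`. -/
def dotCLM (u : Fin d → ℝ) : (Fin d → ℂ) →L[ℂ] ℂ :=
  ∑ i, (u i : ℂ) • ContinuousLinearMap.proj (R := ℂ) (φ := fun _ : Fin d => ℂ) i

theorem dotCLM_apply (u : Fin d → ℝ) (z : Fin d → ℂ) : dotCLM u z = ∑ i, z i * (u i : ℂ) := by
  simp [dotCLM, mul_comm]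

theorem continuous_dotCLM : Continuous (dotCLM (d := d)) := by
  unfold dotCLM
  fun_prop

theorem continuous_dotCLM_apply (z : Fin d → ℂ) : Continuous fun u => dotCLM (d := d) u z := by
  simp only [dotCLM_apply]
  fun_prop

theorem hasFDerivAt_integral_exp (c : ℂ) {φ : (Fin d → ℝ) → F} (hφ : Continuous φ)
    (hs : HasCompactSupport φ) (z₀ : Fin d → ℂ) :
    HasFDerivAt (fun z : Fin d → ℂ => ∫ u, Complex.exp (c * dotCLM u z) • φ u)
      (∫ u, Complex.exp (c * dotCLM u z₀) • (c • dotCLM u).smulRight (φ u)) z₀ := by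
  have hc : ∀ z : Fin d → ℂ, Continuous fun u => Complex.exp (c * dotCLM u z) := fun z =>
    Complex.continuous_exp.comp (continuous_const.mul (continuous_dotCLM_apply z))
  have hg : Continuous fun u => (c • dotCLM u).smulRight (φ u) := by
    have : Continuous fun u : Fin d → ℝ => (ContinuousLinearMap.smulRightL ℂ (Fin d → ℂ) F
        (c • dotCLM u)) (φ u) := by
      have h1 := continuous_dotCLM (d := d)
      fun_prop
    exact this
  have hgs : HasCompactSupport fun u => (c • dotCLM u).smulRight (φ u) := by
    refine hs.mono fun u hu => ?_
    contrapose! hu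
    simp only [Function.mem_support, not_not] at hu ⊢
    ext; simp [hu]
  refine hasFDerivAt_integral_of_dominated_of_fderiv_le (𝕜 := ℂ)
    (F' := fun z u => Complex.exp (c * dotCLM u z) • (c • dotCLM u).smulRight (φ u))
    (bound := fun u => Real.exp (‖c‖ * (‖dotCLM u‖ * (‖z₀‖ + 1))) *
      ‖(c • dotCLM u).smulRight (φ u)‖)
    (Metric.ball_mem_nhds z₀ one_pos) ?_ ?_ ?_ ?_ ?_ ?_
  · exact Filter.Eventually.of_forall fun z => ((hc z).smul hφ).aestronglyMeasurable
  · exact ((hc z₀).smul hφ).integrable_of_hasCompactSupport hs.smul_left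
  · exact ((hc z₀).smul hg).aestronglyMeasurable
  · refine Filter.Eventually.of_forall fun u z hz => ?_
    rw [norm_smul, Complex.norm_exp]
    have h1 : ‖z‖ ≤ ‖z₀‖ + 1 := by
      have := norm_sub_norm_le z z₀
      rw [Metric.mem_ball, dist_eq_norm] at hz
      linarith
    gcongr
    refine (Complex.re_le_norm _).trans ?_
    rw [norm_mul]
    gcongr
    exact ((dotCLM u).le_opNorm z).trans (by gcongr)
  · refine Continuous.integrable_of_hasCompactSupport ?_ (hgs.norm.mul_left)
    have h1 := continuous_dotCLM (d := d)
    exact (Real.continuous_exp.comp (by fun_prop)).mul hg.norm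
  · refine Filter.Eventually.of_forall fun u z hz => ?_
    have h2 : HasFDerivAt (fun z => c * dotCLM u z) (c • dotCLM u) z :=
      (dotCLM u).hasFDerivAt.const_mul c
    have h3 := (h2.cexp).smul_const (φ u)
    convert h3 using 1
    ext v
    simp [smul_smul, mul_assoc]

end ExpTransform

theorem contDiff_integral_exp {d : ℕ} (c : ℂ) (n : ℕ) :
    ∀ {F : Type} [NormedAddCommGroup F] [NormedSpace ℂ F] {φ : (Fin d → ℝ) → F},
      Continuous φ → HasCompactSupport φ →
      ContDiff ℂ n (fun z : Fin d → ℂ => ∫ u, Complex.exp (c * dotCLM u z) • φ u) := by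
  induction n with
  | zero =>
    intro F _ _ φ hφ hs
    rw [Nat.cast_zero, contDiff_zero]
    exact continuous_iff_continuousAt.2 fun z =>
      (hasFDerivAt_integral_exp c hφ hs z).continuousAt
  | succ n ih =>
    intro F _ _ φ hφ hs
    rw [Nat.cast_add, Nat.cast_one, contDiff_succ_iff_fderiv]
    refine ⟨fun z => (hasFDerivAt_integral_exp c hφ hs z).differentiableAt, by simp, ?_⟩
    rw [funext fun z => (hasFDerivAt_integral_exp c hφ hs z).fderiv]
    refine ih ?_ ?_
    · have : Continuous fun u : Fin d → ℝ => (ContinuousLinearMap.smulRightL ℂ (Fin d → ℂ) F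
          (c • dotCLM u)) (φ u) := by
        have h1 := continuous_dotCLM (d := d)
        fun_prop
      exact this
    · refine hs.mono fun u hu => ?_
      contrapose! hu
      simp only [Function.mem_support, not_not] at hu ⊢
      ext; simp [hu]

section Mollify

variable {d : ℕ}

/-- The normalizing constant `(π ℓ²)^{d/2}` of the Gaussian of width `ℓ`. -/
def gaussMass (d : ℕ) (ℓ : ℝ) : ℝ := (π * ℓ ^ 2) ^ ((d : ℝ) / 2)

theorem gaussMass_pos {ℓ : ℝ} (hℓ : 0 < ℓ) : 0 < gaussMass d ℓ := by
  unfold gaussMass; positivity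

/-- The Gaussian `exp (-∑ (zᵢ - uᵢ)² / ℓ²)` at a complex point. -/
def gaussC (ℓ : ℝ) (z : Fin d → ℂ) (u : Fin d → ℝ) : ℂ :=
  Complex.exp (-((1 / ℓ ^ 2 : ℝ) : ℂ) * ∑ i, (z i - (u i : ℂ)) ^ 2)

/-- The Gaussian `exp (-∑ (xᵢ - uᵢ)² / ℓ²)`. -/
def gauss (ℓ : ℝ) (x u : Fin d → ℝ) : ℝ :=
  Real.exp (-(1 / ℓ ^ 2) * ∑ i, (x i - u i) ^ 2)

theorem gaussC_toC (ℓ : ℝ) (x u : Fin d → ℝ) : gaussC ℓ (toC x) u = (gauss ℓ x u : ℂ) := by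
  simp [gaussC, gauss, toC]

theorem gaussC_eq (ℓ : ℝ) (z : Fin d → ℂ) (u : Fin d → ℝ) :
    gaussC ℓ z u = Complex.exp (-((1 / ℓ ^ 2 : ℝ) : ℂ) * ∑ i, z i ^ 2) *
      Complex.exp (-((1 / ℓ ^ 2 : ℝ) : ℂ) * ∑ i, (u i : ℂ) ^ 2 +
        ∑ i, (2 * ((1 / ℓ ^ 2 : ℝ) : ℂ) * z i) * u i) := by
  rw [gaussC, ← Complex.exp_add]
  congr 1
  simp only [Finset.mul_sum, ← Finset.sum_add_distrib]
  refine Finset.sum_congr rfl fun i _ => ?_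
  ring

theorem integrable_gaussC {ℓ : ℝ} (hℓ : 0 < ℓ) (z : Fin d → ℂ) : Integrable (gaussC ℓ z) := by
  rw [funext (gaussC_eq ℓ z)]
  exact (GaussianFourier.integrable_cexp_neg_mul_sum_add
    (by rw [Complex.ofReal_re]; positivity) _).const_mul _

theorem integral_gaussC {ℓ : ℝ} (hℓ : 0 < ℓ) (z : Fin d → ℂ) :
    ∫ u, gaussC ℓ z u = (gaussMass d ℓ : ℂ) := by
  have hℓ' : (ℓ : ℂ) ≠ 0 := by exact_mod_cast hℓ.ne'
  rw [funext (gaussC_eq ℓ z), integral_const_mul, GaussianFourier.integral_cexp_neg_mul_sum_add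
    (by rw [Complex.ofReal_re]; positivity), mul_left_comm, ← Complex.exp_add]
  have h1 : -((1 / ℓ ^ 2 : ℝ) : ℂ) * ∑ i, z i ^ 2 +
      (∑ i, (2 * ((1 / ℓ ^ 2 : ℝ) : ℂ) * z i) ^ 2) / (4 * ((1 / ℓ ^ 2 : ℝ) : ℂ)) = 0 := by
    rw [Finset.sum_div, Finset.mul_sum, ← Finset.sum_add_distrib]
    refine Finset.sum_eq_zero fun i _ => ?_
    push_cast
    field_simp
    ring
  rw [h1, Complex.exp_zero, mul_one, gaussMass, Complex.ofReal_cpow (by positivity)]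
  congr 1
  · push_cast
    field_simp
  · simp

theorem integrable_gauss {ℓ : ℝ} (hℓ : 0 < ℓ) (x : Fin d → ℝ) : Integrable (gauss ℓ x) := by
  have := (integrable_gaussC hℓ (toC x)).re
  simpa [gaussC_toC] using this

theorem integral_gauss {ℓ : ℝ} (hℓ : 0 < ℓ) (x : Fin d → ℝ) :
    ∫ u, gauss ℓ x u = gaussMass d ℓ := by
  have := integral_gaussC hℓ (toC x)
  simp only [gaussC_toC] at this
  rw [integral_complex_ofReal] at this
  exact_mod_cast this

theorem norm_gaussC_le {ℓ : ℝ} (hℓ : 0 < ℓ) {z : Fin d → ℂ} (hz : z ∈ strip d ℓ)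
    (u : Fin d → ℝ) : ‖gaussC ℓ z u‖ ≤ Real.exp d * gauss ℓ (fun i => (z i).re) u := by
  rw [gaussC, Complex.norm_exp, gauss, ← Real.exp_add]
  refine Real.exp_le_exp.2 ?_
  rw [← Complex.ofReal_neg, Complex.re_ofReal_mul, Complex.re_sum, Finset.mul_sum, Finset.mul_sum]
  have hd : (d : ℝ) = ∑ _i : Fin d, (1 : ℝ) := by simp
  rw [hd, ← Finset.sum_add_distrib]
  refine Finset.sum_le_sum fun i _ => ?_
  have h1 : ((z i - (u i : ℂ)) ^ 2).re = ((z i).re - u i) ^ 2 - (z i).im ^ 2 := by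
    simp [pow_two, Complex.mul_re]
  have h2 : (z i).im ^ 2 ≤ ℓ ^ 2 := by
    rw [← sq_abs]
    exact pow_le_pow_left₀ (abs_nonneg _) (hz i).le 2
  have h3 : 1 / ℓ ^ 2 * (z i).im ^ 2 ≤ 1 := by
    rw [one_div_mul_eq_div]
    exact (div_le_one (by positivity)).2 h2
  rw [h1]
  linarith

/-- The Gaussian mollification of `f` at width `ℓ`, extended to complex arguments. -/
def mollC (ℓ : ℝ) (f : (Fin d → ℝ) → ℝ) (z : Fin d → ℂ) : ℂ :=
  ((gaussMass d ℓ)⁻¹ : ℝ) * ∫ u, gaussC ℓ z u * (f u : ℂ)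

/-- The Gaussian mollification of `f` at width `ℓ`. -/
def moll (ℓ : ℝ) (f : (Fin d → ℝ) → ℝ) (x : Fin d → ℝ) : ℝ :=
  (gaussMass d ℓ)⁻¹ * ∫ u, gauss ℓ x u * f u

theorem mollC_toC (ℓ : ℝ) (f : (Fin d → ℝ) → ℝ) (x : Fin d → ℝ) :
    mollC ℓ f (toC x) = (moll ℓ f x : ℂ) := by
  simp only [mollC, moll, gaussC_toC, Complex.ofReal_mul]
  rw [← integral_complex_ofReal]
  simp

theorem contDiff_mollC (ℓ : ℝ) {f : (Fin d → ℝ) → ℝ} (hf : Continuous f)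
    (hs : HasCompactSupport f) : ContDiff ℂ (⊤ : ℕ∞) (mollC ℓ f) := by
  set b : ℂ := ((1 / ℓ ^ 2 : ℝ) : ℂ) with hb
  have h1 : mollC ℓ f = fun z => (((gaussMass d ℓ)⁻¹ : ℝ) : ℂ) *
      (Complex.exp (-b * ∑ i, z i ^ 2) * ∫ u, Complex.exp ((2 * b) * dotCLM u z) •
        (Complex.exp (-b * ∑ i, (u i : ℂ) ^ 2) * (f u : ℂ))) := by
    ext z
    rw [mollC]
    congr 1
    rw [← integral_const_mul]
    refine integral_congr_ae (Filter.Eventually.of_forall fun u => ?_)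
    simp only
    have h2 : ∑ i, (2 * b * z i) * (u i : ℂ) = 2 * b * dotCLM u z := by
      rw [dotCLM_apply, Finset.mul_sum]
      simp only [mul_assoc]
    rw [gaussC_eq, Complex.exp_add, ← hb, h2, smul_eq_mul]
    ring
  rw [h1]
  refine contDiff_const.mul (ContDiff.mul ?_ ?_)
  · fun_prop
  · rw [contDiff_infty]
    intro n
    refine contDiff_integral_exp (2 * b) n ?_ ?_
    · fun_prop
    · refine hs.mono fun u hu => ?_
      contrapose! hu
      simp only [Function.mem_support, not_not] at hu ⊢
      simp [hu]

theorem norm_mollC_le {ℓ : ℝ} (hℓ : 0 < ℓ) {f : (Fin d → ℝ) → ℝ} {M : ℝ}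
    (hM : ∀ x, |f x| ≤ M) {z : Fin d → ℂ} (hz : z ∈ strip d ℓ) :
    ‖mollC ℓ f z‖ ≤ Real.exp d * M := by
  have hm := gaussMass_pos (d := d) hℓ
  rw [mollC, norm_mul, Complex.norm_real, Real.norm_eq_abs, abs_of_pos (inv_pos.2 hm),
    inv_mul_le_iff₀ hm]
  have h1 := norm_integral_le_of_norm_le (μ := volume) (f := fun u => gaussC ℓ z u * (f u : ℂ))
    (g := fun u => Real.exp d * M * gauss ℓ (fun i => (z i).re) u)
    ((integrable_gauss hℓ _).const_mul _) (Filter.Eventually.of_forall fun u => by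
      rw [norm_mul, Complex.norm_real, Real.norm_eq_abs]
      calc _ ≤ (Real.exp d * gauss ℓ (fun i => (z i).re) u) * M :=
            mul_le_mul (norm_gaussC_le hℓ hz u) (hM u) (abs_nonneg _)
              (mul_nonneg (Real.exp_nonneg _) (Real.exp_nonneg _))
        _ = _ := by ring)
  rw [integral_const_mul, integral_gauss hℓ] at h1
  linarith

theorem holBdd_moll {ℓ : ℝ} (hℓ : 0 < ℓ) {f : (Fin d → ℝ) → ℝ} (hf : Continuous f)
    (hs : HasCompactSupport f) {M : ℝ} (hM : ∀ x, |f x| ≤ M) :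
    HolBdd ℓ (Real.exp d * M) (moll ℓ f) :=
  ⟨mollC ℓ f, (contDiff_mollC ℓ hf hs).contDiffOn, fun _ hz => norm_mollC_le hℓ hM hz,
    mollC_toC ℓ f⟩

/-- `(1 + s) e^{-s} ≤ 2 e^{-s/2}` in the form used against the Gaussian. -/
theorem gauss_mul_rpow_le {ℓ β : ℝ} (hℓ : 0 < ℓ) (hβ : 0 < β) (hβ1 : β ≤ 1) (x u : Fin d → ℝ) :
    gauss ℓ x u * ‖x - u‖ ^ β ≤ 2 * ℓ ^ β * gauss (√2 * ℓ) x u := by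
  set s := 1 / ℓ ^ 2 * ∑ i, (x i - u i) ^ 2 with hs
  have hs0 : 0 ≤ s := mul_nonneg (by positivity) (Finset.sum_nonneg fun i _ => sq_nonneg _)
  set t := ‖x - u‖ / ℓ with ht
  have ht0 : 0 ≤ t := by positivity
  have htn : ‖x - u‖ = ℓ * t := by rw [ht]; field_simp
  have h1 : t ^ 2 ≤ s := by
    have h2 : ‖x - u‖ ≤ √(∑ i, (x i - u i) ^ 2) := by
      refine (pi_norm_le_iff_of_nonneg (Real.sqrt_nonneg _)).2 fun i => ?_
      rw [Real.norm_eq_abs]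
      refine Real.abs_le_sqrt ?_
      exact Finset.single_le_sum (f := fun i => (x i - u i) ^ 2) (fun i _ => sq_nonneg _)
        (Finset.mem_univ i)
    have h3 : ‖x - u‖ ^ 2 ≤ ∑ i, (x i - u i) ^ 2 := by
      have := pow_le_pow_left₀ (norm_nonneg _) h2 2
      rwa [Real.sq_sqrt (Finset.sum_nonneg fun i _ => sq_nonneg _)] at this
    rw [ht, hs, div_pow, one_div_mul_eq_div]
    gcongr
  have h2 : t ^ β ≤ 1 + s := by
    rcases le_total t 1 with h | h
    · exact (Real.rpow_le_one ht0 h hβ.le).trans (by linarith)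
    · calc t ^ β ≤ t ^ (1 : ℝ) := Real.rpow_le_rpow_of_exponent_le h hβ1
        _ = t := Real.rpow_one t
        _ ≤ 1 + s := by nlinarith
  have h3 : 1 + s ≤ 2 * Real.exp (s / 2) := by
    have := Real.add_one_le_exp (s / 2)
    linarith
  have e1 : gauss ℓ x u = Real.exp (-s) := by rw [gauss, hs]; ring_nf
  have e2 : gauss (√2 * ℓ) x u = Real.exp (-s) * Real.exp (s / 2) := by
    rw [gauss, hs, ← Real.exp_add, mul_pow, Real.sq_sqrt (by norm_num)]
    congr 1
    field_simp
    ring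
  rw [e1, e2, htn, Real.mul_rpow hℓ.le ht0]
  have h4 : t ^ β ≤ 2 * Real.exp (s / 2) := h2.trans h3
  have h5 : 0 ≤ Real.exp (-s) * ℓ ^ β := by positivity
  nlinarith [mul_le_mul_of_nonneg_left h4 h5]

theorem gaussMass_sqrt_two_mul {ℓ : ℝ} (hℓ : 0 < ℓ) :
    gaussMass d (√2 * ℓ) ≤ 2 ^ d * gaussMass d ℓ := by
  have : π * (√2 * ℓ) ^ 2 = 2 * (π * ℓ ^ 2) := by
    rw [mul_pow, Real.sq_sqrt (by norm_num)]; ring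
  rw [gaussMass, gaussMass, this, Real.mul_rpow (by norm_num) (by positivity)]
  have h2 : (2 : ℝ) ^ ((d : ℝ) / 2) ≤ 2 ^ d := by
    rw [← Real.rpow_natCast]
    exact Real.rpow_le_rpow_of_exponent_le (by norm_num)
      (by have : (0 : ℝ) ≤ d := by positivity
          linarith)
  gcongr

/-- The constant in the mollification estimates. -/
def mollConst (d : ℕ) : ℝ := Real.exp d * (2 * 2 ^ d)

theorem norm_mollC_sub_le {ℓ β L : ℝ} (hℓ : 0 < ℓ) (hβ : 0 < β) (hβ1 : β ≤ 1) (hL0 : 0 ≤ L)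
    {f : (Fin d → ℝ) → ℝ} (hf : Continuous f) (hs : HasCompactSupport f)
    (hL : ∀ x y, |f x - f y| ≤ L * ‖x - y‖ ^ β) {z : Fin d → ℂ} (hz : z ∈ strip d ℓ) :
    ‖mollC ℓ f z - (f (fun i => (z i).re) : ℂ)‖ ≤ mollConst d * L * ℓ ^ β := by
  have hm := gaussMass_pos (d := d) hℓ
  have hm' : ((gaussMass d ℓ : ℝ) : ℂ) ≠ 0 := by exact_mod_cast hm.ne'
  set x : Fin d → ℝ := fun i => (z i).re with hx
  have hi : Integrable fun u => gaussC ℓ z u * (f u : ℂ) := by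
    refine Continuous.integrable_of_hasCompactSupport ?_ ?_
    · unfold gaussC; fun_prop
    · refine hs.mono fun u hu => ?_
      contrapose! hu
      simp only [Function.mem_support, not_not] at hu ⊢
      simp [hu]
  have h1 : mollC ℓ f z - (f x : ℂ) =
      (((gaussMass d ℓ)⁻¹ : ℝ) : ℂ) * ∫ u, gaussC ℓ z u * ((f u : ℂ) - f x) := by
    simp only [mul_sub]
    rw [integral_sub hi ((integrable_gaussC hℓ z).mul_const _), integral_mul_const,
      integral_gaussC hℓ, mollC]
    push_cast
    field_simp
  rw [h1, norm_mul, Complex.norm_real, Real.norm_eq_abs, abs_of_pos (inv_pos.2 hm),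
    inv_mul_le_iff₀ hm]
  have h2 := norm_integral_le_of_norm_le (μ := volume)
    (f := fun u => gaussC ℓ z u * ((f u : ℂ) - f x))
    (g := fun u => Real.exp d * L * (2 * ℓ ^ β) * gauss (√2 * ℓ) x u)
    ((integrable_gauss (by positivity) _).const_mul _) (Filter.Eventually.of_forall fun u => by
      rw [norm_mul, ← Complex.ofReal_sub, Complex.norm_real, Real.norm_eq_abs]
      have h3 := hL u x
      rw [norm_sub_rev] at h3
      calc _ ≤ (Real.exp d * gauss ℓ x u) * (L * ‖x - u‖ ^ β) :=
            mul_le_mul (norm_gaussC_le hℓ hz u) h3 (abs_nonneg _)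
              (mul_nonneg (Real.exp_nonneg _) (Real.exp_nonneg _))
        _ = Real.exp d * L * (gauss ℓ x u * ‖x - u‖ ^ β) := by ring
        _ ≤ Real.exp d * L * (2 * ℓ ^ β * gauss (√2 * ℓ) x u) := by
            exact mul_le_mul_of_nonneg_left (gauss_mul_rpow_le hℓ hβ hβ1 x u) (by positivity)
        _ = _ := by ring)
  rw [integral_const_mul, integral_gauss (by positivity)] at h2
  refine h2.trans ?_
  calc _ ≤ Real.exp d * L * (2 * ℓ ^ β) * (2 ^ d * gaussMass d ℓ) := by
        gcongr; exact gaussMass_sqrt_two_mul hℓ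
    _ = _ := by unfold mollConst; ring

theorem abs_moll_sub_le {ℓ β L : ℝ} (hℓ : 0 < ℓ) (hβ : 0 < β) (hβ1 : β ≤ 1) (hL0 : 0 ≤ L)
    {f : (Fin d → ℝ) → ℝ} (hf : Continuous f) (hs : HasCompactSupport f)
    (hL : ∀ x y, |f x - f y| ≤ L * ‖x - y‖ ^ β) (x : Fin d → ℝ) :
    |moll ℓ f x - f x| ≤ mollConst d * L * ℓ ^ β := by
  have := norm_mollC_sub_le hℓ hβ hβ1 hL0 hf hs hL (toC_mem_strip hℓ x)
  rw [mollC_toC] at this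
  simp only [toC, Complex.ofReal_re] at this
  rwa [← Complex.ofReal_sub, Complex.norm_real] at this

theorem holBdd_moll_sub {ℓ ℓ' β L : ℝ} (hℓ' : 0 < ℓ') (h : ℓ' ≤ ℓ) (hβ : 0 < β) (hβ1 : β ≤ 1)
    (hL0 : 0 ≤ L) {f : (Fin d → ℝ) → ℝ} (hf : Continuous f) (hs : HasCompactSupport f)
    (hL : ∀ x y, |f x - f y| ≤ L * ‖x - y‖ ^ β) :
    HolBdd ℓ' (mollConst d * L * (ℓ' ^ β + ℓ ^ β)) (fun x => moll ℓ' f x - moll ℓ f x) := by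
  refine ⟨fun z => mollC ℓ' f z - mollC ℓ f z,
    ((contDiff_mollC ℓ' hf hs).sub (contDiff_mollC ℓ hf hs)).contDiffOn, fun z hz => ?_,
    fun x => by simp only [mollC_toC, Complex.ofReal_sub]⟩
  have h1 := norm_mollC_sub_le hℓ' hβ hβ1 hL0 hf hs hL hz
  have h2 := norm_mollC_sub_le (hℓ'.trans_le h) hβ hβ1 hL0 hf hs hL (strip_mono h hz)
  calc _ = ‖(mollC ℓ' f z - (f (fun i => (z i).re) : ℂ)) -
        (mollC ℓ f z - (f (fun i => (z i).re) : ℂ))‖ := by congr 1; ring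
    _ ≤ _ := (norm_sub_le _ _).trans (by linarith)

theorem pd_moll {ℓ : ℝ} (hℓ : 0 < ℓ) {f : (Fin d → ℝ) → ℝ} (hf : ContDiff ℝ 1 f)
    (hs : HasCompactSupport f) (i : Fin d) (x : Fin d → ℝ) :
    pd i (moll ℓ f) x = moll ℓ (pd i f) x := by
  have hconv : ∀ g : (Fin d → ℝ) → ℝ, ∀ y, moll ℓ g y = (gaussMass d ℓ)⁻¹ *
      (MeasureTheory.convolution (gauss ℓ 0) g (ContinuousLinearMap.mul ℝ ℝ) volume) y := by
    intro g y
    rw [moll, MeasureTheory.convolution_def, ← integral_sub_left_eq_self _ volume y]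
    congr 2
    ext t
    simp [gauss]
  have hli : LocallyIntegrable (gauss ℓ (0 : Fin d → ℝ)) volume :=
    (integrable_gauss hℓ 0).locallyIntegrable
  have hd := hs.hasFDerivAt_convolution_right (ContinuousLinearMap.mul ℝ ℝ) hli hf x
  rw [hconv, funext (hconv f)]
  unfold pd
  rw [(hd.const_mul _).fderiv, _root_.smul_apply, smul_eq_mul,
    MeasureTheory.convolution_precompR_apply _ hli (hs.fderiv ℝ)
      (hf.continuous_fderiv one_ne_zero)]

end Mollify

section Limit

variable {d : ℕ}

theorem norm_clm_le_sum {E : Type*} [NormedAddCommGroup E] [NormedSpace ℝ E]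
    (T : (Fin d → ℝ) →L[ℝ] E) : ‖T‖ ≤ ∑ i, ‖T (Pi.single i 1)‖ := by
  refine T.opNorm_le_bound (Finset.sum_nonneg fun _ _ => norm_nonneg _) fun h => ?_
  have h1 : T h = ∑ i, h i • T (Pi.single i 1) := by
    conv_lhs => rw [pi_eq_sum_univ' h]
    rw [map_sum]
    refine Finset.sum_congr rfl fun i _ => ?_
    rw [map_smul]
  rw [h1, Finset.sum_mul]
  refine (norm_sum_le _ _).trans (Finset.sum_le_sum fun i _ => ?_)
  rw [norm_smul, mul_comm]
  exact mul_le_mul_of_nonneg_left (norm_le_pi_norm h i) (norm_nonneg _)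

theorem abs_sub_le_of_abs_pd_le {f : (Fin d → ℝ) → ℝ} (hf : Differentiable ℝ f) {M : ℝ}
    (hM : ∀ i x, |pd i f x| ≤ M) (x y : Fin d → ℝ) : |f x - f y| ≤ d * M * ‖x - y‖ := by
  have h := Convex.norm_image_sub_le_of_norm_fderiv_le (𝕜 := ℝ) (f := f) (C := d * M)
    (s := Set.univ) (x := y) (y := x) (fun z _ => hf z) (fun z _ => ?_) convex_univ
    (Set.mem_univ _) (Set.mem_univ _)
  · simpa using h
  · refine (norm_clm_le_sum _).trans ((Finset.sum_le_sum fun i _ => hM i z).trans ?_)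
    simp

theorem abs_sub_le_rpow {f : (Fin d → ℝ) → ℝ} (hf : Differentiable ℝ f) {α b Λ : ℝ} (hα : 0 < α)
    (hα1 : α ≤ 1) (hΛ : 0 < Λ) (hb : ∀ x, |f x| ≤ b) (hM : ∀ i x, |pd i f x| ≤ b * Λ)
    (x y : Fin d → ℝ) : |f x - f y| ≤ (d + 2) * (b * Λ ^ α) * ‖x - y‖ ^ α := by
  have hb0 : 0 ≤ b := (abs_nonneg _).trans (hb 0)
  set t := Λ * ‖x - y‖ with ht
  have ht0 : 0 ≤ t := by positivity
  have e : (d + 2) * (b * Λ ^ α) * ‖x - y‖ ^ α = (d + 2) * b * t ^ α := by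
    rw [ht, Real.mul_rpow hΛ.le (norm_nonneg _)]; ring
  rw [e]
  rcases le_total t 1 with h | h
  · have h1 := abs_sub_le_of_abs_pd_le hf hM x y
    have h2 : t ≤ t ^ α := by
      rcases ht0.eq_or_lt with h0 | h0
      · rw [← h0, Real.zero_rpow hα.ne']
      · calc t = t ^ (1 : ℝ) := (Real.rpow_one t).symm
          _ ≤ t ^ α := Real.rpow_le_rpow_of_exponent_ge h0 h hα1
    calc _ ≤ d * (b * Λ) * ‖x - y‖ := h1
      _ = d * b * t := by rw [ht]; ring
      _ ≤ (d + 2) * b * t ^ α := by gcongr; linarith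
  · have h1 : |f x - f y| ≤ 2 * b := by
      have := abs_sub (f x) (f y)
      linarith [hb x, hb y]
    have h2 : 1 ≤ t ^ α := Real.one_le_rpow h hα.le
    calc _ ≤ 2 * b := h1
      _ ≤ (d + 2) * b * 1 := by nlinarith [mul_nonneg (Nat.cast_nonneg (α := ℝ) d) hb0]
      _ ≤ _ := by gcongr

theorem exists_C1_limit {α : ℝ} (hα : 0 < α) (hα1 : α ≤ 1) {φ : ℕ → (Fin d → ℝ) → ℝ}
    {b Λ : ℕ → ℝ} {M : ℝ} (hφ : ∀ q, Smooth (φ q)) (h0 : ∀ q x, |φ (q + 1) x - φ q x| ≤ b q)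
    (h1 : ∀ q i x, |pd i (φ (q + 1)) x - pd i (φ q) x| ≤ b q)
    (h2 : ∀ q i j x, |pd j (fun y => pd i (φ (q + 1)) y - pd i (φ q) y) x| ≤ b q * Λ q)
    (hΛ : ∀ q, 0 < Λ q) (hb : Summable b) (hbΛ : Summable fun q => b q * Λ q ^ α)
    (hM1 : ∀ i x, |pd i (φ 0) x| ≤ M) (hM2 : ∀ i j x, |pd j (pd i (φ 0)) x| ≤ M) :
    ∃ f : (Fin d → ℝ) → ℝ, Differentiable ℝ f ∧
      (∃ C, 0 ≤ C ∧ ∀ i x y, |pd i f x - pd i f y| ≤ C * ‖x - y‖ ^ α) ∧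
      (∀ x, Filter.Tendsto (fun q => φ q x) Filter.atTop (nhds (f x))) ∧
      ∀ i x, Filter.Tendsto (fun q => pd i (φ q) x) Filter.atTop (nhds (pd i f x)) := by
  have hb0 : ∀ q, 0 ≤ b q := fun q => (abs_nonneg _).trans (h0 q 0)
  have hdiff : ∀ q, Differentiable ℝ (φ q) := fun q => (hφ q).differentiable
  set D : ℕ → (Fin d → ℝ) → ((Fin d → ℝ) →L[ℝ] ℝ) :=
    fun q x => fderiv ℝ (φ (q + 1)) x - fderiv ℝ (φ q) x with hD
  have hDapply : ∀ q x i, D q x (Pi.single i 1) = pd i (φ (q + 1)) x - pd i (φ q) x :=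
    fun q x i => rfl
  have hDn : ∀ q x, ‖D q x‖ ≤ d * b q := by
    intro q x
    refine (norm_clm_le_sum _).trans ((Finset.sum_le_sum fun i _ => ?_).trans_eq
      (by simp : ∑ _i : Fin d, b q = d * b q))
    rw [hDapply]
    exact h1 q i x
  have hs0 : ∀ x, Summable fun q => φ (q + 1) x - φ q x := fun x =>
    Summable.of_norm_bounded hb fun q => h0 q x
  have hsum : ∀ x, HasFDerivAt (fun y => ∑' q, (φ (q + 1) y - φ q y)) (∑' q, D q x) x := fun x =>
    hasFDerivAt_tsum (hb.mul_left (d : ℝ))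
      (fun q y => ((hdiff (q + 1)) y).hasFDerivAt.sub ((hdiff q) y).hasFDerivAt)
      (fun q y => hDn q y) (hs0 0) x
  set f : (Fin d → ℝ) → ℝ := fun y => φ 0 y + ∑' q, (φ (q + 1) y - φ q y) with hf
  have hfd : ∀ x, HasFDerivAt f (fderiv ℝ (φ 0) x + ∑' q, D q x) x := fun x =>
    ((hdiff 0) x).hasFDerivAt.add (hsum x)
  have hsD : ∀ x, Summable fun q => D q x := fun x =>
    Summable.of_norm_bounded (hb.mul_left (d : ℝ)) fun q => hDn q x
  have hs1 : ∀ i x, HasSum (fun q => pd i (φ (q + 1)) x - pd i (φ q) x)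
      (pd i f x - pd i (φ 0) x) := by
    intro i x
    have h3 := (hsD x).hasSum.mapL (ContinuousLinearMap.apply ℝ ℝ (Pi.single i (1 : ℝ)))
    have h4 : pd i f x - pd i (φ 0) x = (∑' q, D q x) (Pi.single i 1) := by
      unfold pd
      rw [(hfd x).fderiv]
      simp
    rw [h4]
    exact h3
  have htel : ∀ (u : ℕ → ℝ) (l : ℝ), HasSum (fun q => u (q + 1) - u q) (l - u 0) →
      Filter.Tendsto u Filter.atTop (nhds l) := by
    intro u l h
    have h3 := h.tendsto_sum_nat
    simp only [Finset.sum_range_sub] at h3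
    simpa using h3.add_const (u 0)
  refine ⟨f, fun x => (hfd x).differentiableAt, ?_, fun x => htel _ _ ?_,
    fun i x => htel _ _ (hs1 i x)⟩
  · refine ⟨(d + 2) * |M| + (d + 2) * ∑' q, b q * Λ q ^ α, ?_, fun i x y => ?_⟩
    · have : 0 ≤ ∑' q, b q * Λ q ^ α :=
        tsum_nonneg fun q => mul_nonneg (hb0 q) (Real.rpow_nonneg (hΛ q).le _)
      positivity
    · have h3 := (hs1 i x).sub (hs1 i y)
      have h4 : ∀ q, ‖(pd i (φ (q + 1)) x - pd i (φ q) x) -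
          (pd i (φ (q + 1)) y - pd i (φ q) y)‖ ≤
          (d + 2) * ‖x - y‖ ^ α * (b q * Λ q ^ α) := by
        intro q
        have := abs_sub_le_rpow (f := fun z => pd i (φ (q + 1)) z - pd i (φ q) z)
          (((hφ (q + 1)).pd i).differentiable.sub ((hφ q).pd i).differentiable) hα hα1 (hΛ q)
          (h1 q i) (fun j z => h2 q i j z) x y
        rw [Real.norm_eq_abs]
        linarith
      have h5 := tsum_of_norm_bounded (hbΛ.hasSum.mul_left ((d + 2) * ‖x - y‖ ^ α)) h4
      rw [h3.tsum_eq, Real.norm_eq_abs] at h5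
      have h6 := abs_sub_le_rpow ((hφ 0).pd i).differentiable hα hα1 one_pos
        (b := |M|) (fun z => (hM1 i z).trans (le_abs_self M))
        (fun j z => by rw [mul_one]; exact (hM2 i j z).trans (le_abs_self M)) x y
      rw [Real.one_rpow, mul_one] at h6
      have h7 := abs_add_le (pd i f x - pd i (φ 0) x - (pd i f y - pd i (φ 0) y))
        (pd i (φ 0) x - pd i (φ 0) y)
      have h8 : pd i f x - pd i (φ 0) x - (pd i f y - pd i (φ 0) y) +
        (pd i (φ 0) x - pd i (φ 0) y) = pd i f x - pd i f y := by ring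
      rw [h8] at h7
      linarith
  · have := (hs0 x).hasSum
    simpa [hf] using this

end Limit

theorem exists_seq_of_step {X : Type*} {P : ℕ → X → Prop} {Q : ℕ → X → X → Prop} {x₀ : X}
    (h0 : P 0 x₀) (h : ∀ q x, P q x → ∃ y, P (q + 1) y ∧ Q q x y) :
    ∃ f : ℕ → X, f 0 = x₀ ∧ ∀ q, P q (f q) ∧ Q q (f q) (f (q + 1)) := by
  choose g hg1 hg2 using h
  let F : ∀ q, {x // P q x} := fun q =>
    Nat.rec (motive := fun q => {x // P q x}) ⟨x₀, h0⟩ (fun q x => ⟨g q x.1 x.2, hg1 q x.1 x.2⟩) q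
  exact ⟨fun q => (F q).1, rfl, fun q => ⟨(F q).2, hg2 q (F q).1 (F q).2⟩⟩

theorem sum_inv_pow_le {σ : ℝ} (hσ : 4 ≤ σ) (q : ℕ) :
    ∑ j ∈ Finset.range q, 1 / σ ^ j ≤ 2 * (1 - 1 / σ ^ q) := by
  induction q with
  | zero => simp
  | succ q ih =>
    rw [Finset.sum_range_succ]
    have h1 : 1 / σ ^ (q + 1) ≤ (1 / 4) * (1 / σ ^ q) := by
      rw [pow_succ, one_div_mul_one_div]
      refine one_div_le_one_div_of_le (by positivity) ?_
      rw [mul_comm]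
      gcongr
    have h2 : 0 < 1 / σ ^ q := by positivity
    linarith

theorem sum_inv_pow_le_two {σ : ℝ} (hσ : 4 ≤ σ) (q : ℕ) :
    ∑ j ∈ Finset.range q, 1 / σ ^ j ≤ 2 := by
  have h1 := sum_inv_pow_le hσ q
  have h2 : 0 < 1 / σ ^ q := by positivity
  linarith

section Scheme

variable {d k N : ℕ}

/-- The possibility of passing, at every stage `q`, from a remainder of size `δ₀ σ^{-2q}` on a strip
of half-width `R Y^{-q}` to the next one, for maps subject to the invariant `Inv`. -/
def StageScheme (S : RankOneBasis d N) (C σ Y δ₀ R : ℝ)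
    (Inv : ℕ → (Fin k → (Fin d → ℝ) → ℝ) → Prop) : Prop :=
  ∀ (q : ℕ) (v : Fin k → (Fin d → ℝ) → ℝ) (w : Fin d → (Fin d → ℝ) → ℝ)
    (G : Fin d → Fin d → (Fin d → ℝ) → ℝ) (K : ℝ),
    (∀ l, Smooth (v l)) → (∀ i, Smooth (w i)) → (∀ i j x, G i j x = G j i x) → 0 ≤ K →
    (∀ l i, HolBdd (R / Y ^ q) K (pd i (v l))) → Inv q v →
    (∀ i j, HolBdd (R / Y ^ q) (S.rad * (δ₀ / (σ ^ 2) ^ q))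
      (fun x => G i j x - metricForm v w i j x - δ₀ / (σ ^ 2) ^ q * S.total i j)) →
    ∃ (v' : Fin k → (Fin d → ℝ) → ℝ) (w' : Fin d → (Fin d → ℝ) → ℝ),
      (∀ l, Smooth (v' l)) ∧ (∀ i, Smooth (w' i)) ∧
      Incr (R / Y ^ (q + 1)) (C * (√δ₀ / σ ^ q)) K v v' w w' ∧ Inv (q + 1) v' ∧
      ∀ i j, HolBdd (R / Y ^ (q + 1)) (S.rad * (δ₀ / (σ ^ 2) ^ (q + 1)) / 2)
        (fun x => G i j x - metricForm v' w' i j x - δ₀ / (σ ^ 2) ^ (q + 1) * S.total i j)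

theorem Incr.mono_grad {r b K K' : ℝ} {v v' : Fin k → (Fin d → ℝ) → ℝ}
    {w w' : Fin d → (Fin d → ℝ) → ℝ} (h : Incr r b K v v' w w') (hb : 0 ≤ b) (hK : K ≤ K') :
    Incr r b K' v v' w w' := by
  have h1 : b * (1 + K) ≤ b * (1 + K') := by gcongr
  exact ⟨h.v_sub, h.pd_v_sub, fun i => (h.w_sub i).weaken h1,
    fun i j => (h.pd_w_sub i j).weaken h1, h.abs_w_sub, h.abs_pd_w_sub⟩

theorem StageScheme.exists_iterates {S : RankOneBasis d N} {C σ Y δ₀ R : ℝ}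
    {Inv : ℕ → (Fin k → (Fin d → ℝ) → ℝ) → Prop} (hS : StageScheme S C σ Y δ₀ R Inv)
    (hC : 0 ≤ C) (hσ : 4 ≤ σ) (hY : 1 ≤ Y) (hR : 0 < R)
    {G : ℕ → Fin d → Fin d → (Fin d → ℝ) → ℝ} (hG : ∀ q i j x, G q i j x = G q j i x)
    (hGs : ∀ q i j, HolBdd (R / Y ^ (q + 1)) (S.rad * (δ₀ / (σ ^ 2) ^ (q + 1)) / 2)
      (fun x => G (q + 1) i j x - G q i j x))
    {v : Fin k → (Fin d → ℝ) → ℝ} {w : Fin d → (Fin d → ℝ) → ℝ} {K : ℝ}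
    (hv : ∀ l, Smooth (v l)) (hw : ∀ i, Smooth (w i)) (hK : 0 ≤ K)
    (hpv : ∀ l i, HolBdd R K (pd i (v l))) (hI : Inv 0 v)
    (h0 : ∀ i j, HolBdd R (S.rad * δ₀)
      (fun x => G 0 i j x - metricForm v w i j x - δ₀ * S.total i j)) :
    ∃ (V : ℕ → Fin k → (Fin d → ℝ) → ℝ) (W : ℕ → Fin d → (Fin d → ℝ) → ℝ),
      V 0 = v ∧ W 0 = w ∧ (∀ q l, Smooth (V q l)) ∧ (∀ q i, Smooth (W q i)) ∧
      (∀ q, Incr (R / Y ^ (q + 1)) (C * (√δ₀ / σ ^ q)) (K + 2 * (C * √δ₀))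
        (V q) (V (q + 1)) (W q) (W (q + 1))) ∧
      ∀ q i j, HolBdd (R / Y ^ q) (S.rad * (δ₀ / (σ ^ 2) ^ q))
        (fun x => G q i j x - metricForm (V q) (W q) i j x - δ₀ / (σ ^ 2) ^ q * S.total i j) := by
  have hb : ∀ q : ℕ, 0 ≤ C * (√δ₀ / σ ^ q) := fun q => by positivity
  have hstep := exists_seq_of_step
    (X := (Fin k → (Fin d → ℝ) → ℝ) × (Fin d → (Fin d → ℝ) → ℝ)) (x₀ := (v, w))
    (P := fun q p => (∀ l, Smooth (p.1 l)) ∧ (∀ i, Smooth (p.2 i)) ∧ Inv q p.1 ∧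
      (∀ l i, HolBdd (R / Y ^ q) (K + 2 * (C * √δ₀) * (1 - 1 / σ ^ q)) (pd i (p.1 l))) ∧
      ∀ i j, HolBdd (R / Y ^ q) (S.rad * (δ₀ / (σ ^ 2) ^ q))
        (fun x => G q i j x - metricForm p.1 p.2 i j x - δ₀ / (σ ^ 2) ^ q * S.total i j))
    (Q := fun q p p' => Incr (R / Y ^ (q + 1)) (C * (√δ₀ / σ ^ q)) (K + 2 * (C * √δ₀))
        p.1 p'.1 p.2 p'.2) ?_ ?_
  · obtain ⟨f, hf0, hf⟩ := hstep
    exact ⟨fun q => (f q).1, fun q => (f q).2, by simp [hf0], by simp [hf0], fun q => (hf q).1.1,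
      fun q => (hf q).1.2.1, fun q => (hf q).2, fun q => (hf q).1.2.2.2.2⟩
  · refine ⟨hv, hw, hI, ?_, ?_⟩
    · simpa using hpv
    · simpa using h0
  · rintro q ⟨v, w⟩ ⟨hv, hw, hI, hpv, hrem⟩
    have hq1 : 1 / σ ^ q ≤ 1 := by
      rw [div_le_one (by positivity)]
      exact one_le_pow₀ (by linarith)
    have hq0 : 0 < 1 / σ ^ q := by positivity
    have hCδ : 0 ≤ C * √δ₀ := by positivity
    obtain ⟨v', w', hv', hw', hinc, hI', hrem'⟩ := hS q v w (G q) _ hv hw (hG q)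
      (by nlinarith) hpv hI hrem
    refine ⟨(v', w'), ⟨hv', hw', hI', fun l i => ?_, fun i j => ?_⟩, ?_⟩
    · have hr : R / Y ^ (q + 1) ≤ R / Y ^ q := by
        gcongr
        · exact Nat.le_succ q
      refine (hinc.pd_bound (fun l i => (hpv l i).shrink hr) l i).weaken ?_
      have e1 : C * (√δ₀ / σ ^ q) = (C * √δ₀) * (1 / σ ^ q) := by ring
      have e2 : 1 / σ ^ (q + 1) ≤ (1 / 4) * (1 / σ ^ q) := by
        rw [pow_succ, one_div_mul_one_div]
        refine one_div_le_one_div_of_le (by positivity) ?_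
        rw [mul_comm]
        gcongr
      have e3 := mul_le_mul_of_nonneg_left e2 hCδ
      have e4 := mul_nonneg hCδ hq0.le
      rw [e1]
      nlinarith
    · exact (((hrem' i j).add (hGs q i j)).congr fun x => by ring).weaken (by linarith)
    · exact hinc.mono_grad (hb q) (by nlinarith)

theorem StageScheme.exists_solution {S : RankOneBasis d N} {C σ Y δ₀ R α : ℝ}
    {Inv : ℕ → (Fin k → (Fin d → ℝ) → ℝ) → Prop} (hS : StageScheme S C σ Y δ₀ R Inv)
    (hC : 0 ≤ C) (hσ : 4 ≤ σ) (hY : 1 ≤ Y) (hR : 0 < R) (hα : 0 < α) (hα1 : α ≤ 1)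
    (hYσ : Y ^ α < σ)
    {G : ℕ → Fin d → Fin d → (Fin d → ℝ) → ℝ} (hG : ∀ q i j x, G q i j x = G q j i x)
    (hGs : ∀ q i j, HolBdd (R / Y ^ (q + 1)) (S.rad * (δ₀ / (σ ^ 2) ^ (q + 1)) / 2)
      (fun x => G (q + 1) i j x - G q i j x)) {G' : Fin d → Fin d → (Fin d → ℝ) → ℝ}
    (hGlim : ∀ i j x, Filter.Tendsto (fun q => G q i j x) Filter.atTop (nhds (G' i j x)))
    {v : Fin k → (Fin d → ℝ) → ℝ} {w : Fin d → (Fin d → ℝ) → ℝ} {K K' : ℝ}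
    (hv : ∀ l, Smooth (v l)) (hw : ∀ i, Smooth (w i)) (hK : 0 ≤ K)
    (hpv : ∀ l i, HolBdd R K (pd i (v l))) (hpw : ∀ l i, HolBdd R K' (pd i (w l))) (hI : Inv 0 v)
    (h0 : ∀ i j, HolBdd R (S.rad * δ₀)
      (fun x => G 0 i j x - metricForm v w i j x - δ₀ * S.total i j)) :
    ∃ (v' : Fin k → (Fin d → ℝ) → ℝ) (w' : Fin d → (Fin d → ℝ) → ℝ),
      (∀ l, Differentiable ℝ (v' l)) ∧ (∀ l, Differentiable ℝ (w' l)) ∧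
      (∃ H, 0 ≤ H ∧ (∀ l i x y, |pd i (v' l) x - pd i (v' l) y| ≤ H * ‖x - y‖ ^ α) ∧
        ∀ l i x y, |pd i (w' l) x - pd i (w' l) y| ≤ H * ‖x - y‖ ^ α) ∧
      (∀ l x, |v' l x - v l x| ≤ 2 * (C * √δ₀)) ∧
      (∀ l i x, |pd i (v' l) x - pd i (v l) x| ≤ 2 * (C * √δ₀)) ∧
      (∀ l x, |w' l x - w l x| ≤
        2 * (C * √δ₀) * (1 + (gradSum v x + d * k * (2 * (C * √δ₀))))) ∧
      (∀ l i x, |pd i (w' l) x - pd i (w l) x| ≤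
        2 * (C * √δ₀) * (1 + (gradSum v x + d * k * (2 * (C * √δ₀))))) ∧
      ∀ i j x, metricForm v' w' i j x = G' i j x := by
  obtain ⟨V, W, hV0, hW0, hV, hW, hinc, hrem⟩ :=
    hS.exists_iterates hC hσ hY hR hG hGs hv hw hK hpv hI h0
  subst hV0 hW0
  have hσ0 : 0 < σ := by linarith
  have hY0 : 0 < Y := by linarith
  have hr : ∀ q : ℕ, 0 < R / Y ^ q := fun q => by positivity
  set c := C * √δ₀ with hc
  have hc0 : 0 ≤ c := by positivity
  set Λ : ℕ → ℝ := fun q => 2 / (R / Y ^ (q + 1)) with hΛ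
  have hΛ0 : ∀ q, 0 < Λ q := fun q => by have := hr (q + 1); positivity
  have hbq : ∀ q : ℕ, C * (√δ₀ / σ ^ q) = c * (1 / σ ^ q) := fun q => by rw [hc]; ring
  simp only [hbq] at hinc
  set K₁ := K + 2 * c with hK₁
  have hK₁0 : 0 ≤ K₁ := by positivity
  have hgeo : Summable fun q : ℕ => 1 / σ ^ q := by
    have := summable_geometric_of_lt_one (r := 1 / σ) (by positivity)
      (by rw [div_lt_one hσ0]; linarith)
    simpa [div_pow] using this
  have hgeo2 : ∀ a : ℝ, Summable fun q : ℕ => (a * (1 / σ ^ q)) * Λ q ^ α := by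
    intro a
    have h1 := (summable_geometric_of_lt_one (r := Y ^ α / σ) (by positivity)
      (by rwa [div_lt_one hσ0])).mul_left (a * ((2 * Y / R) ^ α))
    refine h1.congr fun q => ?_
    have e1 : Λ q = (2 * Y / R) * Y ^ q := by
      simp only [hΛ, pow_succ]
      field_simp
    have e2 : (Y ^ q) ^ α = (Y ^ α) ^ q := by
      rw [← Real.rpow_natCast, ← Real.rpow_mul hY0.le, mul_comm, Real.rpow_mul hY0.le,
        Real.rpow_natCast]
    rw [e1, Real.mul_rpow (by positivity) (by positivity), e2, div_pow]
    ring
  have hvl : ∀ l, ∃ f : (Fin d → ℝ) → ℝ, Differentiable ℝ f ∧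
      (∃ C, 0 ≤ C ∧ ∀ i x y, |pd i f x - pd i f y| ≤ C * ‖x - y‖ ^ α) ∧
      (∀ x, Filter.Tendsto (fun q => V q l x) Filter.atTop (nhds (f x))) ∧
      ∀ i x, Filter.Tendsto (fun q => pd i (V q l) x) Filter.atTop (nhds (pd i f x)) := by
    intro l
    refine exists_C1_limit (φ := fun q => V q l) (b := fun q => c * (1 / σ ^ q)) (Λ := Λ)
      (M := max K (2 * K / R)) hα hα1 (fun q => hV q l)
      (fun q x => ((hinc q).v_sub l).abs_le (hr _) x)
      (fun q i x => ((hinc q).pd_v_sub l i).abs_le (hr _) x)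
      (fun q i j x => ?_) hΛ0 (hgeo.mul_left c) (hgeo2 c)
      (fun i x => ((hpv l i).abs_le hR x).trans (le_max_left _ _))
      (fun i j x => (((hpv l i).pd hR j).abs_le (by positivity) x).trans (le_max_right _ _))
    refine ((((hinc q).pd_v_sub l i).pd (hr _) j).abs_le (by have := hr (q + 1); positivity)
      x).trans_eq ?_
    simp only [hΛ]
    ring
  have hwl : ∀ l, ∃ f : (Fin d → ℝ) → ℝ, Differentiable ℝ f ∧
      (∃ C, 0 ≤ C ∧ ∀ i x y, |pd i f x - pd i f y| ≤ C * ‖x - y‖ ^ α) ∧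
      (∀ x, Filter.Tendsto (fun q => W q l x) Filter.atTop (nhds (f x))) ∧
      ∀ i x, Filter.Tendsto (fun q => pd i (W q l) x) Filter.atTop (nhds (pd i f x)) := by
    intro l
    have e : ∀ q : ℕ, c * (1 / σ ^ q) * (1 + K₁) = c * (1 + K₁) * (1 / σ ^ q) := fun q => by ring
    refine exists_C1_limit (φ := fun q => W q l) (b := fun q => c * (1 + K₁) * (1 / σ ^ q)) (Λ := Λ)
      (M := max K' (2 * K' / R)) hα hα1 (fun q => hW q l)
      (fun q x => (((hinc q).w_sub l).abs_le (hr _) x).trans_eq (e q))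
      (fun q i x => (((hinc q).pd_w_sub l i).abs_le (hr _) x).trans_eq (e q))
      (fun q i j x => ?_) hΛ0 (hgeo.mul_left _) (hgeo2 _)
      (fun i x => ((hpw l i).abs_le hR x).trans (le_max_left _ _))
      (fun i j x => (((hpw l i).pd hR j).abs_le (by positivity) x).trans (le_max_right _ _))
    refine ((((hinc q).pd_w_sub l i).pd (hr _) j).abs_le (by have := hr (q + 1); positivity)
      x).trans_eq ?_
    simp only [hΛ]
    ring
  choose v' hv'd hvH hv'0 hv'1 using hvl
  choose w' hw'd hwH hw'0 hw'1 using hwl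
  choose Hv hHv using hvH
  choose Hw hHw using hwH
  have htel : ∀ (u : ℕ → ℝ) (l a : ℝ), 0 ≤ a → (∀ q, |u (q + 1) - u q| ≤ a * (1 / σ ^ q)) →
      Filter.Tendsto u Filter.atTop (nhds l) → |l - u 0| ≤ 2 * a := by
    intro u l a ha hu hl
    refine le_of_tendsto ((hl.sub_const (u 0)).abs) (Filter.Eventually.of_forall fun q => ?_)
    rw [← Finset.sum_range_sub]
    calc _ ≤ ∑ j ∈ Finset.range q, |u (j + 1) - u j| := Finset.abs_sum_le_sum_abs _ _
      _ ≤ ∑ j ∈ Finset.range q, a * (1 / σ ^ j) := Finset.sum_le_sum fun j _ => hu j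
      _ = a * ∑ j ∈ Finset.range q, 1 / σ ^ j := by rw [Finset.mul_sum]
      _ ≤ a * 2 := by gcongr; exact sum_inv_pow_le_two hσ q
      _ = _ := by ring
  have hgrad : ∀ q x, gradSum (V q) x ≤
      gradSum (V 0) x + d * k * (c * ∑ j ∈ Finset.range q, 1 / σ ^ j) := by
    intro q x
    induction q with
    | zero => simp
    | succ q ih =>
      have := (hinc q).gradSum_le (hr _) x
      rw [Finset.sum_range_succ]
      linarith
  have hgrad2 : ∀ q x, gradSum (V q) x ≤ gradSum (V 0) x + d * k * (2 * c) := by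
    intro q x
    refine (hgrad q x).trans ?_
    have := sum_inv_pow_le_two hσ q
    rw [mul_comm 2 c]
    gcongr
  have hwb : ∀ q x, c * (1 / σ ^ q) * (1 + gradSum (V q) x) ≤
      c * (1 + (gradSum (V 0) x + d * k * (2 * c))) * (1 / σ ^ q) := by
    intro q x
    have h1 : c * (1 / σ ^ q) * (1 + gradSum (V q) x) =
      c * (1 + gradSum (V q) x) * (1 / σ ^ q) := by ring
    rw [h1]
    gcongr
    exact hgrad2 q x
  have hnn : ∀ x, 0 ≤ c * (1 + (gradSum (V 0) x + d * k * (2 * c))) := fun x => by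
    have := gradSum_nonneg (V 0) x
    positivity
  refine ⟨v', w', hv'd, hw'd, ⟨∑ l, Hv l + ∑ l, Hw l, ?_, fun l i x y => ?_, fun l i x y => ?_⟩,
    fun l x => ?_, fun l i x => ?_, fun l x => ?_, fun l i x => ?_, fun i j x => ?_⟩
  · exact add_nonneg (Finset.sum_nonneg fun l _ => (hHv l).1)
      (Finset.sum_nonneg fun l _ => (hHw l).1)
  · refine ((hHv l).2 i x y).trans ?_
    gcongr
    have h1 := Finset.single_le_sum (fun l _ => (hHv l).1) (Finset.mem_univ l)
    have h2 := Finset.sum_nonneg fun l (_ : l ∈ Finset.univ) => (hHw l).1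
    linarith
  · refine ((hHw l).2 i x y).trans ?_
    gcongr
    have h1 := Finset.single_le_sum (fun l _ => (hHw l).1) (Finset.mem_univ l)
    have h2 := Finset.sum_nonneg fun l (_ : l ∈ Finset.univ) => (hHv l).1
    linarith
  · exact htel (fun q => V q l x) _ c hc0 (fun q => ((hinc q).v_sub l).abs_le (hr _) x) (hv'0 l x)
  · exact htel (fun q => pd i (V q l) x) _ c hc0
      (fun q => ((hinc q).pd_v_sub l i).abs_le (hr _) x) (hv'1 l i x)
  · refine (htel (fun q => W q l x) _ _ (hnn x)
      (fun q => ((hinc q).abs_w_sub l x).trans (hwb q x)) (hw'0 l x)).trans_eq (by ring)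
  · refine (htel (fun q => pd i (W q l) x) _ _ (hnn x)
      (fun q => ((hinc q).abs_pd_w_sub l i x).trans (hwb q x)) (hw'1 l i x)).trans_eq (by ring)
  · have hm : Filter.Tendsto (fun q => metricForm (V q) (W q) i j x) Filter.atTop
        (nhds (metricForm v' w' i j x)) := by
      unfold metricForm
      exact ((tendsto_finsetSum _ fun l _ => (hv'1 l i x).mul (hv'1 l j x)).const_mul _).add
        (((hw'1 j i x).add (hw'1 i j x)).div_const 2)
    have hz : Filter.Tendsto (fun q : ℕ => δ₀ / (σ ^ 2) ^ q) Filter.atTop (nhds 0) := by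
      refine Filter.Tendsto.div_atTop tendsto_const_nhds (tendsto_pow_atTop_atTop_of_one_lt ?_)
      nlinarith
    have h1 : Filter.Tendsto (fun q => G q i j x - metricForm (V q) (W q) i j x -
        δ₀ / (σ ^ 2) ^ q * S.total i j) Filter.atTop (nhds 0) := by
      refine squeeze_zero_norm (fun q => (hrem q i j).abs_le (hr q) x) ?_
      simpa using hz.const_mul S.rad
    have h2 := ((hGlim i j x).sub hm).sub (hz.mul_const (S.total i j))
    have h3 := tendsto_nhds_unique h1 h2
    linarith

end Scheme

section Parameters

variable {d k N : ℕ}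

theorem sqrt_div_sq_pow {σ δ₀ : ℝ} (hσ : 0 < σ) (q : ℕ) :
    √(δ₀ / (σ ^ 2) ^ q) = √δ₀ / σ ^ q := by
  rw [← pow_mul, mul_comm 2 q, pow_mul, Real.sqrt_div' _ (by positivity),
    Real.sqrt_sq (by positivity)]

theorem div_sq_pow_le {σ δ₀ : ℝ} (hσ : 4 ≤ σ) (q : ℕ) : √δ₀ / σ ^ q ≤ √δ₀ :=
  div_le_self (Real.sqrt_nonneg _) (one_le_pow₀ (by linarith))

theorem RankOneBasis.stageScheme_of_codim (S : RankOneBasis d N) (hk : 0 < k) (hd : 0 < d)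
    {R δ₀ θ σ Δ : ℝ} (hR : 0 < R) (hR1 : R ≤ 1) (hδ : 0 < δ₀) (hΔ : 1 ≤ Δ) (hδΔ : √δ₀ ≤ Δ)
    (hθ : 4 ≤ θ) (hσ : 4 ≤ σ)
    (hθ2 : N * (1024 * Real.exp (2 * d)) ≤ S.rad / 4 * θ ^ 2)
    (hθk : (N + 1) * (256 * Real.exp (2 * d) ^ 2 * Δ * σ ^ 2) ≤ S.rad / 4 * θ ^ k) :
    StageScheme S (stageConst d k N Δ) σ (σ * θ ^ N) δ₀ R (fun q v => ∀ m, q * N ≤ m → ∀ i j,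
      HolBdd (R / (σ * θ ^ N) ^ q)
        (64 * Real.exp (2 * d) * (√δ₀ * θ * σ / (4 * R) * θ ^ m) / θ ^ k)
        (pd i (pd j (v ⟨m % k, Nat.mod_lt _ hk⟩)))) := by
  intro q v w G K hv hw hG hK hpv hI hrem
  have hσ0 : 0 < σ := by linarith
  have hθ0 : 0 < θ := by linarith
  have hY1 : 1 ≤ σ * θ ^ N := one_le_mul_of_one_le_of_one_le (by linarith)
    (one_le_pow₀ (by linarith))
  have hsq := sqrt_div_sq_pow (δ₀ := δ₀) hσ0 q
  obtain ⟨v', w', h1, h2, h3, h4, h5⟩ := S.exists_stage_of_codim hk hd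
    (ρ := R / (σ * θ ^ N) ^ q) (δ := δ₀ / (σ ^ 2) ^ q) (θ := θ) (σ := σ)
    (P := √δ₀ * θ * σ / (4 * R)) (M := q * N) (by positivity)
    ((div_le_self hR.le (one_le_pow₀ hY1)).trans hR1) (by positivity) hΔ
    (by rw [hsq]; exact (div_sq_pow_le hσ q).trans hδΔ) hθ hσ hθ2 hθk
    (by rw [hsq, mul_pow, ← pow_mul, mul_comm N q]; field_simp) hv hw hG hK hpv hI hrem
  have e1 : R / (σ * θ ^ N) ^ q / (σ * θ ^ N) = R / (σ * θ ^ N) ^ (q + 1) := by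
    rw [pow_succ, div_div]
  have e2 : δ₀ / (σ ^ 2) ^ q / σ ^ 2 = δ₀ / (σ ^ 2) ^ (q + 1) := by rw [pow_succ (σ ^ 2), div_div]
  rw [e1, hsq] at h3
  rw [e1] at h4
  rw [e1, e2] at h5
  refine ⟨v', w', h1, h2, h3, fun m hm => h4 m ?_, h5⟩
  rwa [Nat.succ_mul] at hm

theorem RankOneBasis.stageScheme_of_large_codim {r : ℕ} (S : RankOneBasis d N) (J : ℕ)
    {R δ₀ σ Y Δ : ℝ} (hR : 0 < R) (hR1 : R ≤ 1) (hδ : 0 < δ₀) (hδΔ : √δ₀ ≤ Δ) (hσ : 4 ≤ σ)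
    (hY : 12 * Real.exp (2 * d) * σ * 2 ^ (J + 2) ≤ Y)
    (hY1 : ∀ j ≤ J, (S.oscConst r j).2.2 * (12 * Real.exp (2 * d) * σ * 2 ^ (J + 2) / Y) ≤ S.rad)
    (hY2 : (S.oscConst r J).1 * (12 * Real.exp (2 * d) * σ * 2 ^ (J + 2) / Y) ≤ 1)
    (hY3 : (S.oscConst r J).2.1 * (12 * Real.exp (2 * d) * σ * 2 ^ (J + 2) / Y) ^ (J + 1) * σ ^ 2 ≤
      S.rad / 2) :
    StageScheme S ((1 + ((N + N + r : ℕ) : ℝ)) * (6 * Real.exp (2 * d)) +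
        ((N + N + r : ℕ) : ℝ) * (4 * Real.exp (2 * d) * Δ)) σ Y δ₀ R
      (fun q (v : Fin (N + N + r) → (Fin d → ℝ) → ℝ) => ∀ l i j, HolBdd (R / Y ^ q)
        (12 * Real.exp (2 * d) * σ * √(δ₀ / (σ ^ 2) ^ q) / (R / Y ^ q)) (pd i (pd j (v l)))) := by
  intro q v w G K hv hw hG hK hpv hI hrem
  have hσ0 : 0 < σ := by linarith
  have hY0 : 1 ≤ Y := by
    refine le_trans ?_ hY
    have h1 : 1 ≤ Real.exp (2 * d) := Real.one_le_exp (by positivity)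
    have h2 : (1 : ℝ) ≤ 2 ^ (J + 2) := one_le_pow₀ (by norm_num)
    have h3 : 1 ≤ 12 * Real.exp (2 * d) := by linarith
    exact one_le_mul_of_one_le_of_one_le
      (one_le_mul_of_one_le_of_one_le h3 (by linarith)) h2
  have hsq := sqrt_div_sq_pow (δ₀ := δ₀) hσ0 q
  obtain ⟨v', w', h1, h2, h3, h4, h5⟩ := S.exists_stage_of_large_codim J (Δ := Δ)
    (ρ := R / Y ^ q) (δ := δ₀ / (σ ^ 2) ^ q) (by positivity)
    ((div_le_self hR.le (one_le_pow₀ hY0)).trans hR1) (by positivity)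
    (by rw [hsq]; exact (div_sq_pow_le hσ q).trans hδΔ) hσ hY hY1 hY2 hY3 hv hw hG hK hpv hI hrem
  have e1 : R / Y ^ q / Y = R / Y ^ (q + 1) := by rw [pow_succ, div_div]
  have e2 : δ₀ / (σ ^ 2) ^ q / σ ^ 2 = δ₀ / (σ ^ 2) ^ (q + 1) := by rw [pow_succ (σ ^ 2), div_div]
  rw [e1, hsq] at h3
  rw [e1, e2] at h4 h5
  exact ⟨v', w', h1, h2, h3, h4, h5⟩

/-- The existence, for all amplitudes `δ₀` and all small strips, of a scheme of stages with
parameters `σ` and `Y` adapted to the Hölder exponents `α` and `β`. -/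
def HasScheme (S : RankOneBasis d N) (k : ℕ) (C Δ α β : ℝ) : Prop :=
  ∃ σ Y : ℝ, 4 ≤ σ ∧ 1 ≤ Y ∧ Y ^ α < σ ∧ σ ^ 2 ≤ Y ^ β ∧
    ∀ δ₀, 0 < δ₀ → √δ₀ ≤ Δ → ∃ c₀, 0 < c₀ ∧ ∀ R, 0 < R → R ≤ 1 →
      ∃ Inv : ℕ → (Fin k → (Fin d → ℝ) → ℝ) → Prop, StageScheme S C σ Y δ₀ R Inv ∧
        ∀ v : Fin k → (Fin d → ℝ) → ℝ,
          (∀ l i j, HolBdd R (c₀ / R) (pd i (pd j (v l)))) → Inv 0 v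

theorem rpow_conditions {σ y α β : ℝ} (hσ : 4 ≤ σ) (hyα : 2 * y * α < 1)
    (hyβ : 1 ≤ y * β) : (σ ^ (2 * y)) ^ α < σ ∧ σ ^ 2 ≤ (σ ^ (2 * y)) ^ β := by
  have hσ0 : 0 ≤ σ := by linarith
  have hσ1 : 1 < σ := by linarith
  rw [← Real.rpow_mul hσ0, ← Real.rpow_mul hσ0]
  constructor
  · calc σ ^ (2 * y * α) < σ ^ (1 : ℝ) := Real.rpow_lt_rpow_of_exponent_lt hσ1 hyα
      _ = σ := Real.rpow_one σ
  · rw [← Real.rpow_two]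
    exact Real.rpow_le_rpow_of_exponent_le hσ1.le (by linarith)

theorem RankOneBasis.hasScheme_of_codim (S : RankOneBasis d N) (hk : 0 < k) (hd : 0 < d)
    (hN : 0 < N) {Δ α β y : ℝ} (hΔ : 1 ≤ Δ) (hy : (N : ℝ) / k + 1 / 2 < y)
    (hyα : 2 * y * α < 1) (hyβ : 1 ≤ y * β) : HasScheme S k (stageConst d k N Δ) Δ α β := by
  have hk' : (0 : ℝ) < k := by exact_mod_cast hk
  have hN' : (0 : ℝ) < N := by exact_mod_cast hN
  have hrad := S.rad_pos
  set s := 2 * ((y - 1 / 2) / N) with hs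
  have hsk : 2 < s * k := by
    have : (N : ℝ) / k < y - 1 / 2 := by linarith
    rw [div_lt_iff₀ hk'] at this
    rw [hs, mul_assoc, div_mul_eq_mul_div]
    have h2 : 1 < (y - 1 / 2) * k / N := by rwa [one_lt_div hN']
    linarith
  have hs0 : 0 < s := by
    by_contra h
    push Not at h
    nlinarith
  have hsN : 1 + s * N = 2 * y := by rw [hs]; field_simp; ring
  have t1 := tendsto_rpow_atTop hs0
  have t2 : Filter.Tendsto (fun σ : ℝ => (σ ^ s) ^ 2) Filter.atTop Filter.atTop :=
    (Filter.tendsto_pow_atTop two_ne_zero).comp t1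
  have t3 := tendsto_rpow_atTop (y := s * k - 2) (by linarith)
  obtain ⟨σ, h1, h2, h3, hσ⟩ := ((t1.eventually_ge_atTop 4).and
    ((t2.eventually_ge_atTop (N * (1024 * Real.exp (2 * d)) / (S.rad / 4))).and
    ((t3.eventually_ge_atTop ((N + 1) * (256 * Real.exp (2 * d) ^ 2 * Δ) / (S.rad / 4))).and
      (Filter.eventually_ge_atTop 4)))).exists
  have hσ0 : 0 < σ := by linarith
  have hY : σ * (σ ^ s) ^ N = σ ^ (2 * y) := by
    rw [← Real.rpow_natCast, ← Real.rpow_mul hσ0.le, ← hsN, Real.rpow_add hσ0, Real.rpow_one]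
  obtain ⟨c1, c2⟩ := rpow_conditions hσ hyα hyβ
  refine ⟨σ, σ * (σ ^ s) ^ N, hσ, ?_, by rwa [hY], by rwa [hY], fun δ₀ hδ hδΔ => ?_⟩
  · exact one_le_mul_of_one_le_of_one_le (by linarith) (one_le_pow₀ (by linarith))
  refine ⟨64 * Real.exp (2 * d) * (√δ₀ * σ ^ s * σ / 4) / (σ ^ s) ^ k, ?_, fun R hR hR1 => ?_⟩
  · have := Real.sqrt_pos.2 hδ
    positivity
  refine ⟨_, S.stageScheme_of_codim hk hd hR hR1 hδ hΔ hδΔ h1 hσ ?_ ?_, fun v hv m _ i j => ?_⟩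
  · rwa [div_le_iff₀' (by positivity)] at h2
  · rw [div_le_iff₀' (by positivity)] at h3
    have e : (σ ^ s) ^ k = σ ^ (s * k - 2) * σ ^ 2 := by
      rw [← Real.rpow_natCast (σ ^ s), ← Real.rpow_mul hσ0.le, ← Real.rpow_two,
        ← Real.rpow_add hσ0]
      congr 1
      ring
    rw [e]
    have := mul_le_mul_of_nonneg_right h3 (sq_nonneg σ)
    linarith
  · have h4 : (1 : ℝ) ≤ (σ ^ s) ^ m := one_le_pow₀ (by linarith)
    rw [pow_zero, div_one]
    refine (hv _ i j).weaken ?_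
    have e : 64 * Real.exp (2 * d) * (√δ₀ * σ ^ s * σ / (4 * R) * (σ ^ s) ^ m) / (σ ^ s) ^ k =
      64 * Real.exp (2 * d) * (√δ₀ * σ ^ s * σ / 4) / (σ ^ s) ^ k / R * (σ ^ s) ^ m := by
      field_simp
    rw [e]
    exact le_mul_of_one_le_right (by positivity) h4

theorem RankOneBasis.hasScheme_of_large_codim {r : ℕ} (S : RankOneBasis d N) {Δ α β y : ℝ}
    (hy : 1 / 2 < y) (hyα : 2 * y * α < 1) (hyβ : 1 ≤ y * β) :
    HasScheme S (N + N + r) ((1 + ((N + N + r : ℕ) : ℝ)) * (6 * Real.exp (2 * d)) +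
        ((N + N + r : ℕ) : ℝ) * (4 * Real.exp (2 * d) * Δ)) Δ α β := by
  have hrad := S.rad_pos
  have hp : 0 < 2 * y - 1 := by linarith
  obtain ⟨J, hJ⟩ : ∃ J : ℕ, 2 < (2 * y - 1) * ((J : ℝ) + 1) := by
    obtain ⟨n, hn⟩ := exists_nat_gt (2 / (2 * y - 1))
    refine ⟨n, ?_⟩
    rw [div_lt_iff₀' hp] at hn
    nlinarith
  set c := 12 * Real.exp (2 * d) * 2 ^ (J + 2) with hc
  have t1 : Filter.Tendsto (fun σ : ℝ => c * σ ^ (-(2 * y - 1))) Filter.atTop (nhds 0) := by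
    simpa using (tendsto_rpow_neg_atTop hp).const_mul c
  have t2 : Filter.Tendsto (fun σ : ℝ => (S.oscConst r J).2.1 * c ^ (J + 1) *
      σ ^ (-((2 * y - 1) * ((J : ℝ) + 1) - 2))) Filter.atTop (nhds 0) := by
    simpa using (tendsto_rpow_neg_atTop (sub_pos.2 hJ)).const_mul
      ((S.oscConst r J).2.1 * c ^ (J + 1))
  have t3 : ∀ a : ℝ, Filter.Tendsto (fun σ : ℝ => a * (c * σ ^ (-(2 * y - 1)))) Filter.atTop
      (nhds 0) := fun a => by simpa using t1.const_mul a
  have ev1 : ∀ᶠ σ : ℝ in Filter.atTop, ∀ j ∈ Finset.range (J + 1),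
      (S.oscConst r j).2.2 * (c * σ ^ (-(2 * y - 1))) < S.rad := by
    rw [Filter.eventually_all_finset]
    exact fun j _ => (t3 _).eventually_lt_const hrad
  obtain ⟨σ, h1, h2, h3, h4, hσ⟩ := (ev1.and (((t3 (S.oscConst r J).1).eventually_lt_const
    one_pos).and ((t2.eventually_lt_const (half_pos hrad)).and
      ((t1.eventually_lt_const one_pos).and (Filter.eventually_ge_atTop 4))))).exists
  have hσ0 : 0 < σ := by linarith
  have hY0 : 0 < σ ^ (2 * y) := by positivity
  have e : 12 * Real.exp (2 * d) * σ * 2 ^ (J + 2) / σ ^ (2 * y) = c * σ ^ (-(2 * y - 1)) := by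
    have h5 : σ ^ (2 * y) = σ ^ (2 * y - 1) * σ := by
      conv_rhs => rw [← Real.rpow_one σ, ← Real.rpow_mul hσ0.le, one_mul, ← Real.rpow_add hσ0]
      congr 1
      ring
    rw [h5, Real.rpow_neg hσ0.le, hc]
    field_simp
  obtain ⟨c1, c2⟩ := rpow_conditions hσ hyα hyβ
  refine ⟨σ, σ ^ (2 * y), hσ, Real.one_le_rpow (by linarith) (by linarith), c1, c2,
    fun δ₀ hδ hδΔ => ?_⟩
  refine ⟨12 * Real.exp (2 * d) * σ * √δ₀, ?_, fun R hR hR1 => ?_⟩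
  · have := Real.sqrt_pos.2 hδ
    positivity
  refine ⟨_, S.stageScheme_of_large_codim J hR hR1 hδ hδΔ hσ ?_ ?_ ?_ ?_, fun v hv l i j => ?_⟩
  · rw [← div_le_one hY0, e]
    exact h4.le
  · intro j hj
    rw [e]
    exact (h1 j (Finset.mem_range.2 (by omega))).le
  · rw [e]
    exact h2.le
  · rw [e]
    refine le_trans (le_of_eq ?_) h3.le
    have h6 : (σ ^ (-(2 * y - 1))) ^ (J + 1) * σ ^ 2 =
        σ ^ (-((2 * y - 1) * ((J : ℝ) + 1) - 2)) := by
      rw [← Real.rpow_natCast, ← Real.rpow_mul hσ0.le, ← Real.rpow_two, ← Real.rpow_add hσ0]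
      congr 1
      push_cast
      ring
    rw [mul_pow, ← h6]
    ring
  · simpa using hv l i j

theorem stageConst_nonneg (d k N : ℕ) {Δ : ℝ} (hΔ : 1 ≤ Δ) : 0 ≤ stageConst d k N Δ :=
  incrConst_nonneg (by positivity) (by positivity) N

theorem RankOneBasis.exists_hasScheme (S : RankOneBasis d N) (hN : 2 * N = d * (d + 1))
    (hd : 1 ≤ d) (hk : 1 ≤ k) {Δ : ℝ} (hΔ : 1 ≤ Δ) :
    ∃ C : ℝ, 0 ≤ C ∧ ∀ α β : ℝ, 0 < α → 0 < β →
      (α < min (β / 2) (1 / (1 + (d : ℝ) * ((d : ℝ) + 1) / (k : ℝ)))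
        ∨ (d * (d + 1) ≤ k ∧ α < min (β / 2) 1)) →
      ∃ C' ≤ C, 0 ≤ C' ∧ HasScheme S k C' Δ α β := by
  have hNpos : 0 < N := by
    have : 0 < d * (d + 1) := by positivity
    omega
  have hNd : (d : ℝ) * ((d : ℝ) + 1) = 2 * N := by exact_mod_cast hN.symm
  have hk' : (0 : ℝ) < k := by exact_mod_cast hk
  set C₂ := (1 + (k : ℝ)) * (6 * Real.exp (2 * d)) + (k : ℝ) * (4 * Real.exp (2 * d) * Δ) with hC₂
  have hC₂0 : 0 ≤ C₂ := by positivity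
  refine ⟨max |stageConst d k N Δ| C₂, le_max_of_le_right hC₂0, fun α β hα hβ h => ?_⟩
  have mid : ∀ a : ℝ, a < 1 / (2 * α) → α < β / 2 →
      ∃ y, a < y ∧ 2 * y * α < 1 ∧ 1 ≤ y * β := by
    intro a ha hαβ
    have h1 : 1 / β < 1 / (2 * α) := one_div_lt_one_div_of_lt (by positivity) (by linarith)
    obtain ⟨y, hy1, hy2⟩ := exists_between (max_lt ha h1)
    refine ⟨y, (le_max_left _ _).trans_lt hy1, ?_, ?_⟩
    · rw [lt_div_iff₀ (by positivity)] at hy2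
      linarith
    · have := (le_max_right a _).trans hy1.le
      rwa [div_le_iff₀ hβ] at this
  have hpos := stageConst_nonneg d k N hΔ
  rcases h with h | ⟨hdk, h⟩
  · rw [lt_min_iff] at h
    obtain ⟨y, hy1, hy2, hy3⟩ := mid ((N : ℝ) / k + 1 / 2) (by
      have h2 := h.2
      rw [hNd, lt_one_div hα (by positivity)] at h2
      have : 1 / (2 * α) = (1 / 2) * (1 / α) := by field_simp
      rw [this]
      have h3 : 2 * (N : ℝ) / k = 2 * (N / k) := by ring
      linarith) h.1
    exact ⟨_, (le_abs_self _).trans (le_max_left _ _), hpos,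
      S.hasScheme_of_codim hk hd hNpos hΔ hy1 hy2 hy3⟩
  · rw [lt_min_iff] at h
    obtain ⟨y, hy1, hy2, hy3⟩ := mid (1 / 2) (one_div_lt_one_div_of_lt (by positivity)
      (by linarith)) h.1
    obtain ⟨r, rfl⟩ : ∃ r, k = N + N + r := ⟨k - (N + N), by omega⟩
    exact ⟨C₂, le_max_right _ _, hC₂0, S.hasScheme_of_large_codim hy1 hy2 hy3⟩

end Parameters

section Approximation

variable {d k : ℕ}

theorem HolBdd.exists_shrink {ρ A ε ε' : ℝ} {f : (Fin d → ℝ) → ℝ} (hρ : 0 < ρ)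
    (hf : HolBdd ρ A f) (hε : ∀ x, |f x| ≤ ε) (h : ε < ε') :
    ∃ ρ', 0 < ρ' ∧ ρ' ≤ ρ ∧ HolBdd ρ' ε' f := by
  have hA := hf.nonneg hρ
  obtain ⟨F, h1, h2, h3⟩ := hf
  set t := min (1 / 2) ((ε' - ε) / (2 * A + 1)) with ht
  have ht0 : 0 < t := lt_min (by norm_num) (div_pos (by linarith) (by linarith))
  have ht1 : t < 1 := (min_le_left _ _).trans_lt (by norm_num)
  have htA : 2 * A * t ≤ ε' - ε := by
    have := min_le_right (1 / 2) ((ε' - ε) / (2 * A + 1))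
    rw [← ht, le_div_iff₀ (by linarith)] at this
    nlinarith
  have hsub : strip d (ρ * t) ⊆ strip d ρ := strip_mono (mul_le_of_le_one_right hρ.le ht1.le)
  refine ⟨ρ * t, by positivity, mul_le_of_le_one_right hρ.le ht1.le, F, h1.mono hsub,
    fun z hz => ?_, h3⟩
  set x : Fin d → ℝ := fun i => (z i).re
  let p : ℂ → Fin d → ℂ := fun τ i => (x i : ℂ) + τ * (((z i).im : ℂ) * Complex.I)
  have hp : ∀ τ ∈ Metric.ball (0 : ℂ) (1 / t), p τ ∈ strip d ρ := by
    intro τ hτ i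
    rw [mem_ball_zero_iff] at hτ
    have h4 : (p τ i).im = τ.re * (z i).im := by simp [p]
    rw [h4, abs_mul]
    calc |τ.re| * |(z i).im| ≤ 1 / t * |(z i).im| := by
          gcongr; exact (Complex.abs_re_le_norm τ).trans hτ.le
      _ < 1 / t * (ρ * t) := by
          have := hz i
          gcongr
      _ = ρ := by field_simp
  have hp0 : p 0 = toC x := by ext i; simp [p, toC]
  have hp1 : p 1 = z := by
    ext i
    simp only [p, x, one_mul]
    exact Complex.re_add_im (z i)
  have hpd : Differentiable ℂ p := by
    rw [differentiable_pi]
    intro i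
    fun_prop
  have hd : DifferentiableOn ℂ (F ∘ p) (Metric.ball 0 (1 / t)) :=
    (h1.differentiableOn (by simp)).comp hpd.differentiableOn hp
  have hmaps : Set.MapsTo (F ∘ p) (Metric.ball 0 (1 / t))
      (Metric.closedBall ((F ∘ p) 0) (2 * A)) := by
    intro τ hτ
    rw [mem_closedBall_iff_norm]
    refine (norm_sub_le _ _).trans ?_
    have h5 := h2 _ (hp τ hτ)
    have h6 := h2 _ (hp 0 (by simpa using ht0))
    simp only [Function.comp_apply]
    linarith
  have hdist := Complex.dist_le_div_mul_dist_of_mapsTo_ball hd hmaps (z := 1) (by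
    rw [mem_ball_zero_iff, norm_one, lt_div_iff₀ ht0]; linarith)
  simp only [Function.comp_apply, hp0, hp1, h3] at hdist
  rw [dist_eq_norm, dist_zero_right, norm_one, mul_one, div_div_eq_mul_div, div_one] at hdist
  have h7 : ‖((f x : ℝ) : ℂ)‖ ≤ ε := by
    rw [Complex.norm_real]; exact hε x
  calc ‖F z‖ = ‖(F z - f x) + f x‖ := by rw [sub_add_cancel]
    _ ≤ _ := (norm_add_le _ _).trans (by linarith)

theorem exists_abs_pd_le {f : (Fin d → ℝ) → ℝ} (hf : ContDiff ℝ 1 f) (hs : HasCompactSupport f) :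
    ∃ M, 0 ≤ M ∧ ∀ i x, |pd i f x| ≤ M := by
  obtain ⟨M, hM⟩ := (hf.continuous_fderiv one_ne_zero).bounded_above_of_compact_support
    (hs.fderiv ℝ)
  refine ⟨M, (norm_nonneg _).trans (hM 0), fun i x => ?_⟩
  refine ((fderiv ℝ f x).le_opNorm _).trans ?_
  rw [Pi.norm_single, norm_one, mul_one]
  exact hM x

theorem exists_holder_of_contDiff {β : ℝ} (hβ : 0 < β) (hβ1 : β ≤ 1) {f : (Fin d → ℝ) → ℝ}
    (hf : ContDiff ℝ 1 f) (hs : HasCompactSupport f) :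
    ∃ L, 0 ≤ L ∧ ∀ x y, |f x - f y| ≤ L * ‖x - y‖ ^ β := by
  obtain ⟨M, hM0, hM⟩ := exists_abs_pd_le hf hs
  obtain ⟨B, hB⟩ := hf.continuous.bounded_above_of_compact_support hs
  have hB' : ∀ x, |f x| ≤ max B M := fun x => (hB x).trans (le_max_left _ _)
  have h := abs_sub_le_rpow (hf.differentiable one_ne_zero) hβ hβ1 one_pos hB' fun i x => by
    rw [mul_one]; exact (hM i x).trans (le_max_right _ _)
  refine ⟨_, ?_, h⟩
  have := hM0.trans (le_max_right B M)
  positivity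

theorem hasCompactSupport_pd {f : (Fin d → ℝ) → ℝ} (hs : HasCompactSupport f) (i : Fin d) :
    HasCompactSupport (pd i f) :=
  (hs.fderiv ℝ).comp_left (g := fun T : (Fin d → ℝ) →L[ℝ] ℝ => T (Pi.single i 1)) rfl

theorem contDiff_pd {f : (Fin d → ℝ) → ℝ} (hf : ContDiff ℝ 2 f) (i : Fin d) :
    ContDiff ℝ 1 (pd i f) :=
  (hf.fderiv_right (m := 1) (by norm_num)).clm_apply contDiff_const

theorem mollConst_nonneg : 0 ≤ mollConst d := by
  unfold mollConst; positivity

theorem tendsto_const_mul_rpow {β : ℝ} (hβ : 0 < β) (c : ℝ) :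
    Filter.Tendsto (fun ℓ : ℝ => c * ℓ ^ β) (nhdsWithin 0 (Set.Ioi 0)) (nhds 0) := by
  have : Filter.Tendsto (fun ℓ : ℝ => c * ℓ ^ β) (nhds 0) (nhds (c * 0 ^ β)) :=
    ((Real.continuousAt_rpow_const 0 β (Or.inr hβ.le)).tendsto).const_mul c
  rw [Real.zero_rpow hβ.ne', mul_zero] at this
  exact this.mono_left nhdsWithin_le_nhds

theorem eventually_abs_moll_sub_le {β L ε : ℝ} (hβ : 0 < β) (hβ1 : β ≤ 1) (hL0 : 0 ≤ L)
    (hε : 0 < ε) {f : (Fin d → ℝ) → ℝ} (hf : Continuous f) (hs : HasCompactSupport f)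
    (hL : ∀ x y, |f x - f y| ≤ L * ‖x - y‖ ^ β) :
    ∀ᶠ ℓ in nhdsWithin (0 : ℝ) (Set.Ioi 0), ∀ x, |moll ℓ f x - f x| ≤ ε := by
  filter_upwards [(tendsto_const_mul_rpow hβ (mollConst d * L)).eventually_lt_const hε,
    self_mem_nhdsWithin] with ℓ h1 h2 x
  exact (abs_moll_sub_le h2 hβ hβ1 hL0 hf hs hL x).trans h1.le

theorem eventually_abs_moll_sub_le_of_contDiff {ε : ℝ} (hε : 0 < ε) {f : (Fin d → ℝ) → ℝ}
    (hf : ContDiff ℝ 1 f) (hs : HasCompactSupport f) :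
    ∀ᶠ ℓ in nhdsWithin (0 : ℝ) (Set.Ioi 0), ∀ x, |moll ℓ f x - f x| ≤ ε := by
  obtain ⟨L, hL0, hL⟩ := exists_holder_of_contDiff one_pos le_rfl hf hs
  exact eventually_abs_moll_sub_le one_pos le_rfl hL0 hε hf.continuous hs hL

theorem eventually_moll_C1_close {ε : ℝ} (hε : 0 < ε) {f : (Fin d → ℝ) → ℝ}
    (hf : ContDiff ℝ 2 f) (hs : HasCompactSupport f) :
    ∀ᶠ ℓ in nhdsWithin (0 : ℝ) (Set.Ioi 0), (∀ x, |moll ℓ f x - f x| ≤ ε) ∧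
      ∀ i x, |pd i (moll ℓ f) x - pd i f x| ≤ ε := by
  have hf1 : ContDiff ℝ 1 f := hf.of_le (by norm_num)
  have h2 := Filter.eventually_all.2 fun i => eventually_abs_moll_sub_le_of_contDiff hε
    (contDiff_pd hf i) (hasCompactSupport_pd hs i)
  filter_upwards [eventually_abs_moll_sub_le_of_contDiff hε hf1 hs, h2, self_mem_nhdsWithin]
    with ℓ h1 h2 h3
  refine ⟨h1, fun i x => ?_⟩
  rw [pd_moll h3 hf1 hs]
  exact h2 i x

theorem abs_metricForm_sub_le {v v' : Fin k → (Fin d → ℝ) → ℝ} {w w' : Fin d → (Fin d → ℝ) → ℝ}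
    {M ε : ℝ} (hε : 0 ≤ ε) (hε1 : ε ≤ 1) (hM : ∀ l i x, |pd i (v l) x| ≤ M)
    (hv : ∀ l i x, |pd i (v' l) x - pd i (v l) x| ≤ ε)
    (hw : ∀ l i x, |pd i (w' l) x - pd i (w l) x| ≤ ε) (i j : Fin d) (x : Fin d → ℝ) :
    |metricForm v' w' i j x - metricForm v w i j x| ≤ (k * (M + 1) + 1) * ε := by
  have e : metricForm v' w' i j x - metricForm v w i j x =
      (1 / 2) * ∑ l, ((pd i (v' l) x - pd i (v l) x) * pd j (v' l) x +
        pd i (v l) x * (pd j (v' l) x - pd j (v l) x)) +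
      ((pd i (w' j) x - pd i (w j) x) + (pd j (w' i) x - pd j (w i) x)) / 2 := by
    have : ∑ l, ((pd i (v' l) x - pd i (v l) x) * pd j (v' l) x +
        pd i (v l) x * (pd j (v' l) x - pd j (v l) x)) =
        ∑ l, pd i (v' l) x * pd j (v' l) x - ∑ l, pd i (v l) x * pd j (v l) x := by
      rw [← Finset.sum_sub_distrib]
      exact Finset.sum_congr rfl fun l _ => by ring
    rw [this]
    unfold metricForm
    ring
  have h1 : ∀ l, |(pd i (v' l) x - pd i (v l) x) * pd j (v' l) x +
        pd i (v l) x * (pd j (v' l) x - pd j (v l) x)| ≤ 2 * (M + 1) * ε := by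
    intro l
    have h3 : |pd j (v' l) x| ≤ M + 1 := by
      have h4 := abs_add_le (pd j (v' l) x - pd j (v l) x) (pd j (v l) x)
      rw [sub_add_cancel] at h4
      linarith [hv l j x, hM l j x]
    refine (abs_add_le _ _).trans ?_
    rw [abs_mul, abs_mul]
    calc _ ≤ ε * (M + 1) + (M + 1) * ε := by
          gcongr
          · exact hv l i x
          · linarith [abs_nonneg (pd i (v l) x), hM l i x]
          · linarith [hM l i x]
          · exact hv l j x
      _ = _ := by ring
  have h2 := (Finset.abs_sum_le_sum_abs _ Finset.univ).trans
    (Finset.sum_le_sum fun l (_ : l ∈ Finset.univ) => h1 l)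
  rw [Finset.sum_const, Finset.card_univ, Fintype.card_fin, nsmul_eq_mul] at h2
  have h5 := hw j i x
  have h6 := hw i j x
  rw [e]
  rw [abs_le] at h2 h5 h6 ⊢
  constructor <;> linarith

theorem gradSum_le_add {v v' : Fin k → (Fin d → ℝ) → ℝ} {ε : ℝ}
    (hv : ∀ l i x, |pd i (v' l) x - pd i (v l) x| ≤ ε) (x : Fin d → ℝ) :
    gradSum v' x ≤ gradSum v x + d * k * ε := by
  unfold gradSum
  have : ∀ l i, |pd i (v' l) x| ≤ |pd i (v l) x| + ε := fun l i => by
    have h4 := abs_add_le (pd i (v' l) x - pd i (v l) x) (pd i (v l) x)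
    rw [sub_add_cancel] at h4
    linarith [hv l i x]
  refine (Finset.sum_le_sum fun l _ => Finset.sum_le_sum fun i _ => this l i).trans ?_
  simp only [Finset.sum_add_distrib, Finset.sum_const, Finset.card_univ, Fintype.card_fin,
    nsmul_eq_mul]
  rw [← mul_assoc, mul_comm (k : ℝ)]

end Approximation

section CompactlySupported

variable {d k N : ℕ}

theorem HolBdd.exists_forall {ι : Type*} [Finite ι] {ρ : ℝ} {f : ι → (Fin d → ℝ) → ℝ}
    (h : ∀ i, ∃ A, HolBdd ρ A (f i)) : ∃ A, 0 ≤ A ∧ ∀ i, HolBdd ρ A (f i) := by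
  choose A hA using h
  obtain ⟨M, hM⟩ := (Set.finite_range A).bddAbove
  exact ⟨max M 0, le_max_right _ _, fun i =>
    (hA i).weaken ((hM (Set.mem_range_self i)).trans (le_max_left _ _))⟩

theorem eventually_le_of_pos {ρ : ℝ} (hρ : 0 < ρ) :
    ∀ᶠ R in nhdsWithin (0 : ℝ) (Set.Ioi 0), R ≤ ρ :=
  nhdsWithin_le_nhds (Iic_mem_nhds hρ)

theorem holBdd_metricForm {ρ K K' : ℝ} (hρ : 0 < ρ) {v : Fin k → (Fin d → ℝ) → ℝ}
    {w : Fin d → (Fin d → ℝ) → ℝ} (hv : ∀ l i, HolBdd ρ K (pd i (v l)))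
    (hw : ∀ l i, HolBdd ρ K' (pd i (w l))) (i j : Fin d) :
    ∃ A, HolBdd ρ A (metricForm v w i j) := by
  refine ⟨_, (((HolBdd.sum Finset.univ fun l _ => (hv l i).mul (hv l j) hρ).const_mul
    (1 / 2)).add (((hw j i).add (hw i j)).const_mul (1 / 2))).congr fun x => ?_⟩
  unfold metricForm
  ring

theorem exists_holBdd_moll {ℓ : ℝ} (hℓ : 0 < ℓ) {f : (Fin d → ℝ) → ℝ} (hf : Continuous f)
    (hs : HasCompactSupport f) : ∃ A, HolBdd ℓ A (moll ℓ f) := by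
  obtain ⟨M, hM⟩ := hf.bounded_above_of_compact_support hs
  exact ⟨_, holBdd_moll hℓ hf hs hM⟩

theorem HasScheme.exists_solution {S : RankOneBasis d N} {C Δ α β s L : ℝ}
    (hS : HasScheme S k C Δ α β) (hC : 0 ≤ C) (hΔ : √(3 / S.rad) ≤ Δ) (hα : 0 < α) (hα1 : α ≤ 1)
    (hβ : 0 < β) (hβ1 : β ≤ 1) (hs : 0 < s) (hs1 : s ≤ 1)
    {v : Fin k → (Fin d → ℝ) → ℝ} {w : Fin d → (Fin d → ℝ) → ℝ}
    {A : Fin d → Fin d → (Fin d → ℝ) → ℝ}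
    (hv : ∀ l, ContDiff ℝ 2 (v l)) (hvs : ∀ l, HasCompactSupport (v l))
    (hw : ∀ l, ContDiff ℝ 2 (w l)) (hws : ∀ l, HasCompactSupport (w l))
    (hA : ∀ i j x, A i j x = A j i x) (hAc : ∀ i j, Continuous (A i j))
    (hAs : ∀ i j, HasCompactSupport (A i j)) (hL0 : 0 ≤ L)
    (hL : ∀ i j x y, |A i j x - A i j y| ≤ L * ‖x - y‖ ^ β)
    (hD : ∀ i j x, |A i j x - metricForm v w i j x| ≤ 2 * s) :
    ∃ (v' : Fin k → (Fin d → ℝ) → ℝ) (w' : Fin d → (Fin d → ℝ) → ℝ),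
      (∀ l, Differentiable ℝ (v' l)) ∧ (∀ l, Differentiable ℝ (w' l)) ∧
      (∃ H, 0 ≤ H ∧ (∀ l i x y, |pd i (v' l) x - pd i (v' l) y| ≤ H * ‖x - y‖ ^ α) ∧
        ∀ l i x y, |pd i (w' l) x - pd i (w' l) y| ≤ H * ‖x - y‖ ^ α) ∧
      (∀ l x, |v' l x - v l x| ≤ (2 * (C * Δ) + 1) * √s) ∧
      (∀ l i x, |pd i (v' l) x - pd i (v l) x| ≤ (2 * (C * Δ) + 1) * √s) ∧
      (∀ l x, |w' l x - w l x| ≤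
        (2 * (C * Δ) + 1) * √s * (1 + (gradSum v x + d * k * (2 * (C * Δ) + 1)))) ∧
      (∀ l i x, |pd i (w' l) x - pd i (w l) x| ≤
        (2 * (C * Δ) + 1) * √s * (1 + (gradSum v x + d * k * (2 * (C * Δ) + 1)))) ∧
      ∀ i j x, metricForm v' w' i j x = A i j x + 3 * s / S.rad * S.total i j := by
  have hrad := S.rad_pos
  have hsq : 0 < √s := Real.sqrt_pos.2 hs
  have hsq1 : √s ≤ 1 := Real.sqrt_le_one.2 hs1
  set δ₀ := 3 * s / S.rad with hδ₀
  have hδ : 0 < δ₀ := by positivity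
  have hradδ : S.rad * δ₀ = 3 * s := by rw [hδ₀]; field_simp
  have hδs : √δ₀ ≤ Δ * √s := by
    have : √δ₀ = √(3 / S.rad) * √s := by
      rw [← Real.sqrt_mul (by positivity), hδ₀]; congr 1; ring
    rw [this]
    gcongr
  have hΔ0 : 0 ≤ Δ := (Real.sqrt_nonneg _).trans hΔ
  obtain ⟨σ, Y, hσ, hY, hYσ, hYβ, hsch⟩ := hS
  obtain ⟨c₀, hc₀, hInv⟩ := hsch δ₀ hδ (hδs.trans (mul_le_of_le_one_right hΔ0 hsq1))
  obtain ⟨M, hM0, hM⟩ : ∃ M, 0 ≤ M ∧ ∀ l i x, |pd i (v l) x| ≤ M := by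
    choose M hM0 hM using fun l => exists_abs_pd_le ((hv l).of_le (by norm_num)) (hvs l)
    exact ⟨∑ l, M l, Finset.sum_nonneg fun l _ => hM0 l, fun l i x => (hM l i x).trans
      (Finset.single_le_sum (fun l _ => hM0 l) (Finset.mem_univ l))⟩
  set ε := min (√s) (s / (4 * (k * (M + 1) + 1))) with hε
  have hε0 : 0 < ε := lt_min hsq (by positivity)
  have hεs : ε ≤ √s := min_le_left _ _
  have hεM : (k * (M + 1) + 1) * ε ≤ s / 4 := by
    have := min_le_right (√s) (s / (4 * (k * (M + 1) + 1)))
    rw [← hε, le_div_iff₀ (by positivity)] at this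
    linarith
  have hmc := mollConst_nonneg (d := d)
  obtain ⟨ℓ, hℓv, hℓw, hℓA, hℓβ, hℓ⟩ := ((Filter.eventually_all.2 fun l =>
      eventually_moll_C1_close hε0 (hv l) (hvs l)).and
    ((Filter.eventually_all.2 fun l => eventually_moll_C1_close hε0 (hw l) (hws l)).and
    ((Filter.eventually_all.2 fun i => Filter.eventually_all.2 fun j =>
      eventually_abs_moll_sub_le hβ hβ1 hL0 (ε := s / 4) (by positivity) (hAc i j) (hAs i j)
        (hL i j)).and
    (((tendsto_const_mul_rpow hβ (mollConst d * L)).eventually_lt_const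
      (show 0 < s / 8 by positivity)).and self_mem_nhdsWithin)))).exists
  replace hℓ : 0 < ℓ := hℓ
  set v₀ : Fin k → (Fin d → ℝ) → ℝ := fun l => moll ℓ (v l) with hv₀
  set w₀ : Fin d → (Fin d → ℝ) → ℝ := fun l => moll ℓ (w l) with hw₀
  have hv₀h : ∀ l, ∃ B, HolBdd ℓ B (v₀ l) := fun l =>
    exists_holBdd_moll hℓ (hv l).continuous (hvs l)
  have hw₀h : ∀ l, ∃ B, HolBdd ℓ B (w₀ l) := fun l =>
    exists_holBdd_moll hℓ (hw l).continuous (hws l)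
  obtain ⟨K, hK0, hK⟩ : ∃ K, 0 ≤ K ∧ ∀ p : Fin k × Fin d, HolBdd (ℓ / 2) K (pd p.2 (v₀ p.1)) :=
    HolBdd.exists_forall fun p => by
      obtain ⟨B, hB⟩ := hv₀h p.1
      exact ⟨_, hB.pd hℓ p.2⟩
  obtain ⟨K', hK'0, hK'⟩ : ∃ K, 0 ≤ K ∧ ∀ p : Fin d × Fin d, HolBdd (ℓ / 2) K (pd p.2 (w₀ p.1)) :=
    HolBdd.exists_forall fun p => by
      obtain ⟨B, hB⟩ := hw₀h p.1
      exact ⟨_, hB.pd hℓ p.2⟩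
  have hK2 : ∀ l i j, HolBdd (ℓ / 2 / 2) (2 * K / (ℓ / 2)) (pd i (pd j (v₀ l))) :=
    fun l i j => (hK (l, j)).pd (by positivity) i
  have hrem : ∀ i j, ∃ ρ, 0 < ρ ∧ ρ ≤ ℓ / 2 ∧
      HolBdd ρ (11 / 4 * s) (fun x => moll ℓ (A i j) x - metricForm v₀ w₀ i j x) := by
    intro i j
    obtain ⟨B₁, hB₁⟩ := exists_holBdd_moll hℓ (hAc i j) (hAs i j)
    obtain ⟨B₂, hB₂⟩ := holBdd_metricForm (by positivity) (fun l i => hK (l, i))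
      (fun l i => hK' (l, i)) i j
    refine ((hB₁.shrink (by linarith)).sub hB₂).exists_shrink (ε := 5 / 2 * s) (by positivity)
      (fun x => ?_) (by linarith)
    have h1 := hℓA i j x
    have h2 := hD i j x
    have h3 := (abs_metricForm_sub_le hε0.le (hεs.trans hsq1) hM (fun l => (hℓv l).2)
      (fun l => (hℓw l).2) i j x).trans hεM
    rw [abs_le] at h1 h2 h3 ⊢
    constructor <;> linarith
  choose ρ hρ0 hρℓ hρ using hrem
  obtain ⟨R, hR1, hRℓ, hRρ, hRK, hRs, hRσ, hR⟩ := ((eventually_le_of_pos one_pos).and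
    ((eventually_le_of_pos (show 0 < ℓ / 2 / 2 by positivity)).and
    ((Filter.eventually_all.2 fun i => Filter.eventually_all.2 fun j =>
      eventually_le_of_pos (hρ0 i j)).and
    ((eventually_le_of_pos (show 0 < c₀ / (2 * K / (ℓ / 2) + 1) by positivity)).and
    (((tendsto_const_mul_rpow hβ (mollConst d * L)).eventually_lt_const
      (show 0 < s / 8 by positivity)).and
    (((tendsto_const_mul_rpow hβ (mollConst d * L * (1 + σ ^ 2))).eventually_lt_const
      (show 0 < 3 * s / 2 by positivity)).and self_mem_nhdsWithin)))))).exists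
  replace hR : 0 < R := hR
  obtain ⟨Inv, hscheme, hInv₀⟩ := hInv R hR hR1
  have hY0 : 0 < Y := by linarith
  have hσ0 : 0 < σ := by linarith
  have hRq : ∀ q : ℕ, (R / Y ^ q) ^ β ≤ R ^ β / (σ ^ 2) ^ q := by
    intro q
    rw [Real.div_rpow hR.le (by positivity), ← Real.rpow_natCast_mul hY0.le, mul_comm,
      Real.rpow_mul_natCast hY0.le]
    gcongr
  have hRq0 : ∀ q : ℕ, 0 < R / Y ^ q := fun q => by positivity
  obtain ⟨v', w', h1, h2, h3, h4, h5, h6, h7, h8⟩ := hscheme.exists_solution hC hσ hY hR hα hα1 hYσ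
    (G := fun q i j x => moll (R / Y ^ q) (A i j) x + δ₀ * S.total i j)
    (G' := fun i j x => A i j x + δ₀ * S.total i j) (v := v₀) (w := w₀) (K := K) (K' := K')
    (fun q i j x => by
      have : A i j = A j i := funext fun x => hA i j x
      rw [this, S.total_comm])
    (fun q i j => by
      have hle : R / Y ^ (q + 1) ≤ R / Y ^ q := by
        gcongr
        omega
      refine ((holBdd_moll_sub (hRq0 (q + 1)) hle hβ hβ1 hL0 (hAc i j) (hAs i j)
        (hL i j)).weaken ?_).congr fun x => by ring
      calc mollConst d * L * ((R / Y ^ (q + 1)) ^ β + (R / Y ^ q) ^ β)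
          ≤ mollConst d * L * (R ^ β / (σ ^ 2) ^ (q + 1) + R ^ β / (σ ^ 2) ^ q) := by
            gcongr
            · exact hRq _
            · exact hRq _
        _ = mollConst d * L * (1 + σ ^ 2) * R ^ β / (σ ^ 2) ^ (q + 1) := by
            rw [pow_succ (σ ^ 2)]; field_simp
        _ ≤ 3 * s / 2 / (σ ^ 2) ^ (q + 1) := by gcongr
        _ = S.rad * (δ₀ / (σ ^ 2) ^ (q + 1)) / 2 := by rw [← hradδ]; ring)
    (fun i j x => by
      refine Filter.Tendsto.add_const _ ?_
      rw [tendsto_iff_dist_tendsto_zero]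
      have hgeo : Filter.Tendsto (fun q : ℕ => mollConst d * L * R ^ β * ((σ ^ 2)⁻¹) ^ q)
          Filter.atTop (nhds 0) := by
        simpa using (tendsto_pow_atTop_nhds_zero_of_lt_one (by positivity)
          (inv_lt_one_of_one_lt₀ (by nlinarith : 1 < σ ^ 2))).const_mul (mollConst d * L * R ^ β)
      refine squeeze_zero (fun _ => dist_nonneg) (fun q => ?_) hgeo
      rw [Real.dist_eq]
      refine (abs_moll_sub_le (hRq0 q) hβ hβ1 hL0 (hAc i j) (hAs i j) (hL i j) x).trans ?_
      rw [inv_pow, mul_assoc _ (R ^ β), ← div_eq_mul_inv]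
      gcongr
      exact hRq q)
    (fun l => (hv₀h l).elim fun _ h => h.contDiff hℓ)
    (fun l => (hw₀h l).elim fun _ h => h.contDiff hℓ) hK0
    (fun l i => (hK (l, i)).shrink (by linarith)) (fun l i => (hK' (l, i)).shrink (by linarith))
    (hInv₀ v₀ fun l i j => (hK2 l i j).mono hRℓ (by
      rw [le_div_iff₀ (by positivity)] at hRK
      rw [le_div_iff₀ hR]
      nlinarith))
    (fun i j => by
      have hRℓ' : R ≤ ℓ := by linarith
      have h9 := (holBdd_moll_sub hR hRℓ' hβ hβ1 hL0 (hAc i j) (hAs i j) (hL i j)).add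
        ((hρ i j).shrink (hRρ i j))
      refine (h9.weaken ?_).congr fun x => ?_
      · rw [hradδ]
        linarith
      · rw [pow_zero, div_one]
        ring)
  have hCδ : C * √δ₀ ≤ C * Δ * √s := by
    rw [mul_assoc]; gcongr
  have hgs : ∀ x, gradSum v₀ x ≤ gradSum v x + d * k * √s := fun x =>
    (gradSum_le_add (fun l => (hℓv l).2) x).trans (by gcongr)
  have hW : ∀ x, 2 * (C * √δ₀) * (1 + (gradSum v₀ x + d * k * (2 * (C * √δ₀)))) + ε ≤
      (2 * (C * Δ) + 1) * √s * (1 + (gradSum v x + d * k * (2 * (C * Δ) + 1))) := by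
    intro x
    have hg0 := gradSum_nonneg v x
    have hg₀ := gradSum_nonneg v₀ x
    set X := 1 + (gradSum v x + d * k * (2 * (C * Δ) + 1)) with hX
    have hCΔ : 0 ≤ C * Δ := by positivity
    have hX1 : 1 ≤ X := by
      rw [hX]
      have : 0 ≤ (d : ℝ) * k * (2 * (C * Δ) + 1) := by positivity
      linarith
    have hin : 1 + (gradSum v₀ x + d * k * (2 * (C * √δ₀))) ≤ X := by
      have h10 : (d : ℝ) * k * (2 * (C * √δ₀)) ≤ d * k * (2 * (C * Δ * √s)) := by gcongr
      have h11 : (d : ℝ) * k * (√s * (2 * (C * Δ) + 1)) ≤ d * k * (1 * (2 * (C * Δ) + 1)) := by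
        gcongr
      rw [hX]
      linarith [hgs x]
    calc _ ≤ 2 * (C * Δ * √s) * X + √s * X := by
          gcongr
          exact hεs.trans (le_mul_of_one_le_right hsq.le hX1)
      _ = _ := by ring
  have tri : ∀ a b c e₁ e₂ : ℝ, |a - b| ≤ e₁ → |b - c| ≤ e₂ → |a - c| ≤ e₁ + e₂ :=
    fun a b c e₁ e₂ ha hb => (abs_sub_le a b c).trans (add_le_add ha hb)
  refine ⟨v', w', h1, h2, h3, fun l x => ?_, fun l i x => ?_, fun l x => ?_, fun l i x => ?_, h8⟩
  · refine (tri _ _ _ _ _ (h4 l x) ((hℓv l).1 x)).trans ?_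
    linarith
  · refine (tri _ _ _ _ _ (h5 l i x) ((hℓv l).2 i x)).trans ?_
    linarith
  · exact (tri _ _ _ _ _ (h6 l x) ((hℓw l).1 x)).trans (hW x)
  · exact (tri _ _ _ _ _ (h7 l i x) ((hℓw l).2 i x)).trans (hW x)

end CompactlySupported

section Cutoff

variable {d k : ℕ}

open scoped Manifold in
theorem exists_cutoff {K U : Set (Fin d → ℝ)} (hK : IsCompact K) (hU : IsOpen U) (hKU : K ⊆ U) :
    ∃ (χ : (Fin d → ℝ) → ℝ) (T : Set (Fin d → ℝ)), ContDiff ℝ 2 χ ∧ IsCompact T ∧ T ⊆ U ∧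
      (∀ x, 0 ≤ χ x ∧ χ x ≤ 1) ∧ (∀ x, x ∉ T → χ x = 0) ∧
      ∀ x ∈ K, χ =ᶠ[nhds x] fun _ => 1 := by
  obtain ⟨T₁, hT₁, hKT, hTU⟩ := exists_compact_between hK hU hKU
  obtain ⟨T, hT, hT₁T, hTU'⟩ := exists_compact_between hT₁ hU hTU
  obtain ⟨f, h0, h1, h01⟩ := exists_contMDiffMap_zero_one_of_isClosed (n := 2)
    𝓘(ℝ, Fin d → ℝ) (isOpen_interior (s := T)).isClosed_compl hT₁.isClosed
    (Set.disjoint_compl_left_iff_subset.2 hT₁T)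
  refine ⟨f, T, f.contMDiff.contDiff, hT, hTU', fun x => ⟨(h01 x).1, (h01 x).2⟩,
    fun x hx => h0 fun h => hx (interior_subset h), fun x hx => ?_⟩
  filter_upwards [mem_interior_iff_mem_nhds.1 (hKT hx)] with y hy using h1 hy

theorem abs_mul_sub_mul_le {χ f : (Fin d → ℝ) → ℝ} {T : Set (Fin d → ℝ)} {β L L' M : ℝ}
    (hM0 : 0 ≤ M) (hL'0 : 0 ≤ L') (hL0 : 0 ≤ L) (hχ : ∀ x, 0 ≤ χ x ∧ χ x ≤ 1)
    (hT : ∀ x, x ∉ T → χ x = 0)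
    (hL' : ∀ x y, |χ x - χ y| ≤ L' * ‖x - y‖ ^ β) (hL : ∀ x y, |f x - f y| ≤ L * ‖x - y‖ ^ β)
    (hM : ∀ x ∈ T, |f x| ≤ M) (x y : Fin d → ℝ) :
    |χ x * f x - χ y * f y| ≤ (L + M * L') * ‖x - y‖ ^ β := by
  have hr : 0 ≤ ‖x - y‖ ^ β := by positivity
  have key : ∀ x y, y ∈ T → |χ x * f x - χ y * f y| ≤ (L + M * L') * ‖x - y‖ ^ β := by
    intro x y hy
    have e : χ x * f x - χ y * f y = χ x * (f x - f y) + f y * (χ x - χ y) := by ring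
    rw [e]
    refine (abs_add_le _ _).trans ?_
    rw [abs_mul, abs_mul, abs_of_nonneg (hχ x).1]
    calc _ ≤ 1 * (L * ‖x - y‖ ^ β) + M * (L' * ‖x - y‖ ^ β) := by
          gcongr
          · exact (hχ x).2
          · exact hL x y
          · exact hM y hy
          · exact hL' x y
      _ = _ := by ring
  by_cases hy : y ∈ T
  · exact key x y hy
  by_cases hx : x ∈ T
  · rw [abs_sub_comm, norm_sub_rev]
    exact key y x hx
  · rw [hT x hx, hT y hy, zero_mul, zero_mul, sub_zero, abs_zero]
    positivity

theorem pd_eq_of_eventuallyEq {f g : (Fin d → ℝ) → ℝ} {x : Fin d → ℝ} (h : f =ᶠ[nhds x] g)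
    (i : Fin d) : pd i f x = pd i g x := by
  unfold pd
  rw [h.fderiv_eq]

theorem contDiff_metricForm {v : Fin k → (Fin d → ℝ) → ℝ} {w : Fin d → (Fin d → ℝ) → ℝ}
    (hv : ∀ l, ContDiff ℝ 2 (v l)) (hw : ∀ l, ContDiff ℝ 2 (w l)) (i j : Fin d) :
    ContDiff ℝ 1 (metricForm v w i j) :=
  (contDiff_const.mul (ContDiff.sum fun l _ =>
    (contDiff_pd (hv l) i).mul (contDiff_pd (hv l) j))).add
    (((contDiff_pd (hw j) i).add (contDiff_pd (hw i) j)).div_const 2)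

/-- Compactly supported data agreeing with given data on a compact set, with a deficit that is
globally controlled. -/
theorem exists_compactly_supported {K : Set (Fin d → ℝ)} (hK : IsCompact K) {β L s : ℝ}
    (hβ : 0 < β) (hβ1 : β ≤ 1) (hs : 0 < s)
    {v : Fin k → (Fin d → ℝ) → ℝ} {w : Fin d → (Fin d → ℝ) → ℝ}
    {A : Fin d → Fin d → (Fin d → ℝ) → ℝ}
    (hv : ∀ l, ContDiff ℝ 2 (v l)) (hw : ∀ l, ContDiff ℝ 2 (w l))
    (hA : ∀ i j x, A i j x = A j i x) (hAc : ∀ i j, Continuous (A i j)) (hL0 : 0 ≤ L)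
    (hL : ∀ i j x y, |A i j x - A i j y| ≤ L * ‖x - y‖ ^ β)
    (hD : ∀ i j, ∀ x ∈ K, |A i j x - metricForm v w i j x| ≤ s) :
    ∃ (v' : Fin k → (Fin d → ℝ) → ℝ) (w' : Fin d → (Fin d → ℝ) → ℝ)
      (A' : Fin d → Fin d → (Fin d → ℝ) → ℝ) (L' : ℝ),
      (∀ l, ContDiff ℝ 2 (v' l)) ∧ (∀ l, HasCompactSupport (v' l)) ∧
      (∀ l, ContDiff ℝ 2 (w' l)) ∧ (∀ l, HasCompactSupport (w' l)) ∧
      (∀ i j x, A' i j x = A' j i x) ∧ (∀ i j, Continuous (A' i j)) ∧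
      (∀ i j, HasCompactSupport (A' i j)) ∧ 0 ≤ L' ∧
      (∀ i j x y, |A' i j x - A' i j y| ≤ L' * ‖x - y‖ ^ β) ∧
      (∀ i j x, |A' i j x - metricForm v' w' i j x| ≤ 2 * s) ∧
      (∀ x ∈ K, ∀ l, v' l =ᶠ[nhds x] v l) ∧ (∀ x ∈ K, ∀ l, w' l =ᶠ[nhds x] w l) ∧
      ∀ x ∈ K, ∀ i j, A' i j x = A i j x := by
  have hmc := fun i j => contDiff_metricForm hv hw i j
  obtain ⟨χ, T, hχ, hT, hTU, hχ01, hχT, hχK⟩ := exists_cutoff hK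
    (U := ⋂ i, ⋂ j, {x | |A i j x - metricForm v w i j x| < 2 * s})
    (isOpen_iInter_of_finite fun i => isOpen_iInter_of_finite fun j =>
      isOpen_lt ((hAc i j).sub (hmc i j).continuous).abs continuous_const)
    (fun x hx => Set.mem_iInter₂.2 fun i j => by
      have := hD i j x hx
      simp only [Set.mem_ofPred_eq]
      linarith)
  set v' : Fin k → (Fin d → ℝ) → ℝ := fun l x => χ x * v l x with hv'
  set w' : Fin d → (Fin d → ℝ) → ℝ := fun l x => χ x * w l x with hw'
  have hv'c : ∀ l, ContDiff ℝ 2 (v' l) := fun l => hχ.mul (hv l)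
  have hw'c : ∀ l, ContDiff ℝ 2 (w' l) := fun l => hχ.mul (hw l)
  have hzero : ∀ f : (Fin d → ℝ) → ℝ, ∀ x, x ∉ T → χ x * f x = 0 := fun f x hx => by
    rw [hχT x hx, zero_mul]
  have hpd : ∀ f : (Fin d → ℝ) → ℝ, ∀ i x, x ∉ T → pd i (fun x => χ x * f x) x = 0 := by
    intro f i x hx
    have : (fun x => χ x * f x) =ᶠ[nhds x] fun _ => 0 := by
      filter_upwards [hT.isClosed.isOpen_compl.mem_nhds hx] with y hy using hzero f y hy
    rw [pd_eq_of_eventuallyEq this]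
    simp [pd]
  have hvK : ∀ x ∈ K, ∀ f : (Fin d → ℝ) → ℝ, (fun x => χ x * f x) =ᶠ[nhds x] f := by
    intro x hx f
    filter_upwards [hχK x hx] with y hy
    rw [hy, one_mul]
  set g : Fin d → Fin d → (Fin d → ℝ) → ℝ := fun i j x =>
    metricForm v' w' i j x - χ x * metricForm v w i j x with hg
  have hg0 : ∀ i j x, x ∉ T → g i j x = 0 := by
    intro i j x hx
    have h1 : ∀ l i, pd i (v' l) x = 0 := fun l i => hpd _ i x hx
    have h2 : ∀ l i, pd i (w' l) x = 0 := fun l i => hpd _ i x hx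
    simp [hg, metricForm, hχT x hx, h1, h2]
  have hgc : ∀ i j, ContDiff ℝ 1 (g i j) := fun i j =>
    (contDiff_metricForm hv'c hw'c i j).sub ((hχ.of_le (by norm_num)).mul (hmc i j))
  have hgs : ∀ i j, HasCompactSupport (g i j) := fun i j => HasCompactSupport.intro hT (hg0 i j)
  choose Lg hLg0 hLg using fun p : Fin d × Fin d =>
    exists_holder_of_contDiff hβ hβ1 (hgc p.1 p.2) (hgs p.1 p.2)
  obtain ⟨Lχ, hLχ0, hLχ⟩ := exists_holder_of_contDiff hβ hβ1 (hχ.of_le (by norm_num))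
    (HasCompactSupport.intro hT hχT)
  choose M hM using fun p : Fin d × Fin d =>
    hT.exists_bound_of_continuousOn (hAc p.1 p.2).continuousOn
  have hM' : ∀ i j, ∀ x ∈ T, |A i j x| ≤ ∑ p, |M p| := fun i j x hx =>
    ((hM (i, j) x hx).trans (le_abs_self _)).trans
      (Finset.single_le_sum (f := fun p => |M p|) (fun p _ => abs_nonneg _) (Finset.mem_univ _))
  have hM0 : 0 ≤ ∑ p, |M p| := Finset.sum_nonneg fun p _ => abs_nonneg _
  refine ⟨v', w', fun i j x => χ x * A i j x + g i j x, L + (∑ p, |M p|) * Lχ + ∑ p, Lg p,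
    hv'c, fun l => HasCompactSupport.intro hT (hzero _), hw'c,
    fun l => HasCompactSupport.intro hT (hzero _), fun i j x => ?_,
    fun i j => (hχ.continuous.mul (hAc i j)).add (hgc i j).continuous,
    fun i j => HasCompactSupport.intro hT fun x hx => by simp [hχT x hx, hg0 i j x hx],
    ?_, fun i j x y => ?_, fun i j x => ?_, fun x hx l => hvK x hx _, fun x hx l => hvK x hx _,
    fun x hx i j => ?_⟩
  · simp only [hg]
    rw [hA, metricForm_comm v', metricForm_comm v]
  · have := Finset.sum_nonneg fun p (_ : p ∈ Finset.univ) => hLg0 p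
    positivity
  · have h1 := abs_mul_sub_mul_le hM0 hLχ0 hL0 hχ01 hχT hLχ (hL i j) (hM' i j) x y
    have h2 := hLg (i, j) x y
    have h3 : Lg (i, j) * ‖x - y‖ ^ β ≤ (∑ p, Lg p) * ‖x - y‖ ^ β := by
      gcongr
      exact Finset.single_le_sum (fun p _ => hLg0 p) (Finset.mem_univ _)
    have e : χ x * A i j x + g i j x - (χ y * A i j y + g i j y) =
      (χ x * A i j x - χ y * A i j y) + (g i j x - g i j y) := by ring
    rw [e, add_mul]
    exact (abs_add_le _ _).trans (add_le_add h1 (h2.trans h3))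
  · have e : χ x * A i j x + g i j x - metricForm v' w' i j x =
      χ x * (A i j x - metricForm v w i j x) := by simp only [hg]; ring
    rw [e]
    by_cases hx : x ∈ T
    · have h1 : |A i j x - metricForm v w i j x| < 2 * s := Set.mem_iInter₂.1 (hTU hx) i j
      rw [abs_mul, abs_of_nonneg (hχ01 x).1]
      calc _ ≤ 1 * (2 * s) := mul_le_mul (hχ01 x).2 h1.le (abs_nonneg _) zero_le_one
        _ = _ := one_mul _
    · rw [hχT x hx, zero_mul, abs_zero]
      positivity
  · have h1 : χ x = 1 := (hχK x hx).eq_of_nhds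
    have h2 : metricForm v' w' i j x = metricForm v w i j x := by
      simp only [metricForm, hv', hw', pd_eq_of_eventuallyEq (hvK x hx _)]
    simp only [hg]
    rw [h1, h2]
    ring

end Cutoff

section Assembly

variable {d k : ℕ}

theorem fderiv_apply_single {m : ℕ} {f : (Fin d → ℝ) → Fin m → ℝ}
    (hf : ∀ l, Differentiable ℝ (fun x => f x l)) (x : Fin d → ℝ) (i : Fin d) (l : Fin m) :
    fderiv ℝ f x (Pi.single i 1) l = pd i (fun y => f y l) x := by
  rw [fderiv_pi fun l => hf l x]
  rfl

theorem norm_fderiv_le {m : ℕ} {f : (Fin d → ℝ) → Fin m → ℝ}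
    (hf : ∀ l, Differentiable ℝ (fun x => f x l)) {x : Fin d → ℝ} {B : ℝ} (hB : 0 ≤ B)
    (h : ∀ i l, |pd i (fun y => f y l) x| ≤ B) : ‖fderiv ℝ f x‖ ≤ d * B := by
  refine (norm_clm_le_sum _).trans ((Finset.sum_le_sum fun i _ =>
    (pi_norm_le_iff_of_nonneg hB).2 fun l => ?_).trans_eq (by simp))
  rw [fderiv_apply_single hf]
  exact h i l

theorem holderWith_of_norm_sub_le {E : Type*} [NormedAddCommGroup E] {f : (Fin d → ℝ) → E}
    {H α : ℝ} (hα : 0 ≤ α) (hH : 0 ≤ H) (h : ∀ x y, ‖f x - f y‖ ≤ H * ‖x - y‖ ^ α) :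
    HolderWith H.toNNReal α.toNNReal f := by
  intro x y
  rw [edist_dist, edist_dist, Real.coe_toNNReal _ hα, dist_eq_norm, dist_eq_norm,
    ENNReal.ofReal_rpow_of_nonneg (norm_nonneg _) hα]
  change _ ≤ ENNReal.ofReal H * _
  rw [← ENNReal.ofReal_mul hH]
  exact ENNReal.ofReal_le_ofReal (h x y)

theorem isC1Holder_of_pd {m : ℕ} {f : (Fin d → ℝ) → Fin m → ℝ} {H α : ℝ} (hα : 0 < α)
    (hH : 0 ≤ H) (hf : ∀ l, Differentiable ℝ (fun x => f x l))
    (h : ∀ l i x y, |pd i (fun z => f z l) x - pd i (fun z => f z l) y| ≤ H * ‖x - y‖ ^ α) :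
    IsC1Holder α f := by
  have hh : HolderWith (d * H).toNNReal α.toNNReal (fderiv ℝ f) := by
    refine holderWith_of_norm_sub_le hα.le (by positivity) fun x y => ?_
    have hr : 0 ≤ H * ‖x - y‖ ^ α := by positivity
    refine (norm_clm_le_sum _).trans ((Finset.sum_le_sum fun i _ =>
      (pi_norm_le_iff_of_nonneg hr).2 fun l => ?_).trans_eq (by simp [mul_assoc]))
    rw [_root_.sub_apply, Pi.sub_apply, fderiv_apply_single hf, fderiv_apply_single hf]
    exact h l i x y
  refine ⟨contDiff_one_iff_fderiv.2 ⟨differentiable_pi.2 hf, hh.continuous ?_⟩, _, hh⟩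
  exact Real.toNNReal_pos.2 hα

theorem bddAbove_norm {E : Type*} [NormedAddCommGroup E] {K : Set (Fin d → ℝ)} (hK : IsCompact K)
    {f : (Fin d → ℝ) → E} (hf : Continuous f) : BddAbove (Set.range fun x : K => ‖f x.1‖) := by
  obtain ⟨M, hM⟩ := hK.exists_bound_of_continuousOn hf.continuousOn
  refine ⟨M, ?_⟩
  rintro _ ⟨x, rfl⟩
  exact hM x.1 x.2

theorem C1Norm_le {m : ℕ} {ω : Set (Fin d → ℝ)} (hω : ω.Nonempty) {f : (Fin d → ℝ) → Fin m → ℝ}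
    (hf : ∀ l, Differentiable ℝ (fun x => f x l)) {B : ℝ} (hB : 0 ≤ B)
    (h0 : ∀ x ∈ closure ω, ∀ l, |f x l| ≤ B)
    (h1 : ∀ x ∈ closure ω, ∀ i l, |pd i (fun y => f y l) x| ≤ B) :
    C1Norm ω f ≤ (1 + d) * B := by
  have : Nonempty (closure ω) := hω.closure.to_subtype
  have e1 : supNorm ω f ≤ B :=
    ciSup_le fun x => (pi_norm_le_iff_of_nonneg hB).2 fun l => h0 x.1 x.2 l
  have e2 : grad1Norm ω f ≤ d * B := ciSup_le fun x => norm_fderiv_le hf hB (h1 x.1 x.2)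
  unfold C1Norm
  linarith

theorem gradSum_le_grad1Norm {ω : Set (Fin d → ℝ)} (hω : IsCompact (closure ω))
    {v : (Fin d → ℝ) → Fin k → ℝ} (hv : ContDiff ℝ 2 v) {x : Fin d → ℝ} (hx : x ∈ closure ω) :
    gradSum (fun l y => v y l) x ≤ d * k * grad1Norm ω v := by
  have h1 : ‖fderiv ℝ v x‖ ≤ grad1Norm ω v :=
    le_ciSup (bddAbove_norm hω (hv.continuous_fderiv two_ne_zero)) ⟨x, hx⟩
  have h2 : ∀ l i, |pd i (fun y => v y l) x| ≤ grad1Norm ω v := by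
    intro l i
    rw [← fderiv_apply_single fun l => (contDiff_pi.1 hv l).differentiable two_ne_zero]
    refine (norm_le_pi_norm (fderiv ℝ v x (Pi.single i 1)) l).trans ?_
    refine ((fderiv ℝ v x).le_opNorm _).trans ?_
    rwa [Pi.norm_single, norm_one, mul_one]
  unfold gradSum
  refine (Finset.sum_le_sum fun l _ => Finset.sum_le_sum fun i _ => h2 l i).trans_eq ?_
  simp only [Finset.sum_const, Finset.card_univ, Fintype.card_fin, nsmul_eq_mul]
  ring

theorem deficit_eq_sub_metricForm (A : (Fin d → ℝ) → Fin d → Fin d → ℝ)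
    (v : (Fin d → ℝ) → Fin k → ℝ) (w : (Fin d → ℝ) → Fin d → ℝ) (x : Fin d → ℝ) (i j : Fin d) :
    deficit A v w x i j =
      A x i j - metricForm (fun l y => v y l) (fun l y => w y l) i j x := rfl

theorem abs_deficit_le {ω : Set (Fin d → ℝ)} (hω : IsCompact (closure ω))
    {A : (Fin d → ℝ) → Fin d → Fin d → ℝ} (hA : Continuous A)
    {v : (Fin d → ℝ) → Fin k → ℝ} {w : (Fin d → ℝ) → Fin d → ℝ} (hv : ContDiff ℝ 2 v)
    (hw : ContDiff ℝ 2 w) {x : Fin d → ℝ} (hx : x ∈ closure ω) (i j : Fin d) :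
    |deficit A v w x i j| ≤ supNorm ω (deficit A v w) := by
  have hc : Continuous (deficit A v w) :=
    continuous_pi fun i => continuous_pi fun j =>
      ((continuous_apply j).comp ((continuous_apply i).comp hA)).sub
        (contDiff_metricForm (contDiff_pi.1 hv) (contDiff_pi.1 hw) i j).continuous
  exact ((norm_le_pi_norm (deficit A v w x i) j).trans (norm_le_pi_norm _ i)).trans
    (le_ciSup (bddAbove_norm hω hc) ⟨x, hx⟩)

end Assembly

section Correction

variable {d k : ℕ}

theorem pd_sub_linear {f : (Fin d → ℝ) → ℝ} (hf : Differentiable ℝ f) (c : ℝ) (m : Fin d → ℝ)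
    (i : Fin d) (x : Fin d → ℝ) :
    pd i (fun y => f y - c * ∑ j, m j * y j) x = pd i f x - c * m i := by
  have hm := (smooth_sum_mul m).differentiable
  rw [pd_sub hf (hm.const_mul c), pd_const_mul hm, pd_sum_mul]

theorem metricForm_sub_linear {v : Fin k → (Fin d → ℝ) → ℝ} {w : Fin d → (Fin d → ℝ) → ℝ}
    (hw : ∀ l, Differentiable ℝ (w l)) (c : ℝ) {T : Fin d → Fin d → ℝ}
    (hT : ∀ i j, T i j = T j i) (i j : Fin d) (x : Fin d → ℝ) :
    metricForm v (fun l y => w l y - c * ∑ j, T l j * y j) i j x =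
      metricForm v w i j x - c * T i j := by
  unfold metricForm
  rw [pd_sub_linear (hw j), pd_sub_linear (hw i), hT j i]
  ring

theorem abs_sum_mul_le {T : Fin d → Fin d → ℝ} {r : ℝ} {x : Fin d → ℝ} (hx : ‖x‖ ≤ r)
    (i : Fin d) : |∑ j, T i j * x j| ≤ (∑ i, ∑ j, |T i j|) * r := by
  have hr : 0 ≤ r := (norm_nonneg x).trans hx
  calc |∑ j, T i j * x j| ≤ ∑ j, |T i j| * r := by
        refine (Finset.abs_sum_le_sum_abs _ _).trans (Finset.sum_le_sum fun j _ => ?_)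
        rw [abs_mul]
        gcongr
        exact (norm_le_pi_norm x j).trans hx
    _ = (∑ j, |T i j|) * r := by rw [Finset.sum_mul]
    _ ≤ _ := mul_le_mul_of_nonneg_right
        (Finset.single_le_sum (f := fun i => ∑ j, |T i j|)
          (fun _ _ => Finset.sum_nonneg fun _ _ => abs_nonneg _) (Finset.mem_univ i)) hr

theorem abs_le_sum_sum (T : Fin d → Fin d → ℝ) (i j : Fin d) : |T i j| ≤ ∑ i, ∑ j, |T i j| :=
  (Finset.single_le_sum (f := fun j => |T i j|) (fun _ _ => abs_nonneg _)
    (Finset.mem_univ j)).trans (Finset.single_le_sum (f := fun i => ∑ j, |T i j|)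
      (fun _ _ => Finset.sum_nonneg fun _ _ => abs_nonneg _) (Finset.mem_univ i))

theorem abs_sub_linear_le {a b c t u e E : ℝ} (hc : 0 ≤ c) (h : |a - b| ≤ e) (ht : |t| ≤ u)
    (hE : c * u ≤ E) : |a - c * t - b| ≤ e + E := by
  have e1 : a - c * t - b = (a - b) - c * t := by ring
  have h1 : |c * t| ≤ c * u := by
    rw [abs_mul, abs_of_nonneg hc]
    gcongr
  rw [e1]
  exact (abs_sub _ _).trans (add_le_add h (h1.trans hE))

end Correction

/-- Corollary 4.2: the Nash–Kuiper scheme in `C^{1,α}` for the von Kármán system,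
with `α < min{β/2, 1/(1+2d_*/k)}` (or `α < min{β/2, 1}` when `k ≥ d(d+1)`),
where `2d_*/k = d(d+1)/k`. Constants `C` depend only on `d`, `k` and `ω`. -/
theorem NashKuiper_Holder
    {d k : ℕ} (hd : 1 ≤ d) (hk : 1 ≤ k)
    (ω : Set (Fin d → ℝ)) (hω : IsOpen ω) (hωbd : Bornology.IsBounded ω)
    (hωne : ω.Nonempty) :
    ∃ C : ℝ, 0 < C ∧
      ∀ (v : (Fin d → ℝ) → Fin k → ℝ) (w : (Fin d → ℝ) → Fin d → ℝ)
        (A : (Fin d → ℝ) → Fin d → Fin d → ℝ) (β : ℝ),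
        0 < β → β ≤ 1 →
        ContDiff ℝ 2 v → ContDiff ℝ 2 w →
        IsHolder β A → (∀ x i j, A x i j = A x j i) →
        0 < supNorm ω (deficit A v w) → supNorm ω (deficit A v w) ≤ 1 →
        ∀ α : ℝ, 0 < α →
        (α < min (β / 2) (1 / (1 + (d : ℝ) * ((d : ℝ) + 1) / (k : ℝ)))
          ∨ (d * (d + 1) ≤ k ∧ α < min (β / 2) 1)) →
        ∃ (vt : (Fin d → ℝ) → Fin k → ℝ) (wt : (Fin d → ℝ) → Fin d → ℝ),
          IsC1Holder α vt ∧ IsC1Holder α wt ∧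
          C1Norm ω (fun x => vt x - v x)
              ≤ C * supNorm ω (deficit A v w) ^ (1/2 : ℝ) ∧
          C1Norm ω (fun x => wt x - w x)
              ≤ C * supNorm ω (deficit A v w) ^ (1/2 : ℝ) * (1 + grad1Norm ω v) ∧
          ∀ x ∈ closure ω, ∀ i j, deficit A vt wt x i j = 0 := by
  obtain ⟨N, η, L, hN, hη, hsum⟩ := exists_rankOne_basis d
  let S : RankOneBasis d N := ⟨η, L, hη, hsum⟩
  have hrad := S.rad_pos
  have hK : IsCompact (closure ω) := hωbd.isCompact_closure
  obtain ⟨C₀, hC₀, hscheme⟩ := S.exists_hasScheme (k := k) hN hd hk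
    (le_max_left 1 √(3 / S.rad))
  set Δ := max 1 √(3 / S.rad) with hΔ
  have hΔ1 : 1 ≤ Δ := le_max_left _ _
  obtain ⟨r₀, hr₀⟩ := hK.isBounded.exists_norm_le
  set r := max 1 r₀ with hr
  have hr1 : 1 ≤ r := le_max_left _ _
  set Tt := ∑ i, ∑ j, |S.total i j| with hTt
  have hTt0 : 0 ≤ Tt := Finset.sum_nonneg fun _ _ => Finset.sum_nonneg fun _ _ => abs_nonneg _
  set B := 2 * (C₀ * Δ) + 1 with hB
  have hB1 : 1 ≤ B := by
    have : 0 ≤ C₀ * Δ := by positivity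
    linarith
  set E := 3 / S.rad * (Tt * r) with hE
  have hE0 : 0 ≤ E := by positivity
  set X := 1 + (d : ℝ) * k + d * k * B with hX
  have hX1 : 1 ≤ X := by
    have : 0 ≤ (d : ℝ) * k + d * k * B := by positivity
    linarith
  have hBX : B ≤ B * X := le_mul_of_one_le_right (by linarith) hX1
  refine ⟨(1 + d) * (B * X + E), by positivity, fun v w A β hβ hβ1 hv hw hAβ hAsymm hs hs1 α hα
    hαβ => ?_⟩
  have hα1 : α ≤ 1 := by
    rcases hαβ with h | ⟨_, h⟩ <;> linarith [(lt_min_iff.1 h).1]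
  set s := supNorm ω (deficit A v w) with hsdef
  have hsq : 0 < √s := Real.sqrt_pos.2 hs
  have hsle : s ≤ √s := Real.le_sqrt_of_sq_le (by nlinarith)
  rw [← Real.sqrt_eq_rpow]
  obtain ⟨C', hC'C, hC'0, hS⟩ := hscheme α β hα hβ hαβ
  obtain ⟨H, hH⟩ := hAβ
  have hAc : Continuous A := hH.continuous (Real.toNNReal_pos.2 hβ)
  have hAL : ∀ i j x y, |A x i j - A y i j| ≤ H * ‖x - y‖ ^ β := by
    intro i j x y
    have h1 := hH.dist_le x y
    rw [Real.coe_toNNReal _ hβ.le, dist_eq_norm, dist_eq_norm] at h1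
    exact ((norm_le_pi_norm ((A x - A y) i) j).trans (norm_le_pi_norm (A x - A y) i)).trans h1
  obtain ⟨v₁, w₁, A₁, L₁, hv₁, hv₁s, hw₁, hw₁s, hA₁, hA₁c, hA₁s, hL₁, hA₁L, hD₁, hvK, hwK, hAK⟩ :=
    exists_compactly_supported hK hβ hβ1 hs (v := fun l y => v y l) (w := fun l y => w y l)
      (A := fun i j x => A x i j) (contDiff_pi.1 hv) (contDiff_pi.1 hw)
      (fun i j x => hAsymm x i j)
      (fun i j => (continuous_apply j).comp ((continuous_apply i).comp hAc)) H.coe_nonneg hAL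
      (fun i j x hx => abs_deficit_le hK hAc hv hw hx i j)
  obtain ⟨v', w', hv'd, hw'd, ⟨M, hM0, hMv, hMw⟩, h4, h5, h6, h7, h8⟩ :=
    hS.exists_solution hC'0 (le_max_right _ _) hα hα1 hβ hβ1 hs hs1 hv₁ hv₁s hw₁ hw₁s hA₁ hA₁c
      hA₁s hL₁ hA₁L hD₁
  set B' := 2 * (C' * Δ) + 1 with hB'
  have hB'0 : 0 ≤ B' := by positivity
  have hB'B : B' ≤ B := by
    have : C' * Δ ≤ C₀ * Δ := by gcongr
    linarith
  set c := 3 * s / S.rad with hc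
  have hc0 : 0 ≤ c := by positivity
  have hcE : c * (Tt * r) ≤ E * √s := by
    calc c * (Tt * r) = E * s := by rw [hc, hE]; ring
      _ ≤ E * √s := by gcongr
  set g := grad1Norm ω v with hg
  have hg0 : 0 ≤ g := Real.iSup_nonneg fun _ => norm_nonneg _
  have hpdv : ∀ x ∈ closure ω, ∀ i l, pd i (v₁ l) x = pd i (fun y => v y l) x :=
    fun x hx i l => pd_eq_of_eventuallyEq (hvK x hx l) i
  have hpdw : ∀ x ∈ closure ω, ∀ i l, pd i (w₁ l) x = pd i (fun y => w y l) x :=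
    fun x hx i l => pd_eq_of_eventuallyEq (hwK x hx l) i
  have hvd : ∀ l, Differentiable ℝ fun y => v y l := fun l =>
    (contDiff_pi.1 hv l).differentiable two_ne_zero
  have hwd : ∀ l, Differentiable ℝ fun y => w y l := fun l =>
    (contDiff_pi.1 hw l).differentiable two_ne_zero
  have hlin : ∀ l, Differentiable ℝ fun y : Fin d → ℝ => c * ∑ j, S.total l j * y j := fun l =>
    (smooth_sum_mul (S.total l)).differentiable.const_mul c
  have hbv : B' * √s ≤ (B * X + E) * √s := by
    gcongr
    linarith
  have hbw : ∀ x ∈ closure ω, B' * √s * (1 + (gradSum v₁ x + d * k * B')) + E * √s ≤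
      (B * X + E) * √s * (1 + g) := by
    intro x hx
    have h9 : gradSum v₁ x ≤ d * k * g := by
      refine le_of_eq_of_le ?_ (gradSum_le_grad1Norm hK hv hx)
      unfold gradSum
      simp_rw [hpdv x hx]
    have h10 : (d : ℝ) * k * B' ≤ d * k * B := by gcongr
    have h11 : 1 + (gradSum v₁ x + d * k * B') ≤ X * (1 + g) := by
      have h13 : 0 ≤ (1 + d * k * B) * g := by positivity
      have h14 : (0 : ℝ) ≤ d * k := by positivity
      rw [hX]
      linarith
    have h12 := gradSum_nonneg v₁ x
    calc _ ≤ B * √s * (X * (1 + g)) + E * √s * (1 + g) := by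
          refine add_le_add ?_ (le_mul_of_one_le_right (by positivity) (by linarith))
          gcongr
      _ = _ := by ring
  refine ⟨fun x l => v' l x, fun x l => w' l x - c * ∑ j, S.total l j * x j,
    isC1Holder_of_pd hα hM0 hv'd hMv,
    isC1Holder_of_pd hα hM0 (fun l => (hw'd l).sub (hlin l)) fun l i x y => ?_, ?_, ?_,
    fun x hx i j => ?_⟩
  · rw [pd_sub_linear (hw'd l), pd_sub_linear (hw'd l), sub_sub_sub_cancel_right]
    exact hMw l i x y
  · refine (C1Norm_le hωne (B := (B * X + E) * √s) (fun l => (hv'd l).sub (hvd l)) (by positivity)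
      (fun x hx l => ?_) fun x hx i l => ?_).trans_eq (by ring)
    · have := h4 l x
      rw [(hvK x hx l).eq_of_nhds] at this
      exact this.trans hbv
    · have := h5 l i x
      rw [hpdv x hx] at this
      have e := pd_sub (hv'd l) (hvd l) i x
      exact (le_of_eq (congrArg abs e)).trans (this.trans hbv)
  · refine (C1Norm_le hωne (B := (B * X + E) * √s * (1 + g))
      (fun l => ((hw'd l).sub (hlin l)).sub (hwd l)) (by positivity)
      (fun x hx l => ?_) fun x hx i l => ?_).trans_eq (by ring)
    · have h9 := h6 l x
      rw [(hwK x hx l).eq_of_nhds] at h9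
      exact (abs_sub_linear_le hc0 h9
        (abs_sum_mul_le ((hr₀ x hx).trans (le_max_right _ _)) l) hcE).trans (hbw x hx)
    · have h9 := h7 l i x
      rw [hpdw x hx] at h9
      have e := pd_sub ((hw'd l).sub (hlin l)) (hwd l) i x
      have e' := pd_sub_linear (hw'd l) c (S.total l) i x
      refine (le_of_eq (congrArg abs (e.trans (congrArg (· - _) e')))).trans ?_
      refine (abs_sub_linear_le hc0 h9 (abs_le_sum_sum S.total l i) ?_).trans (hbw x hx)
      exact (mul_le_mul_of_nonneg_left (le_mul_of_one_le_right hTt0 hr1) hc0).trans hcE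
  · rw [deficit_eq_sub_metricForm]
    refine sub_eq_zero.2 ((metricForm_sub_linear hw'd c S.total_comm i j x).trans ?_).symm
    rw [h8, add_sub_cancel_right]
    exact hAK x hx i j
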